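/- arXiv:math/0505570 — 3 statements merged into one kernel-verified Lean document; each statement's English description precedes it below -/
import Mathlib

section
/- Let $V$ be a vector space over a field of characteristic zero with $\dim V \geq N+2$, where $N - s$ is odd, say $N = 2p + s + 1$. Embed exterior powers in tensor powers by antisymmetrization. For $\alpha \in \mathrm{Hom}(\wedge^N V, V^{\otimes N-s})$, define $\{\mathbf{1}, \alpha\} = \mathbf{1} \otimes \alpha + (-1)^s \alpha \otimes \mathbf{1} : \wedge^{N+1} V \to V^{\otimes N+1-s}$. Then the image of $\{\mathbf{1}, \alpha\}$ is contained in $\wedge^{N+1-s} V$ if and only if $\alpha = \underline{\mathbf{1}^{2p} L}$ for some linear map $L : \wedge^{s+1} V \to V$, where $\underline{\mathbf{1}^{2p} L} = \sum_{i+j = 2p,\, i,j \text{ even}} \mathbf{1}^{\otimes i} \otimes L \otimes \mathbf{1}^{\otimes j}$ summed over all placements of $L$ at even positions in blocks of size $2$. -/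
open scoped TensorProduct
open PiTensorProduct

namespace PBW10


variable (k V : Type) [Field k] [CharZero k] [AddCommGroup V] [Module k V]

/-- The pure tensor `x 0 ⊗ ⋯ ⊗ x (n-1)` in `V^{⊗n}`. -/
noncomputable def tpN (n : ℕ) (x : ℕ → V) : ⨂[k]^n V := tprod k fun i : Fin n => x i

/-- The total antisymmetrization `∑_{σ ∈ S_n} sgn σ • x_{σ(0)} ⊗ ⋯ ⊗ x_{σ(n-1)}`,
the image of `x 0 ∧ ⋯ ∧ x (n-1)` under the embedding `∧ⁿ V ⊆ V^{⊗n}`. -/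
noncomputable def asymN (n : ℕ) (x : ℕ → V) : ⨂[k]^n V :=
  ∑ σ : Equiv.Perm (Fin n), (Equiv.Perm.sign σ : ℤ) • tprod k (fun i : Fin n => x (σ i))

/-- The image of `∧ⁿ V` in `V^{⊗n}` under total antisymmetrization. -/
noncomputable def wedgeIm (n : ℕ) : Submodule k (⨂[k]^n V) :=
  Submodule.span k (Set.range (asymN k V n))

/-- `x 0 ∧ ⋯ ∧ x (n-1)` as an element of the subspace `∧ⁿ V ⊆ V^{⊗n}`. -/
noncomputable def wdgN (n : ℕ) (x : ℕ → V) : wedgeIm k V n :=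
  ⟨asymN k V n x, Submodule.subset_span ⟨x, rfl⟩⟩

/-- Permute the first `n` entries of the sequence `x` by `σ`. -/
def permt {n : ℕ} (σ : Equiv.Perm (Fin n)) (x : ℕ → V) : ℕ → V :=
  fun m => if h : m < n then x (σ ⟨m, h⟩) else x m

/-- Remove the `j`-th entry of the sequence `x`. -/
def removeN (j : ℕ) (x : ℕ → V) : ℕ → V := fun m => if m < j then x m else x (m + 1)

/-- Prepend the entry `v` at the front of the sequence `x`. -/
def consT (v : V) (x : ℕ → V) : ℕ → V := fun m => if m = 0 then v else x (m - 1)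

/-- Replace the `p`-th entry of the sequence `x` by `v`. -/
def putAt (p : ℕ) (x : ℕ → V) (v : V) : ℕ → V := fun m => if m = p then v else x m


/-- The map `V^{⊗m} → V^{⊗(m+1)}`, `t ↦ v ⊗ t`. -/
noncomputable def prepend (m : ℕ) (v : V) : ⨂[k]^m V →ₗ[k] ⨂[k]^(m+1) V :=
  (TensorPower.cast k V (Nat.add_comm 1 m)).toLinearMap ∘ₗ
    (TensorPower.mulEquiv (R := k) (M := V) (n := 1) (m := m)).toLinearMap ∘ₗ
      TensorProduct.mk k (⨂[k]^1 V) (⨂[k]^m V) (tprod k fun _ : Fin 1 => v)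

/-- The map `V^{⊗m} → V^{⊗(m+1)}`, `t ↦ t ⊗ v`. -/
noncomputable def append (m : ℕ) (v : V) : ⨂[k]^m V →ₗ[k] ⨂[k]^(m+1) V :=
  (TensorPower.mulEquiv (R := k) (M := V) (n := m) (m := 1)).toLinearMap ∘ₗ
    (TensorProduct.mk k (⨂[k]^m V) (⨂[k]^1 V)).flip (tprod k fun _ : Fin 1 => v)


/-- `(𝟙 ⊗ α)` applied to the antisymmetrization of `x_0, …, x_{m+s}`, via the expansion
`∧^{N+1} V ⊆ V ⊗ ∧^N V` (where `N = m + s` and `α : ∧^N V → V^{⊗m}`). -/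
noncomputable def oneTA (m s : ℕ) (α : wedgeIm k V (m + s) →ₗ[k] ⨂[k]^m V) (x : ℕ → V) :
    ⨂[k]^(m+1) V :=
  ∑ j ∈ Finset.range (m + s + 1),
    ((-1 : ℤ) ^ j) • prepend k V m (x j) (α (wdgN k V (m + s) (removeN V j x)))

/-- `(α ⊗ 𝟙)` applied to the antisymmetrization of `x_0, …, x_{m+s}`, via the expansion
`∧^{N+1} V ⊆ ∧^N V ⊗ V`. -/
noncomputable def taOne (m s : ℕ) (α : wedgeIm k V (m + s) →ₗ[k] ⨂[k]^m V) (x : ℕ → V) :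
    ⨂[k]^(m+1) V :=
  ∑ j ∈ Finset.range (m + s + 1),
    ((-1 : ℤ) ^ (m + s - j)) • append k V m (x j) (α (wdgN k V (m + s) (removeN V j x)))

/-- The monomial `𝟙^{⊗2a} ⊗ L ⊗ 𝟙^{⊗2b}` applied to a sequence: `L` (alternating, with
`s+1` arguments) consumes the `s+1` consecutive entries starting at position `2a`, and the
remaining entries are kept. -/
def blockEv (s : ℕ) (L : AlternatingMap k V V (Fin (s + 1))) (a : ℕ) (y : ℕ → V) :
    ℕ → V :=
  fun n =>
    if n < 2 * a then y n
    else if n = 2 * a then L (fun i : Fin (s + 1) => y (2 * a + i))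
    else y (n + s)

end PBW10


namespace PBWCore
open Function

lemma const_of_replace {τ ι M : Type*} [Fintype τ] [DecidableEq τ] [DecidableEq ι]
    (W : Finset ι) (hW : Fintype.card τ < W.card) (φ : (τ → ι) → M)
    (h : ∀ v : τ → ι, Injective v → (∀ i, v i ∈ W) → ∀ i c, c ∈ W → (∀ l, v l ≠ c) →
      φ (update v i c) = φ v)
    (v v' : τ → ι) (hv : Injective v) (hvW : ∀ i, v i ∈ W)
    (hv' : Injective v') (hvW' : ∀ i, v' i ∈ W) : φ v = φ v' := by
  have inj_upd : ∀ (u : τ → ι), Injective u → ∀ i c, (∀ l, u l ≠ c) → Injective (update u i c) := by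
    intro u hu i c hc a b hab
    by_cases ha : a = i <;> by_cases hb : b = i
    · rw [ha, hb]
    · subst ha; rw [update_self, update_of_ne hb] at hab; exact absurd hab.symm (hc b)
    · subst hb; rw [update_self, update_of_ne ha] at hab; exact absurd hab (hc a)
    · rw [update_of_ne ha, update_of_ne hb] at hab; exact hu hab
  have W_upd : ∀ (u : τ → ι), (∀ i, u i ∈ W) → ∀ i c, c ∈ W → ∀ l, update u i c l ∈ W := by
    intro u hu i c hc l
    by_cases hl : l = i
    · subst hl; rwa [update_self]
    · rw [update_of_ne hl]; exact hu l
  induction hn : (Finset.univ.filter fun i => v i ≠ v' i).card using Nat.strong_induction_on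
    generalizing v with
  | _ n ih =>
    by_cases hall : ∀ i, v i = v' i
    · rw [funext hall]
    push Not at hall
    obtain ⟨i, hi⟩ := hall
    by_cases hr : ∀ l, v l ≠ v' i
    · rw [← h v hv hvW i (v' i) (hvW' i) hr]
      refine ih _ ?_ _ (inj_upd v hv i _ hr) (W_upd v hvW i _ (hvW' i)) rfl
      rw [← hn]
      apply Finset.card_lt_card
      refine ⟨fun l => ?_, fun hsub => ?_⟩
      · by_cases hl : l = i
        · subst hl; simp
        · simp [update_of_ne hl]
      · have := hsub (x := i) (by simpa using hi)
        simp at this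
    · push Not at hr
      obtain ⟨l, hl⟩ := hr
      have hli : l ≠ i := by rintro rfl; exact hi hl
      obtain ⟨c, hcW, hc⟩ : ∃ c ∈ W, ∀ a, v a ≠ c := by
        have : (Finset.univ.image v).card < W.card :=
          lt_of_le_of_lt Finset.card_image_le (by simpa using hW)
        obtain ⟨c, hc, hc'⟩ := Finset.exists_mem_notMem_of_card_lt_card this
        exact ⟨c, hc, fun a ha => hc' (by simp [← ha])⟩
      have hv1 := inj_upd v hv l c hc
      have hW1 := W_upd v hvW l c hcW
      have hr1 : ∀ a, update v l c a ≠ v' i := by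
        intro a
        by_cases ha : a = l
        · subst ha; rw [update_self]; rw [← hl]; exact (hc a).symm
        · rw [update_of_ne ha, ← hl]; exact fun e => ha (hv e)
      rw [← h v hv hvW l c hcW hc, ← h _ hv1 hW1 i (v' i) (hvW' i) hr1]
      refine ih _ ?_ _ (inj_upd _ hv1 i _ hr1) (W_upd _ hW1 i _ (hvW' i)) rfl
      rw [← hn]
      apply Finset.card_lt_card
      refine ⟨fun a => ?_, fun hsub => ?_⟩
      · by_cases hai : a = i
        · subst hai; simp
        · by_cases hal : a = l
          · subst hal
            simp only [Finset.mem_filter, Finset.mem_univ, true_and]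
            intro _ e
            rw [hl] at e
            exact hai (hv' e).symm
          · simp [update_of_ne hai, update_of_ne hal]
      · have := hsub (x := i) (by simpa using hi)
        simp at this

/-- A function on injective tuples with the exchange property is a sum of one-variable functions. -/
lemma exists_sum {ι k : Type*} [DecidableEq ι] [Field k] [CharZero k] (p : ℕ)
    (W : Finset ι) (hW : 2 * p + 3 ≤ W.card) (h : (Fin (p + 1) → ι) → k)
    (hex : ∀ (i i' : Fin (p + 1)) (a b : ι) (X Y : Fin p → ι), a ∈ W → b ∈ W →
      (∀ l, X l ∈ W) → (∀ l, Y l ∈ W) → a ≠ b →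
      Injective X → Injective Y → (∀ l, X l ≠ a) → (∀ l, X l ≠ b) → (∀ l, Y l ≠ a) →
      (∀ l, Y l ≠ b) → (∀ l l', X l ≠ Y l') →
      h (i.insertNth a X) - h (i.insertNth b X) = h (i'.insertNth a Y) - h (i'.insertNth b Y)) :
    ∃ g : ι → k, ∀ u : Fin (p + 1) → ι, Injective u → (∀ l, u l ∈ W) → h u = ∑ l, g (u l) := by
  classical
  -- existence of tuples
  have tup : ∀ Z : Finset ι, Z.card ≤ p + 3 → ∃ Y : Fin p → ι, Injective Y ∧ ∀ l, Y l ∈ W ∧ Y l ∉ Z := by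
    intro Z hZ
    have : p ≤ (W \ Z).card := by
      have := Finset.le_card_sdiff Z W; omega
    obtain ⟨Y⟩ : Nonempty (Fin p ↪ {x // x ∈ W \ Z}) :=
      Function.Embedding.nonempty_of_card_le (by simpa using this)
    refine ⟨fun l => (Y l : ι), fun a b e => Y.injective (Subtype.ext e), fun l => ?_⟩
    have := (Y l).2
    exact Finset.mem_sdiff.mp this
  have disj : ∀ (a b : ι) (X : Fin p → ι) (c : ι),
      ∃ Y : Fin p → ι, Injective Y ∧ (∀ l, Y l ∈ W) ∧ (∀ l, Y l ≠ a) ∧ (∀ l, Y l ≠ b) ∧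
        (∀ l l', X l ≠ Y l') ∧ ∀ l, Y l ≠ c := by
    intro a b X c
    obtain ⟨Y, hY, hY'⟩ := tup ({a, b, c} ∪ Finset.univ.image X) (by
      refine (Finset.card_union_le _ _).trans ?_
      have h1 : ({a, b, c} : Finset ι).card ≤ 3 := Finset.card_le_three
      have h2 : (Finset.univ.image X).card ≤ p := Finset.card_image_le.trans (by simp)
      omega)
    refine ⟨Y, hY, fun l => (hY' l).1, ?_, ?_, ?_, ?_⟩
    · rintro l rfl; exact (hY' l).2 (by simp)
    · rintro l rfl; exact (hY' l).2 (by simp)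
    · intro l l' e; exact (hY' l').2 (by simp [← e])
    · rintro l rfl; exact (hY' l).2 (by simp)
  -- full independence
  have key : ∀ (i i' : Fin (p + 1)) (a b : ι) (X Y : Fin p → ι), a ∈ W → b ∈ W →
      (∀ l, X l ∈ W) → (∀ l, Y l ∈ W) → a ≠ b →
      Injective X → Injective Y → (∀ l, X l ≠ a) → (∀ l, X l ≠ b) → (∀ l, Y l ≠ a) →
      (∀ l, Y l ≠ b) →
      h (i.insertNth a X) - h (i.insertNth b X) = h (i'.insertNth a Y) - h (i'.insertNth b Y) := by
    intro i i' a b X Y ha hb hXW hYW hab hX hY hXa hXb hYa hYb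
    obtain ⟨Z, hZ, hZW, hZa, hZb, hXZ, -⟩ := disj a b X a
    rw [hex i i' a b X Z ha hb hXW hZW hab hX hZ hXa hXb hZa hZb hXZ]
    refine const_of_replace (τ := Fin p) ((W.erase a).erase b) ?_
      (fun X => h (i'.insertNth a X) - h (i'.insertNth b X)) ?_ Z Y hZ ?_ hY ?_
    · rw [Finset.card_erase_of_mem (by simp [hab.symm, hb]), Finset.card_erase_of_mem ha]
      simp; omega
    · intro v hv hvW l c hc hvc
      simp only [Finset.mem_erase] at hvW hc
      obtain ⟨Y', hY', hYW', hYa', hYb', hXY', hYc'⟩ := disj a b v c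
      have e1 := hex i' i' a b v Y' ha hb (fun l => (hvW l).2.2) hYW' hab hv hY'
        (fun l => (hvW l).2.1) (fun l => (hvW l).1) hYa' hYb' hXY'
      have hup : ∀ (P : ι → Prop), P c → (∀ l, P (v l)) → ∀ l', P (update v l c l') := by
        intro P h1 h2 l'
        by_cases hl : l' = l
        · subst hl; rwa [update_self]
        · rw [update_of_ne hl]; exact h2 l'
      have e2 := hex i' i' a b (update v l c) Y' ha hb (hup (· ∈ W) hc.2.2 (fun l => (hvW l).2.2))
        hYW' hab (by
          intro x y hxy
          by_cases hx : x = l <;> by_cases hy : y = l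
          · rw [hx, hy]
          · subst hx; rw [update_self, update_of_ne hy] at hxy; exact absurd hxy.symm (hvc y)
          · subst hy; rw [update_self, update_of_ne hx] at hxy; exact absurd hxy (hvc x)
          · rw [update_of_ne hx, update_of_ne hy] at hxy; exact hv hxy) hY'
        (hup (· ≠ a) hc.2.1 (fun l => (hvW l).2.1)) (hup (· ≠ b) hc.1 (fun l => (hvW l).1))
        hYa' hYb' (fun l₁ l₂ => hup (· ≠ Y' l₂) (hYc' l₂).symm (fun l => hXY' l l₂) l₁)
      exact e2.trans e1.symm
    · intro l; simp [hZa l, hZb l, hZW l]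
    · intro l; simp [hYa l, hYb l, hYW l]
  obtain ⟨c0, hc0⟩ : W.Nonempty := Finset.card_pos.mp (by omega)
  choose Xf hXf1 hXf2 hXf3 hXf4 _ _ using fun a : ι => disj a c0 (fun _ => a) a
  let g0 : ι → k := fun a => h ((0 : Fin (p + 1)).insertNth a (Xf a)) -
    h ((0 : Fin (p + 1)).insertNth c0 (Xf a))
  have g0spec : ∀ (i : Fin (p + 1)) (a b : ι) (X : Fin p → ι), a ∈ W → b ∈ W →
      (∀ l, X l ∈ W) → a ≠ b → Injective X → (∀ l, X l ≠ a) → (∀ l, X l ≠ b) →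
      h (i.insertNth a X) - h (i.insertNth b X) = g0 a - g0 b := by
    intro i a b X ha hb hXW hab hX hXa hXb
    obtain ⟨Y, hY, hYW, hYa, hYb, -, hYc⟩ := disj a b X c0
    rw [key i 0 a b X Y ha hb hXW hYW hab hX hY hXa hXb hYa hYb]
    have ga : ∀ a ∈ W, (∀ l, Y l ≠ a) →
        g0 a = h ((0 : Fin (p + 1)).insertNth a Y) - h ((0 : Fin (p + 1)).insertNth c0 Y) := by
      intro a ha hYa
      by_cases hac : a = c0
      · subst hac; simp [g0]
      · exact key 0 0 a c0 (Xf a) Y ha hc0 (hXf2 a) hYW hac (hXf1 a) hY (hXf3 a) (hXf4 a) hYa hYc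
    rw [ga a ha hYa, ga b hb hYb]; ring
  -- the difference is constant
  have hconst : ∀ u u' : Fin (p + 1) → ι, Injective u → (∀ l, u l ∈ W) → Injective u' →
      (∀ l, u' l ∈ W) → h u - ∑ l, g0 (u l) = h u' - ∑ l, g0 (u' l) := by
    intro u u' hu huW hu' huW'
    refine const_of_replace W (by simp; omega) (fun u => h u - ∑ l, g0 (u l)) ?_ u u' hu huW hu' huW'
    intro v hv hvW i c hc hvc
    have e := g0spec i c (v i) (i.removeNth v) hc (hvW i) (fun l => hvW _) (hvc i).symm
      (fun x y e => Fin.succAbove_right_injective (hv e)) (fun l => hvc _)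
      (fun l e => Fin.succAbove_ne i l (hv e))
    have e1 : i.insertNth c (i.removeNth v) = update v i c := by simp
    have e2 : i.insertNth (v i) (i.removeNth v) = v := by simp
    rw [e1, e2] at e
    have e3 : ∑ l, g0 (update v i c l) = ∑ l, g0 (v l) + g0 c - g0 (v i) := by
      rw [Fin.sum_univ_succAbove _ i, Fin.sum_univ_succAbove (fun l => g0 (v l)) i]
      simp; ring
    rw [e3]; linear_combination e
  obtain ⟨Y, hY, hYW, hYc, -⟩ := disj c0 c0 (fun _ => c0) c0
  let u0 : Fin (p + 1) → ι := Fin.cons c0 Y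
  have hu0 : Injective u0 := by
    rw [Fin.cons_injective_iff]; exact ⟨by rintro ⟨l, hl⟩; exact hYc l hl, hY⟩
  have hu0W : ∀ l, u0 l ∈ W := by
    intro l; refine Fin.cases ?_ ?_ l
    · exact hc0
    · intro l; exact hYW l
  refine ⟨fun a => g0 a + (h u0 - ∑ l, g0 (u0 l)) / (p + 1), fun u hu huW => ?_⟩
  rw [Finset.sum_add_distrib]
  have := hconst u u0 hu huW hu0 hu0W
  simp only [Finset.sum_const, Finset.card_univ, Fintype.card_fin, nsmul_eq_mul]
  have hp : ((p : k) + 1) ≠ 0 := by exact_mod_cast Nat.succ_ne_zero p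
  push_cast
  rw [mul_div_cancel₀ _ hp]
  linear_combination this

end PBWCore


namespace PBWCore
open Function

/-- Inverse rotation of positions. -/
def rr (p : ℕ) : Equiv.Perm (Fin (2 * p + 2)) := (finRotate (2 * p + 1 + 1)).symm

structure IsCore {ι k : Type*} [DecidableEq ι] [Field k] (p s : ℕ)
    (T : (Fin (2 * p + 2) ⊕ Fin s → ι) → (Fin (2 * p + 2) → ι) → k) : Prop where
  alt : ∀ (σ : Equiv.Perm (Fin (2 * p + 2) ⊕ Fin s)) x w,
    T (x ∘ σ) w = ((Equiv.Perm.sign σ : ℤ) : k) * T x w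
  zero : ∀ x w, (∀ i, x i ≠ w 0) → T x w = 0
  rep : ∀ x w i c, Injective x → x i = w 0 → (∀ l, x l ≠ c) →
    T (update x i c) (update w 0 c) = T x w
  anti : ∀ x w (π : Equiv.Perm (Fin (2 * p + 2))),
    T x (w ∘ π) - T x (w ∘ π ∘ rr p) = ((Equiv.Perm.sign π : ℤ) : k) * (T x w - T x (w ∘ rr p))

lemma sign_rr (p : ℕ) : Equiv.Perm.sign (rr p) = -1 := by
  unfold rr
  rw [Equiv.Perm.sign_symm, sign_finRotate]
  exact Odd.neg_one_pow (by simp)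

lemma rr_symm_val (p : ℕ) (l : Fin (2 * p + 2)) :
    (((rr p).symm l : Fin (2 * p + 2)) : ℕ) = if (l : ℕ) = 2 * p + 1 then 0 else (l : ℕ) + 1 := by
  unfold rr
  rw [Equiv.symm_symm]
  split_ifs with h
  · have : l = Fin.last (2 * p + 1) := Fin.ext h
    rw [this, finRotate_last]; rfl
  · exact coe_finRotate_of_ne_last (fun e => h (by rw [e]; rfl))

lemma rr_symm_pow_val (p n : ℕ) (hn : n < 2 * p + 2) :
    (((((rr p).symm) ^ n : Equiv.Perm (Fin (2 * p + 2))) 0 : Fin (2 * p + 2)) : ℕ) = n := by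
  induction n with
  | zero => rfl
  | succ n ih =>
    rw [pow_succ', Equiv.Perm.mul_apply, rr_symm_val, ih (by omega), if_neg (by omega)]

lemma inj_upd {τ ι : Type*} [DecidableEq τ] {u : τ → ι} (hu : Injective u) (i : τ) (c : ι)
    (hc : ∀ l, u l ≠ c) : Injective (update u i c) := by
  intro a b hab
  by_cases ha : a = i <;> by_cases hb : b = i
  · rw [ha, hb]
  · subst ha; rw [update_self, update_of_ne hb] at hab; exact absurd hab.symm (hc b)
  · subst hb; rw [update_self, update_of_ne ha] at hab; exact absurd hab (hc a)
  · rw [update_of_ne ha, update_of_ne hb] at hab; exact hu hab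

lemma exists_perm {τ ι : Type*} [Finite τ] (x x' : τ → ι) (hx' : Injective x')
    (h : ∀ i, ∃ l, x l = x' i) : ∃ σ : Equiv.Perm τ, x' = x ∘ σ := by
  choose f hf using h
  have hfi : Injective f := fun a b e => hx' (by rw [← hf, ← hf, e])
  exact ⟨Equiv.ofBijective f (Finite.injective_iff_bijective.mp hfi), funext fun i => (hf i).symm⟩

namespace IsCore
variable {ι k : Type*} [DecidableEq ι] [Field k] [CharZero k] {p s : ℕ}
  {T : (Fin (2 * p + 2) ⊕ Fin s → ι) → (Fin (2 * p + 2) → ι) → k}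


lemma rot2 (hT : IsCore p s T) (x w) : T x (w ∘ rr p ∘ rr p) = T x w := by
  have := hT.anti x w (rr p)
  rw [sign_rr] at this
  push_cast at this
  linear_combination -this

lemma rot2' (hT : IsCore p s T) (x w) : T x (w ∘ (rr p).symm ∘ (rr p).symm) = T x w := by
  rw [← hT.rot2 x (w ∘ (rr p).symm ∘ (rr p).symm)]
  congr 1; ext i; simp

lemma rot_pow (hT : IsCore p s T) (x w) (n : ℕ) : T x (w ∘ (((rr p).symm ^ (2 * n) : Equiv.Perm _))) = T x w := by
  induction n with
  | zero => rfl
  | succ n ih =>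
    rw [← ih, ← hT.rot2' x (w ∘ (((rr p).symm ^ (2 * n) : Equiv.Perm _)))]
    congr 1

lemma zero_even (hT : IsCore p s T) (x w) (l : Fin (2 * p + 2)) (hl : Even (l : ℕ)) (h : ∀ i, x i ≠ w l) :
    T x w = 0 := by
  obtain ⟨n, hn⟩ := hl
  rw [← hT.rot_pow x w n]
  apply hT.zero
  have e : ((rr p).symm ^ (2 * n) : Equiv.Perm _) 0 = l := by
    ext; rw [rr_symm_pow_val _ _ (by omega)]; omega
  intro i
  rw [comp_apply, e]; exact h i

lemma rep_even (hT : IsCore p s T) (x w i c) (l : Fin (2 * p + 2)) (hl : Even (l : ℕ)) (hx : Injective x)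
    (hi : x i = w l) (hc : ∀ l, x l ≠ c) : T (update x i c) (update w l c) = T x w := by
  obtain ⟨n, hn⟩ := hl
  rw [← hT.rot_pow x w n, ← hT.rot_pow _ (update w l c) n]
  have e : ((rr p).symm ^ (2 * n) : Equiv.Perm _) 0 = l := by
    ext; rw [rr_symm_pow_val _ _ (by omega)]; omega
  rw [update_comp_equiv, ← e, Equiv.symm_apply_apply]
  exact hT.rep x _ i c hx (by rw [comp_apply, e, hi]) hc

lemma even_rot (l : Fin (2 * p + 2)) (hl : ¬ Even (l : ℕ)) :
    Even (((rr p).symm l : Fin (2 * p + 2)) : ℕ) := by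
  rw [rr_symm_val]
  split_ifs
  · simp
  · rw [Nat.even_add_one]; exact hl

lemma zero_odd (hT : IsCore p s T) (x w) (l : Fin (2 * p + 2)) (hl : ¬ Even (l : ℕ)) (h : ∀ i, x i ≠ w l) :
    T x (w ∘ rr p) = 0 := by
  apply hT.zero_even _ _ ((rr p).symm l) (even_rot l hl)
  simpa using h

lemma noninj (hT : IsCore p s T) (x w) (hw : ¬ Injective w) : T x (w ∘ rr p) = T x w := by
  rw [Injective] at hw; push Not at hw
  obtain ⟨a, b, hab, hne⟩ := hw
  have := hT.anti x w (Equiv.swap a b)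
  have e : w ∘ Equiv.swap a b = w := by
    ext i
    by_cases h1 : i = a
    · subst h1; simp [hab]
    by_cases h2 : i = b
    · subst h2; simp [hab]
    simp [Equiv.swap_apply_of_ne_of_ne h1 h2]
  rw [← comp_assoc, e, Equiv.Perm.sign_swap hne] at this
  push_cast at this
  have h2 : (2 : k) * (T x w - T x (w ∘ rr p)) = 0 := by linear_combination this
  have h3 := (mul_eq_zero.mp h2).resolve_left two_ne_zero
  linear_combination -h3

lemma elim_perm (hT : IsCore p s T) (w q) (w' : Fin (2 * p + 2) → ι) (π : Equiv.Perm (Fin (2 * p + 2))) :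
    T (Sum.elim (w ∘ π) q) w' = ((Equiv.Perm.sign π : ℤ) : k) * T (Sum.elim w q) w' := by
  have := hT.alt (Equiv.sumCongr π (Equiv.refl _)) (Sum.elim w q) w'
  have e : Sum.elim w q ∘ Equiv.sumCongr π (Equiv.refl _) = Sum.elim (w ∘ π) q := by
    ext i; cases i <;> simp
  rw [e] at this
  rw [this]
  congr 3
  have := Equiv.Perm.sign_sumCongr π (1 : Equiv.Perm (Fin s))
  rw [Equiv.Perm.sign_one, mul_one] at this
  exact this

lemma F_sym (hT : IsCore p s T) (w q) (π : Equiv.Perm (Fin (2 * p + 2))) :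
    T (Sum.elim (w ∘ π) q) (w ∘ π) + T (Sum.elim ((w ∘ π) ∘ rr p) q) ((w ∘ π) ∘ rr p) =
    T (Sum.elim w q) w + T (Sum.elim (w ∘ rr p) q) (w ∘ rr p) := by
  rw [hT.elim_perm, hT.elim_perm, hT.elim_perm, hT.elim_perm w q _ (rr p), sign_rr]
  have := hT.anti (Sum.elim w q) w π
  have hs : ((Equiv.Perm.sign π : ℤ) : k) * ((Equiv.Perm.sign π : ℤ) : k) = 1 := by
    norm_cast; simp
  push_cast
  rw [comp_assoc]
  linear_combination ((Equiv.Perm.sign π : ℤ) : k) * this +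
    hs * (T (Sum.elim w q) w - T (Sum.elim w q) (w ∘ rr p))

/-- combine even letters `v` and odd letters `u` -/
def cmb (v u : Fin (p + 1) → ι) : Fin (2 * p + 2) → ι := fun i =>
  if Even (i : ℕ) then v ⟨i / 2, by omega⟩ else u ⟨i / 2, by omega⟩

lemma cmb_rr (v u : Fin (p + 1) → ι) :
    cmb (p := p) v u ∘ rr p = cmb (u ∘ (finRotate (p + 1)).symm) v := by
  have : cmb (p := p) v u = cmb (u ∘ (finRotate (p + 1)).symm) v ∘ (rr p).symm := by
    ext i
    simp only [cmb, comp_apply, rr_symm_val]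
    by_cases hi : Even (i : ℕ)
    · have h1 : (i : ℕ) ≠ 2 * p + 1 := by
        rintro h; rw [h] at hi; rw [Nat.even_iff] at hi; omega
      simp only [hi, if_true, h1, if_false, Nat.even_add_one, not_true_eq_false]
      congr 2
      rw [Nat.even_iff] at hi; omega
    · simp only [hi, if_false]
      rw [if_pos (by split_ifs <;> simp [Nat.even_add_one, hi])]
      congr 1
      rw [Equiv.eq_symm_apply]
      rw [Nat.even_iff] at hi
      ext
      split_ifs with h
      · have : (⟨(i : ℕ) / 2, by omega⟩ : Fin (p + 1)) = Fin.last p := by ext; simp; omega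
        rw [this, finRotate_last]; rfl
      · rw [coe_finRotate_of_ne_last (by rw [Ne, Fin.ext_iff]; simp; omega)]
        simp; omega
  rw [this]; ext i; simp

lemma cmb_inj (v u : Fin (p + 1) → ι) (hv : Injective v) (hu : Injective u)
    (hd : ∀ a b, v a ≠ u b) : Injective (cmb (p := p) v u) := by
  intro i j hij
  unfold cmb at hij
  split_ifs at hij with h1 h2 h2
  · have := congrArg Fin.val (hv hij); simp at this; ext
    rw [Nat.even_iff] at h1 h2; omega
  · exact absurd hij (hd _ _)
  · exact absurd hij.symm (hd _ _)
  · have := congrArg Fin.val (hu hij); simp at this; ext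
    rw [Nat.even_iff] at h1 h2; omega

lemma cmb_update (v u : Fin (p + 1) → ι) (i : Fin (p + 1)) (c : ι) :
    update (cmb (p := p) v u) ⟨2 * i, by omega⟩ c = cmb (update v i c) u := by
  ext l
  unfold cmb
  by_cases hl : l = ⟨2 * i, by omega⟩
  · subst hl
    rw [update_self]; simp
  · rw [update_of_ne hl]
    split_ifs with h
    · rw [update_of_ne]
      rintro rfl
      apply hl; ext; simp; rw [Nat.even_iff] at h; omega
    · rfl

lemma cmb_swap (v u : Fin (p + 1) → ι) (i i' : Fin (p + 1)) :
    cmb (p := p) v u ∘ Equiv.swap ⟨2 * i', by omega⟩ ⟨2 * i + 1, by omega⟩ =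
      cmb (update v i' (u i)) (update u i (v i')) := by
  ext l
  have e0 : ∀ a : Fin (p + 1), (2 * (a : ℕ) + 1) / 2 = a := fun a => by omega
  by_cases h1 : l = ⟨2 * i', by omega⟩
  · subst h1
    simp [cmb, e0]
  by_cases h2 : l = ⟨2 * i + 1, by omega⟩
  · subst h2
    simp [cmb, e0]
  rw [comp_apply, Equiv.swap_apply_of_ne_of_ne h1 h2]
  unfold cmb
  split_ifs with h
  · rw [update_of_ne]
    rintro rfl
    apply h1; ext; simp; rw [Nat.even_iff] at h; omega
  · rw [update_of_ne]
    rintro rfl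
    apply h2; ext; simp; rw [Nat.even_iff] at h; omega

lemma F_rep (hT : IsCore p s T) (w q) (hi : Injective (Sum.elim w q)) (l : Fin (2 * p + 2)) (hl : Even (l : ℕ)) (c : ι)
    (hc : ∀ l, Sum.elim w q l ≠ c) :
    T (Sum.elim (update w l c) q) (update w l c) = T (Sum.elim w q) w := by
  rw [← Sum.update_elim_inl]
  exact hT.rep_even _ _ _ _ l hl hi rfl hc

theorem diag (hT : IsCore p s T) [Fintype ι] (hd : 2 * p + s + 3 ≤ Fintype.card ι) (q : Fin s → ι) :
    ∃ g : ι → k, ∀ w : Fin (2 * p + 2) → ι, Injective (Sum.elim w q) →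
      T (Sum.elim w q) w = ∑ a : Fin (p + 1), g (w ⟨2 * a + 1, by omega⟩) := by
  classical
  by_cases hq : Injective q
  swap
  · exact ⟨0, fun w hw => absurd (fun a b e => Sum.inr_injective (hw (by simpa using e))) hq⟩
  have hqc : (Finset.univ.image q).card ≤ s := Finset.card_image_le.trans (by simp)
  have exv : ∀ u : Fin (p + 1) → ι, ∃ v : Fin (p + 1) → ι, Injective v ∧ (∀ a b, v a ≠ u b) ∧
      ∀ a b, v a ≠ q b := by
    intro u
    have h1 : (Finset.univ.image u).card ≤ p + 1 := Finset.card_image_le.trans (by simp)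
    have : p + 1 ≤ (Finset.univ \ (Finset.univ.image q ∪ Finset.univ.image u)).card := by
      have h2 := Finset.le_card_sdiff (Finset.univ.image q ∪ Finset.univ.image u)
        (Finset.univ : Finset ι)
      have h3 := Finset.card_union_le (Finset.univ.image q) (Finset.univ.image u)
      rw [Finset.card_univ] at h2
      omega
    obtain ⟨Y⟩ : Nonempty (Fin (p + 1) ↪
        {x // x ∈ Finset.univ \ (Finset.univ.image q ∪ Finset.univ.image u)}) :=
      Function.Embedding.nonempty_of_card_le (by rwa [Fintype.card_coe, Fintype.card_fin])
    refine ⟨fun l => (Y l : ι), fun a b e => Y.injective (Subtype.ext e), fun a b e => ?_,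
      fun a b e => ?_⟩
    · have := (Finset.mem_sdiff.mp (Y a).2).2; simp only at e; rw [e] at this; simp at this
    · have := (Finset.mem_sdiff.mp (Y a).2).2; simp only at e; rw [e] at this; simp at this
  choose vf hvf1 hvf2 hvf3 using exv
  have elinj : ∀ v u : Fin (p + 1) → ι, Injective v → Injective u → (∀ a b, v a ≠ u b) →
      (∀ a b, v a ≠ q b) → (∀ a b, u a ≠ q b) → Injective (Sum.elim (cmb (p := p) v u) q) := by
    intro v u hv hu hd h1 h2
    apply Injective.sumElim (cmb_inj v u hv hu hd) hq
    intro a b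
    unfold cmb
    split_ifs
    · exact h1 _ _
    · exact h2 _ _
  let F : (Fin (2 * p + 2) → ι) → k := fun w => T (Sum.elim w q) w
  have hF : ∀ v u : Fin (p + 1) → ι, Injective v → Injective u → (∀ a b, v a ≠ u b) →
      (∀ a b, v a ≠ q b) → (∀ a b, u a ≠ q b) → F (cmb v u) = F (cmb (vf u) u) := by
    intro v u hv hu hvu hvq huq
    refine const_of_replace (Finset.univ \ (Finset.univ.image q ∪ Finset.univ.image u)) ?_
      (fun v => F (cmb v u)) ?_ v (vf u) hv ?_ (hvf1 u) ?_
    · have h1 : (Finset.univ.image u).card ≤ p + 1 := Finset.card_image_le.trans (by simp)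
      have h2 := Finset.le_card_sdiff (Finset.univ.image q ∪ Finset.univ.image u)
        (Finset.univ : Finset ι)
      have h3 := Finset.card_union_le (Finset.univ.image q) (Finset.univ.image u)
      rw [Finset.card_univ] at h2
      simp only [Fintype.card_fin]
      omega
    · intro v hv hvW i c hc hvc
      have hc' := (Finset.mem_sdiff.mp hc).2
      simp only [Finset.mem_union, Finset.mem_image, Finset.mem_univ, true_and, not_or,
        not_exists] at hc'
      have hvW' : ∀ i, (¬ ∃ l, q l = v i) ∧ ¬ ∃ l, u l = v i := by
        intro i
        have := (Finset.mem_sdiff.mp (hvW i)).2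
        simpa only [Finset.mem_union, Finset.mem_image, Finset.mem_univ, true_and, not_or] using this
      simp only [F]
      rw [← cmb_update]
      apply hT.F_rep
      · exact elinj v u hv hu (fun a b e => (hvW' a).2 ⟨b, e.symm⟩)
          (fun a b e => (hvW' a).1 ⟨b, e.symm⟩) huq
      · simp
      · rintro (l | l)
        · simp only [Sum.elim_inl, cmb]
          split_ifs
          · exact hvc _
          · exact hc'.2 _
        · exact hc'.1 l
    · intro a; simp only [Finset.mem_sdiff, Finset.mem_univ, Finset.mem_union, Finset.mem_image,
        true_and, not_or, not_exists]
      exact ⟨fun b e => hvq a b e.symm, fun b e => hvu a b e.symm⟩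
    · intro a; simp only [Finset.mem_sdiff, Finset.mem_univ, Finset.mem_union, Finset.mem_image,
        true_and, not_or, not_exists]
      exact ⟨fun b e => hvf3 u a b e.symm, fun b e => hvf2 u a b e.symm⟩
  -- the exchange relation
  let h : (Fin (p + 1) → ι) → k := fun u => F (cmb (vf u) u)
  have hsum : ∀ v u : Fin (p + 1) → ι, Injective v → Injective u → (∀ a b, v a ≠ u b) →
      (∀ a b, v a ≠ q b) → (∀ a b, u a ≠ q b) →
      F (cmb v u) + F (cmb v u ∘ rr p) = h u + h v := by
    intro v u hv hu hvu hvq huq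
    rw [cmb_rr, hF v u hv hu hvu hvq huq, hF _ v (hu.comp (Equiv.injective _)) hv
      (fun a b => (hvu _ _).symm) (fun a b => huq _ _) hvq]
  obtain ⟨g, hg⟩ := exists_sum p (Finset.univ \ Finset.univ.image q) (by
      have h2 := Finset.le_card_sdiff (Finset.univ.image q) (Finset.univ : Finset ι)
      rw [Finset.card_univ] at h2
      omega) h (by
    intro i i' a b X Y ha hb hXW hYW hab hX hY hXa hXb hYa hYb hXY
    have mW : ∀ {c}, c ∈ Finset.univ \ Finset.univ.image q → ∀ l, c ≠ q l := by
      intro c hc l e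
      exact (Finset.mem_sdiff.mp hc).2 (by simp [e])
    have insinj : ∀ (i : Fin (p + 1)) (c : ι) (Z : Fin p → ι), Injective Z → (∀ l, Z l ≠ c) →
        Injective (i.insertNth c Z : Fin (p + 1) → ι) := by
      intro i c Z hZ hc
      intro x y
      revert x y
      simp only [Fin.forall_iff_succAbove i, Fin.insertNth_apply_same, Fin.insertNth_apply_succAbove]
      refine ⟨⟨fun _ => trivial, fun l e => absurd e.symm (hc l)⟩,
        fun l => ⟨fun e => absurd e (hc l), fun m e => by rw [hZ e]⟩⟩
    have insP : ∀ (P : ι → Prop) (i : Fin (p + 1)) (c : ι) (Z : Fin p → ι), P c →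
        (∀ l, P (Z l)) → ∀ l, P ((i.insertNth c Z : Fin (p + 1) → ι) l) := by
      intro P i c Z h1 h2
      rw [Fin.forall_iff_succAbove i]
      simp [h1, h2]
    have e := hT.F_sym (cmb (p := p) (i'.insertNth b Y) (i.insertNth a X)) q
      (Equiv.swap ⟨2 * i', by omega⟩ ⟨2 * i + 1, by omega⟩)
    rw [cmb_swap] at e
    simp only [Fin.insertNth_apply_same, Fin.update_insertNth] at e
    have e1 := hsum (i'.insertNth b Y) (i.insertNth a X) (insinj _ _ _ hY hYb) (insinj _ _ _ hX hXa)
      (fun l l' => insP (fun c => c ≠ (i.insertNth a X : Fin (p + 1) → ι) l') _ _ _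
        (insP (fun c => b ≠ c) _ _ _ hab.symm (fun l => (hXb l).symm) l')
        (fun l => insP (fun c => Y l ≠ c) _ _ _ (hYa l) (fun m => (hXY m l).symm) l') l)
      (fun l l' => insP (fun c => c ≠ q l') _ _ _ (mW hb l') (fun l => mW (hYW l) l') l)
      (fun l l' => insP (fun c => c ≠ q l') _ _ _ (mW ha l') (fun l => mW (hXW l) l') l)
    have e2 := hsum (i'.insertNth a Y) (i.insertNth b X) (insinj _ _ _ hY hYa) (insinj _ _ _ hX hXb)
      (fun l l' => insP (fun c => c ≠ (i.insertNth b X : Fin (p + 1) → ι) l') _ _ _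
        (insP (fun c => a ≠ c) _ _ _ hab (fun l => (hXa l).symm) l')
        (fun l => insP (fun c => Y l ≠ c) _ _ _ (hYb l) (fun m => (hXY m l).symm) l') l)
      (fun l l' => insP (fun c => c ≠ q l') _ _ _ (mW ha l') (fun l => mW (hYW l) l') l)
      (fun l l' => insP (fun c => c ≠ q l') _ _ _ (mW hb l') (fun l => mW (hXW l) l') l)
    simp only [F] at e1 e2
    linear_combination e2 - e1 - e)
  refine ⟨g, fun w hw => ?_⟩
  have hw1 : Injective w := fun a b e => Sum.inl_injective (hw (by simpa using e))
  have hwq : ∀ a b, w a ≠ q b := fun a b e => by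
    have := hw (a₁ := Sum.inl a) (a₂ := Sum.inr b) (by simpa using e)
    cases this
  let v : Fin (p + 1) → ι := fun a => w ⟨2 * a, by omega⟩
  let u : Fin (p + 1) → ι := fun a => w ⟨2 * a + 1, by omega⟩
  have hcmb : w = cmb v u := by
    ext l
    simp only [cmb, v, u]
    split_ifs with h <;> rw [Nat.even_iff] at h
    · congr 1; ext; simp; omega
    · congr 1; ext; simp; omega
  have hu : Injective u := fun a b e => by
    have := congrArg Fin.val (hw1 e); simp at this; ext; omega
  have hv : Injective v := fun a b e => by
    have := congrArg Fin.val (hw1 e); simp at this; ext; omega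
  have e := hF v u hv hu (fun a b e => by
    have := congrArg Fin.val (hw1 e); simp at this; omega) (fun a b => hwq _ _) (fun a b => hwq _ _)
  rw [← hcmb] at e
  exact e.trans (hg u hu (fun l => by simpa using fun b e => hwq _ b e.symm))

end IsCore
end PBWCore


namespace PBWCore
open Function
namespace IsCore
variable {ι k : Type*} [LinearOrder ι] [Fintype ι] [Field k] [CharZero k] {p s : ℕ}
  {T : (Fin (2 * p + 2) ⊕ Fin s → ι) → (Fin (2 * p + 2) → ι) → k}

lemma D_of_missing (hT : IsCore p s T) (x w) (l : Fin (2 * p + 2)) (hl : ¬ Even (l : ℕ))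
    (h : ∀ i, x i ≠ w l) (π : Equiv.Perm (Fin (2 * p + 2))) (l' : Fin (2 * p + 2))
    (hl' : ¬ Even (l' : ℕ)) (hπ : ∀ i, x i ≠ w (π l')) :
    T x (w ∘ π) = ((Equiv.Perm.sign π : ℤ) : k) * T x w := by
  have e := hT.anti x w π
  rw [hT.zero_odd x w l hl h, ← comp_assoc, hT.zero_odd x (w ∘ π) l' hl' hπ] at e
  linear_combination e

/-- words of the form `(z, c, r)` -/
def wd (z c : ι) (r : Fin (2 * p) → ι) : Fin (2 * p + 2) → ι :=
  Fin.cons z (Fin.cons c r : Fin (2 * p + 1) → ι)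

lemma offdiag_const (hT : IsCore p s T) (hd : 2 * p + s + 3 ≤ Fintype.card ι)
    (y0 j : ι) (q : Fin s → ι) (hq : Injective q) (hy : ∀ a, q a ≠ y0) (hj : j ≠ y0)
    (hjq : ∀ a, q a ≠ j)
    (z z' : ι) (r r' : Fin (2 * p) → ι) (hr : Injective r) (hr' : Injective r')
    (hrW : ∀ l, r l ≠ y0 ∧ r l ≠ j ∧ ∀ a, q a ≠ r l)
    (hrW' : ∀ l, r' l ≠ y0 ∧ r' l ≠ j ∧ ∀ a, q a ≠ r' l)
    (hz : z ≠ y0 ∧ z ≠ j ∧ (∀ a, q a ≠ z) ∧ ∀ l, r l ≠ z)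
    (hz' : z' ≠ y0 ∧ z' ≠ j ∧ (∀ a, q a ≠ z') ∧ ∀ l, r' l ≠ z') :
    T (Sum.elim (wd z y0 r) q) (wd z j r) = T (Sum.elim (wd z' y0 r') q) (wd z' j r') := by
  classical
  have elinj : ∀ (z : ι) (r : Fin (2 * p) → ι), Injective r →
      (∀ l, r l ≠ y0 ∧ r l ≠ j ∧ ∀ a, q a ≠ r l) →
      (z ≠ y0 ∧ z ≠ j ∧ (∀ a, q a ≠ z) ∧ ∀ l, r l ≠ z) →
      Injective (Sum.elim (wd z y0 r) q) := by
    intro z r hr hrW hz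
    apply Injective.sumElim _ hq
    · intro a b
      refine Fin.cases ?_ (fun a => ?_) a
      · exact fun e => hz.2.2.1 b e.symm
      · refine Fin.cases ?_ (fun a => ?_) a
        · exact fun e => hy b e.symm
        · exact fun e => (hrW a).2.2 b e.symm
    · unfold wd
      rw [Fin.cons_injective_iff, Fin.cons_injective_iff]
      refine ⟨?_, ?_, hr⟩
      · rintro ⟨l, hl⟩
        revert hl
        refine Fin.cases ?_ (fun a => ?_) l
        · exact fun e => hz.1 e.symm
        · exact fun e => hz.2.2.2 a e
      · rintro ⟨l, hl⟩; exact (hrW l).1 hl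
  -- independence of `z`
  have indz : ∀ (z z' : ι) (r : Fin (2 * p) → ι), Injective r →
      (∀ l, r l ≠ y0 ∧ r l ≠ j ∧ ∀ a, q a ≠ r l) →
      (z ≠ y0 ∧ z ≠ j ∧ (∀ a, q a ≠ z) ∧ ∀ l, r l ≠ z) →
      (z' ≠ y0 ∧ z' ≠ j ∧ (∀ a, q a ≠ z') ∧ ∀ l, r l ≠ z') →
      T (Sum.elim (wd z y0 r) q) (wd z j r) = T (Sum.elim (wd z' y0 r) q) (wd z' j r) := by
    intro z z' r hr hrW hz hz'
    by_cases hzz : z = z'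
    · rw [hzz]
    have e := hT.rep (Sum.elim (wd z y0 r) q) (wd z j r) (Sum.inl 0) z' (elinj z r hr hrW hz) rfl (by
      rintro (l | l)
      · refine Fin.cases ?_ (fun a => ?_) l
        · exact hzz
        · refine Fin.cases ?_ (fun a => ?_) a
          · exact hz'.1.symm
          · exact hz'.2.2.2 a
      · exact hz'.2.2.1 l)
    rw [← e, Sum.update_elim_inl]
    unfold wd
    rw [Fin.update_cons_zero, Fin.update_cons_zero]
  have exz : ∀ r : Fin (2 * p) → ι, ∃ z, (z ≠ y0 ∧ z ≠ j ∧ (∀ a, q a ≠ z) ∧ ∀ l, r l ≠ z) := by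
    intro r
    have : ({y0, j} ∪ Finset.univ.image q ∪ Finset.univ.image r).card <
        (Finset.univ : Finset ι).card := by
      have h1 : (Finset.univ.image r).card ≤ 2 * p := Finset.card_image_le.trans (by simp)
      have h2 : (Finset.univ.image q).card ≤ s := Finset.card_image_le.trans (by simp)
      have h3 : ({y0, j} : Finset ι).card ≤ 2 := Finset.card_le_two
      have h4 := Finset.card_union_le ({y0, j} ∪ Finset.univ.image q) (Finset.univ.image r)
      have h5 := Finset.card_union_le {y0, j} (Finset.univ.image q)
      rw [Finset.card_univ]; omega
    obtain ⟨z, -, hz⟩ := Finset.exists_mem_notMem_of_card_lt_card this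
    simp only [Finset.mem_union, Finset.mem_image, Finset.mem_univ, true_and, not_or,
        not_exists, Finset.mem_insert, Finset.mem_singleton] at hz
    exact ⟨z, hz.1.1.1, hz.1.1.2, hz.1.2, hz.2⟩
  choose zf hzf using exz
  have key := const_of_replace (Finset.univ \ ({y0, j} ∪ Finset.univ.image q)) (τ := Fin (2 * p)) (by
      have h2 : (Finset.univ.image q).card ≤ s := Finset.card_image_le.trans (by simp)
      have h3 : ({y0, j} : Finset ι).card ≤ 2 := Finset.card_le_two
      have h5 := Finset.card_union_le {y0, j} (Finset.univ.image q)
      have h6 := Finset.le_card_sdiff ({y0, j} ∪ Finset.univ.image q) (Finset.univ : Finset ι)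
      rw [Finset.card_univ] at h6
      rw [Fintype.card_fin]; omega)
    (fun r => T (Sum.elim (wd (zf r) y0 r) q) (wd (zf r) j r)) (by
      intro v hv hvW i c hc hvc
      have mW : ∀ {c}, c ∈ Finset.univ \ ({y0, j} ∪ Finset.univ.image q) →
          (c ≠ y0 ∧ c ≠ j ∧ ∀ a, q a ≠ c) := by
        intro c hc
        have := (Finset.mem_sdiff.mp hc).2
        simp only [Finset.mem_union, Finset.mem_image, Finset.mem_univ, true_and, not_or,
          not_exists, Finset.mem_insert, Finset.mem_singleton] at this
        exact ⟨this.1.1, this.1.2, this.2⟩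
      have hup : ∀ (P : ι → Prop), P c → (∀ l, P (v l)) → ∀ l', P (update v i c l') := by
        intro P h1 h2 l'
        by_cases hl : l' = i
        · subst hl; rwa [update_self]
        · rw [update_of_ne hl]; exact h2 l'
      have hcW := mW hc
      have hvW' := fun l => mW (hvW l)
      beta_reduce
      rw [indz (zf v) c v hv hvW' (hzf v) ⟨hcW.1, hcW.2.1, hcW.2.2, hvc⟩]
      have hu := inj_upd hv i c hvc
      have huW := hup (fun c => c ≠ y0 ∧ c ≠ j ∧ ∀ a, q a ≠ c) hcW hvW'
      have hvi : v i ≠ y0 ∧ v i ≠ j ∧ (∀ a, q a ≠ v i) ∧ ∀ l, update v i c l ≠ v i := by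
        refine ⟨(hvW' i).1, (hvW' i).2.1, (hvW' i).2.2, fun l => ?_⟩
        by_cases hl : l = i
        · subst hl; rw [update_self]; exact (hvc l).symm
        · rw [update_of_ne hl]; exact fun e => hl (hv e)
      rw [indz _ (v i) (update v i c) hu huW (hzf _) hvi]
      -- the swap
      have esw : ∀ d : ι, wd (v i) d (update v i c) =
          wd c d v ∘ Equiv.swap (0 : Fin (2 * p + 2)) (Fin.succ (Fin.succ i)) := by
        intro d
        ext l
        unfold wd
        refine Fin.cases ?_ (fun a => ?_) l
        · simp
        · refine Fin.cases ?_ (fun a => ?_) a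
          · rw [comp_apply, Equiv.swap_apply_of_ne_of_ne (Fin.succ_ne_zero _)
              (fun e => by have := Fin.succ_injective _ e; exact absurd this.symm (Fin.succ_ne_zero _))]
            rfl
          · by_cases ha : a = i
            · subst ha; simp
            · rw [comp_apply, Equiv.swap_apply_of_ne_of_ne (Fin.succ_ne_zero _)
                (fun e => ha (Fin.succ_injective _ (Fin.succ_injective _ e)))]
              simp [ha]
      rw [esw y0, esw j, hT.elim_perm]
      have hmiss : ∀ l, Sum.elim (wd c y0 v) q l ≠ j := by
        rintro (l | l)
        · refine Fin.cases ?_ (fun a => ?_) l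
          · exact hcW.2.1
          · refine Fin.cases ?_ (fun a => ?_) a
            · exact hj.symm
            · exact (hvW' a).2.1
        · exact hjq l
      rw [hT.D_of_missing _ _ (1 : Fin (2 * p + 2)) (by simp) hmiss _ 1 (by simp) (by
        rw [Equiv.swap_apply_of_ne_of_ne (by simp) (by
          intro e
          have := congrArg Fin.val e
          simp at this)]
        exact hmiss)]
      rw [← mul_assoc]
      have hs : ∀ π : Equiv.Perm (Fin (2 * p + 2)),
        ((Equiv.Perm.sign π : ℤ) : k) * ((Equiv.Perm.sign π : ℤ) : k) = 1 := by
        intro π; norm_cast; simp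
      rw [hs, one_mul])
    r r' hr (by
      intro l; have := hrW l
      simp only [Finset.mem_sdiff, Finset.mem_univ, Finset.mem_union, Finset.mem_image, true_and,
        not_or, not_exists, Finset.mem_insert, Finset.mem_singleton]
      exact ⟨⟨this.1, this.2.1⟩, this.2.2⟩) hr' (by
      intro l; have := hrW' l
      simp only [Finset.mem_sdiff, Finset.mem_univ, Finset.mem_union, Finset.mem_image, true_and,
        not_or, not_exists, Finset.mem_insert, Finset.mem_singleton]
      exact ⟨⟨this.1, this.2.1⟩, this.2.2⟩)
  rw [indz z (zf r) r hr hrW hz (hzf r), indz z' (zf r') r' hr' hrW' hz' (hzf r')]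
  exact key

lemma exists_sorted {τ : Type*} [Fintype τ] {n m : ℕ} (x : τ → ι) (hx : Injective x)
    (B : Finset ι) (hB : B ⊆ Finset.univ.image x) (hBc : B.card = m)
    (hc : Fintype.card τ = m + n) :
    ∃ y : Fin n → ι, StrictMono y ∧ (∀ a, y a ∉ B) ∧ ∀ a, ∃ i, x i = y a := by
  classical
  have h1 : (Finset.univ.image x \ B).card = n := by
    rw [Finset.card_sdiff_of_subset hB, Finset.card_image_of_injective _ hx, Finset.card_univ]
    omega
  refine ⟨(Finset.univ.image x \ B).orderEmbOfFin h1, OrderEmbedding.strictMono _, fun a => ?_,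
    fun a => ?_⟩
  · exact (Finset.mem_sdiff.mp (Finset.orderEmbOfFin_mem _ h1 a)).2
  · simpa using (Finset.mem_sdiff.mp (Finset.orderEmbOfFin_mem _ h1 a)).1

lemma sign_ne (τ : Type*) [Fintype τ] [DecidableEq τ] (σ : Equiv.Perm τ) :
    ((Equiv.Perm.sign σ : ℤ) : k) ≠ 0 := by
  have : (Equiv.Perm.sign σ : ℤ) ≠ 0 := by simp
  exact_mod_cast this

theorem vanish (hT : IsCore p s T) (hd : 2 * p + s + 3 ≤ Fintype.card ι)
    (N1 : ∀ w q, Injective (Sum.elim w q) → StrictMono q → T (Sum.elim w q) w = 0)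
    (N2 : ∀ y : Fin (s + 1) → ι, StrictMono y → ∀ j, (∀ a, y a ≠ j) →
      ∃ (z : ι) (r : Fin (2 * p) → ι), Injective (Sum.elim (wd z (y 0) r) (Fin.tail y)) ∧
        z ≠ j ∧ (∀ l, r l ≠ j) ∧ T (Sum.elim (wd z (y 0) r) (Fin.tail y)) (wd z j r) = 0)
    (x₀ w₀) (hx₀ : Injective x₀) : T x₀ w₀ = 0 := by
  classical
  -- the word has exactly one letter not in `x`, at position `1`
  have c2 : ∀ x : Fin (2 * p + 2) ⊕ Fin s → ι, Injective x →
      ∀ w : Fin (2 * p + 2) → ι, Injective w → (∀ i, x i ≠ w 1) →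
      (∀ l, l ≠ 1 → ∃ i, x i = w l) → T x w = 0 := by
    intro x hx w hw h1 hl
    obtain ⟨y, hy, hyB, hyx⟩ := exists_sorted (n := s + 1) (m := 2 * p + 1) x hx
      ((Finset.univ.erase 1).image w) (by
        intro c hc
        simp only [Finset.mem_image, Finset.mem_erase, Finset.mem_univ, and_true] at hc
        obtain ⟨l, hl1, rfl⟩ := hc
        simpa using hl l hl1) (by
        rw [Finset.card_image_of_injective _ hw, Finset.card_erase_of_mem (Finset.mem_univ _)]
        simp) (by simp; omega)
    have hyw : ∀ a l, l ≠ 1 → w l ≠ y a := by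
      intro a l hl1 e
      exact hyB a (Finset.mem_image.mpr ⟨l, by simpa using hl1, e⟩)
    have hwd : ∀ c, wd (p := p) (w 0) c (fun l => w l.succ.succ) = update w 1 c := by
      intro c; ext l; unfold wd
      refine Fin.cases ?_ (fun a => ?_) l
      · simp
      · refine Fin.cases ?_ (fun a => ?_) a
        · exact (update_self (1 : Fin (2 * p + 2)) c w).symm
        · rw [update_of_ne (by
            intro e
            exact absurd (Fin.succ_injective _ (a₂ := 0) e) (Fin.succ_ne_zero _))]
          simp
    have hyj : ∀ a, y a ≠ w 1 := by
      intro a e; obtain ⟨i, hi⟩ := hyx a; exact h1 i (hi.trans e)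
    have hss : ∀ l : Fin (2 * p), (l.succ.succ : Fin (2 * p + 2)) ≠ 1 := by
      intro l e
      exact absurd (Fin.succ_injective _ (a₂ := 0) e) (Fin.succ_ne_zero _)
    have hx' : Injective (Sum.elim (wd (p := p) (w 0) (y 0) (fun l => w l.succ.succ)) (Fin.tail y)) := by
      rw [hwd]
      apply Injective.sumElim
      · intro a b hab
        by_cases ha : a = 1 <;> by_cases hb : b = 1
        · rw [ha, hb]
        · subst ha; rw [update_self, update_of_ne hb] at hab; exact absurd hab.symm (hyw 0 b hb)
        · subst hb; rw [update_self, update_of_ne ha] at hab; exact absurd hab (hyw 0 a ha)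
        · rw [update_of_ne ha, update_of_ne hb] at hab; exact hw hab
      · exact hy.injective.comp (Fin.succ_injective _)
      · intro a b
        by_cases ha : a = 1
        · subst ha; rw [update_self]; exact fun e => absurd (hy.injective e).symm (Fin.succ_ne_zero _)
        · rw [update_of_ne ha]; exact hyw _ a ha
    obtain ⟨σ, hσ⟩ := exists_perm x _ hx' (by
      rw [hwd]
      rintro (l | l)
      · by_cases ha : l = 1
        · subst ha; simpa using hyx 0
        · simpa [ha] using hl l ha
      · exact hyx _)
    obtain ⟨z, r, hzr, hzj, hrj, h0⟩ := N2 y hy (w 1) hyj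
    have e := hT.alt σ x w
    have hww : w = wd (w 0) (w 1) (fun l => w l.succ.succ) := by rw [hwd]; simp
    have zr1 : Injective (wd (p := p) z (y 0) r) := fun a b e =>
      Sum.inl_injective (hzr (by simpa using e))
    have zr2 : ∀ a b, wd (p := p) z (y 0) r a ≠ Fin.tail y b := fun a b e => by
      have := hzr (a₁ := Sum.inl a) (a₂ := Sum.inr b) (by simpa using e)
      cases this
    have zr3 := zr1
    unfold wd at zr3
    rw [Fin.cons_injective_iff, Fin.cons_injective_iff] at zr3
    have key := hT.offdiag_const hd (y 0) (w 1) (Fin.tail y) (hy.injective.comp (Fin.succ_injective _))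
      (fun a e => absurd (hy.injective e) (Fin.succ_ne_zero _)) (hyj 0).symm (fun a => hyj _)
      z (w 0) r (fun l => w l.succ.succ) zr3.2.2
      (fun a b e => Fin.succ_injective _ (Fin.succ_injective _ (hw e)))
      (fun l => ⟨fun e => zr3.2.1 ⟨l, e⟩, hrj l, fun a e => zr2 l.succ.succ a (by simpa [wd] using e.symm)⟩)
      (fun l => ⟨hyw _ _ (hss l), fun e => hss l (hw e), fun a e => hyw _ _ (hss l) e.symm⟩)
      ⟨fun e => zr3.1 ⟨0, by simp [e]⟩, hzj, fun a e => zr2 0 a (by simpa [wd] using e.symm),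
        fun l e => zr3.1 ⟨l.succ, by simpa using e⟩⟩
      ⟨hyw _ _ (by simp), fun e => by have := hw e; simp at this, fun a e => hyw _ _ (by simp) e.symm,
        fun l e => by exact absurd (hw e) (Fin.succ_ne_zero _)⟩
    rw [h0, ← hww, hσ, e] at key
    exact (mul_eq_zero.mp key.symm).resolve_left (sign_ne _ σ)
  -- a letter of the word is missing in `x`
  have c1 : ∀ x : Fin (2 * p + 2) ⊕ Fin s → ι, Injective x →
      ∀ w : Fin (2 * p + 2) → ι, (∃ l, ∀ i, x i ≠ w l) → T x w = 0 := by
    rintro x hx w ⟨l, hl⟩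
    by_cases hle : Even (l : ℕ)
    · exact hT.zero_even x w l hle hl
    by_cases hw : Injective w
    swap
    · rw [← hT.noninj x w hw]; exact hT.zero_odd x w l hle hl
    by_cases hl2 : ∃ l', l' ≠ l ∧ ∀ i, x i ≠ w l'
    · obtain ⟨l', hne, hl'⟩ := hl2
      by_cases hle' : Even (l' : ℕ)
      · exact hT.zero_even x w l' hle' hl'
      have e := hT.anti x w (Equiv.swap l' 0)
      have hl0 : l ≠ 0 := by rintro rfl; exact hle (by simp)
      rw [hT.zero x (w ∘ Equiv.swap l' 0) (by simpa using hl'), ← comp_assoc,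
        hT.zero_odd x (w ∘ Equiv.swap l' 0) l hle (by
          rw [comp_apply, Equiv.swap_apply_of_ne_of_ne hne.symm hl0]; exact hl),
        hT.zero_odd x w l hle hl, sub_zero, sub_zero] at e
      exact (mul_eq_zero.mp e.symm).resolve_left (sign_ne _ _)
    · push Not at hl2
      have e0 := c2 x hx (w ∘ Equiv.swap l 1) (hw.comp (Equiv.injective _)) (by simpa using hl) (by
        intro l' hl'
        apply hl2
        intro e
        apply hl'
        have := congrArg (Equiv.swap l 1) e
        rwa [Equiv.swap_apply_self, Equiv.swap_apply_left] at this)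
      rw [hT.D_of_missing x w l hle hl (Equiv.swap l 1) 1 (by simp) (by simpa using hl)] at e0
      exact (mul_eq_zero.mp e0).resolve_left (sign_ne _ _)
  by_cases hall : ∃ l, ∀ i, x₀ i ≠ w₀ l
  · exact c1 x₀ hx₀ w₀ hall
  push Not at hall
  by_cases hw : Injective w₀
  · obtain ⟨y, hy, hyB, hyx⟩ := exists_sorted (n := s) (m := 2 * p + 2) x₀ hx₀
      (Finset.univ.image w₀) (by
        intro c hc
        simp only [Finset.mem_image, Finset.mem_univ, true_and] at hc
        obtain ⟨l, rfl⟩ := hc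
        simpa using hall l) (by
        rw [Finset.card_image_of_injective _ hw]; simp) (by simp)
    have hi : Injective (Sum.elim w₀ y) := hw.sumElim hy.injective (by
      intro a b e; exact hyB b (by simp [← e]))
    obtain ⟨σ, hσ⟩ := exists_perm x₀ _ hi (by
      rintro (l | l)
      · exact hall l
      · exact hyx l)
    have e := N1 w₀ y hi hy
    rw [hσ, hT.alt] at e
    exact (mul_eq_zero.mp e).resolve_left (sign_ne _ σ)
  · have main : ∀ w : Fin (2 * p + 2) → ι, ∀ l l', l ≠ l' → w l = w l' → Even (l : ℕ) →
        T x₀ w = 0 := by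
      intro w l l' hne e hle
      by_cases hm : ∀ i, x₀ i ≠ w l
      · exact hT.zero_even x₀ w l hle hm
      push Not at hm
      obtain ⟨i, hi⟩ := hm
      have : (Finset.univ.image x₀).card < (Finset.univ : Finset ι).card := by
        have h1 : (Finset.univ.image x₀).card ≤ _ := Finset.card_image_le
        rw [Finset.card_univ] at h1 ⊢
        simp only [Fintype.card_sum, Fintype.card_fin] at h1
        omega
      obtain ⟨c, -, hc⟩ := Finset.exists_mem_notMem_of_card_lt_card this
      have hc' : ∀ l, x₀ l ≠ c := fun l e => hc (by simp [← e])
      rw [← hT.rep_even x₀ w i c l hle hx₀ hi hc']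
      refine c1 _ (inj_upd hx₀ i c hc') _ ⟨l', ?_⟩
      rw [update_of_ne hne.symm, ← e, ← hi]
      intro l''
      by_cases h : l'' = i
      · subst h; rw [update_self]; exact (hc' _).symm
      · rw [update_of_ne h]; exact fun e => h (hx₀ e)
    have hw' := hw
    unfold Injective at hw'
    push Not at hw'
    obtain ⟨l, l', e, hne⟩ := hw'
    by_cases hle : Even (l : ℕ)
    · exact main w₀ l l' hne e hle
    · rw [← hT.noninj x₀ w₀ hw]
      refine main _ ((rr p).symm l) ((rr p).symm l') (fun h => hne ((rr p).symm.injective h))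
        (by simpa using e) (even_rot l hle)

end IsCore
end PBWCore

namespace PBW10
set_option linter.unusedSectionVars false
variable (k V : Type) [Field k] [CharZero k] [AddCommGroup V] [Module k V]

/-- signed sum over permutations of the first `n` entries -/
noncomputable def Alt {W : Type*} [AddCommGroup W] (n : ℕ) (F : (ℕ → V) → W) (x : ℕ → V) : W :=
  ∑ σ : Equiv.Perm (Fin n), (Equiv.Perm.sign σ : ℤ) • F (permt V σ x)

lemma permt_permt {n : ℕ} (ρ τ : Equiv.Perm (Fin n)) (x : ℕ → V) :
    permt V ρ (permt V τ x) = permt V (τ * ρ) x := by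
  funext m
  unfold permt
  by_cases h : m < n
  · rw [dif_pos h, dif_pos (Fin.is_lt _), dif_pos h]; rfl
  · rw [dif_neg h, dif_neg h, dif_neg h]

lemma Alt_perm {W : Type*} [AddCommGroup W] (n : ℕ) (F : (ℕ → V) → W) (x : ℕ → V)
    (ρ : Equiv.Perm (Fin n)) :
    Alt V n (fun y => F (permt V ρ y)) x = (Equiv.Perm.sign ρ : ℤ) • Alt V n F x := by
  unfold Alt
  rw [Finset.smul_sum]
  refine Fintype.sum_equiv (Equiv.mulRight ρ) _ _ fun σ => ?_
  beta_reduce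
  rw [permt_permt, Equiv.coe_mulRight, smul_smul, Equiv.Perm.sign_mul]
  congr 1
  push_cast
  rw [mul_comm, mul_assoc]
  simp

lemma Alt_congr {W : Type*} [AddCommGroup W] (n : ℕ) {F G : (ℕ → V) → W} (h : ∀ y, F y = G y)
    (x : ℕ → V) : Alt V n F x = Alt V n G x := by
  rw [show F = G from funext h]

lemma cons_perm_eq (n : ℕ) (j : Fin (n + 1)) (σ : Equiv.Perm (Fin n)) (x : ℕ → V) :
    consT V (x j) (permt V σ (removeN V j x)) =
      permt V (j.cycleRange.symm * Equiv.Perm.decomposeFin.symm (0, σ)) x := by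
  funext m
  unfold consT permt
  rcases m with _ | m
  · simp
  · simp only [Nat.add_eq_zero_iff, one_ne_zero, and_false, if_false, Nat.add_sub_cancel]
    by_cases h : m < n
    · rw [dif_pos h, dif_pos (by omega)]
      have : (⟨m + 1, by omega⟩ : Fin (n + 1)) = (⟨m, h⟩ : Fin n).succ := rfl
      rw [this, Equiv.Perm.mul_apply, Equiv.Perm.decomposeFin_symm_apply_succ, Equiv.swap_self,
        Equiv.refl_apply, Fin.cycleRange_symm_succ]
      unfold removeN
      rw [Fin.succAbove]
      simp only [Fin.lt_def, Fin.val_castSucc]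
      split_ifs <;> simp
    · rw [dif_neg h, dif_neg (by omega)]
      unfold removeN
      rw [if_neg (by omega)]

lemma Alt_cons {W : Type*} [AddCommGroup W] (n : ℕ) (F : (ℕ → V) → W) (x : ℕ → V) :
    ∑ j ∈ Finset.range (n + 1), ((-1 : ℤ) ^ j) •
      Alt V n (fun y => F (consT V (x j) y)) (removeN V j x) = Alt V (n + 1) F x := by
  rw [Finset.sum_range]
  unfold Alt
  simp_rw [Finset.smul_sum]
  rw [← Fintype.sum_prod_type']
  let f : Fin (n + 1) × Equiv.Perm (Fin n) → Equiv.Perm (Fin (n + 1)) := fun q =>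
    q.1.cycleRange.symm * Equiv.Perm.decomposeFin.symm (0, q.2)
  have f0 : ∀ q, f q 0 = q.1 := by intro q; simp [f]
  have finj : Function.Injective f := by
    rintro ⟨i, σ⟩ ⟨j, τ⟩ h
    have h0 : i = j := by
      have := f0 ⟨i, σ⟩
      rw [h, f0] at this
      exact this.symm
    subst h0
    have := Equiv.Perm.decomposeFin.symm.injective (mul_left_cancel h)
    simpa using this
  have fbij : Function.Bijective f := by
    rw [Fintype.bijective_iff_injective_and_card]
    refine ⟨finj, ?_⟩
    simp [Fintype.card_perm, Nat.factorial_succ]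
  refine Fintype.sum_bijective f fbij _ _ fun q => ?_
  rw [cons_perm_eq, smul_smul]
  congr 1
  simp [f, Fin.sign_cycleRange]

/-- `L` placed at position `l`. -/
def gb (s : ℕ) (L : AlternatingMap k V V (Fin (s + 1))) (l : ℕ) (y : ℕ → V) : ℕ → V :=
  fun n => if n < l then y n else if n = l then L (fun i : Fin (s + 1) => y (l + i))
    else y (n + s)

lemma tpN_congr (n : ℕ) (x y : ℕ → V) (h : ∀ i < n, x i = y i) : tpN k V n x = tpN k V n y := by
  unfold tpN
  congr 1
  funext i
  exact h i i.2

lemma prepend_tpN (m : ℕ) (v : V) (y : ℕ → V) :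
    prepend k V m v (tpN k V m y) = tpN k V (m + 1) (consT V v y) := by
  unfold prepend tpN
  simp only [LinearMap.comp_apply, LinearEquiv.coe_coe, TensorProduct.mk_apply]
  rw [← TensorPower.gMul_def, TensorPower.tprod_mul_tprod, TensorPower.cast_tprod]
  congr 1
  funext i
  simp only [Function.comp_apply, consT]
  refine Fin.cases ?_ (fun i => ?_) i
  · have : Fin.cast (Nat.add_comm 1 m).symm 0 = Fin.castAdd m (0 : Fin 1) := by ext; simp
    rw [this, Fin.append_left]; simp
  · have : Fin.cast (Nat.add_comm 1 m).symm i.succ = Fin.natAdd 1 i := by ext; simp; omega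
    rw [this, Fin.append_right]; simp

lemma append_tpN (m : ℕ) (v : V) (y : ℕ → V) :
    append k V m v (tpN k V m y) = tpN k V (m + 1) (putAt V m y v) := by
  unfold append tpN
  simp only [LinearMap.comp_apply, LinearEquiv.coe_coe, LinearMap.flip_apply, TensorProduct.mk_apply]
  rw [← TensorPower.gMul_def, TensorPower.tprod_mul_tprod]
  congr 1
  funext i
  simp only [putAt]
  refine Fin.lastCases ?_ (fun i => ?_) i
  · have : Fin.last m = Fin.natAdd m (0 : Fin 1) := by ext; simp
    rw [this, Fin.append_right]; simp
  · have : i.castSucc = Fin.castAdd 1 i := rfl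
    rw [this, Fin.append_left]
    have := i.2
    simp; omega

lemma consT_blockEv (s : ℕ) (L : AlternatingMap k V V (Fin (s + 1))) (a : ℕ) (v : V) (y : ℕ → V) :
    consT V v (blockEv k V s L a y) = gb k V s L (2 * a + 1) (consT V v y) := by
  funext n
  unfold consT blockEv gb
  rcases n with _ | n
  · simp
  · simp only [Nat.add_eq_zero_iff, one_ne_zero, and_false, if_false, Nat.add_sub_cancel,
      Nat.add_lt_add_iff_right, Nat.add_right_cancel_iff]
    split_ifs
    · rfl
    · congr 1; funext i
      congr 1; omega
    · rename_i h1 h2 h3; simp at h3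
    · congr 1; omega

lemma putAt_blockEv (p s : ℕ) (L : AlternatingMap k V V (Fin (s + 1))) (a : ℕ) (ha : a < p + 1)
    (v : V) (y : ℕ → V) :
    tpN k V (2 * p + 2) (putAt V (2 * p + 1) (blockEv k V s L a y) v) =
      tpN k V (2 * p + 2) (gb k V s L (2 * a)
        (permt V (finRotate (2 * p + 1 + s + 1)) (consT V v y))) := by
  have hrot : ∀ m ≤ 2 * p + 1 + s, permt V (finRotate (2 * p + 1 + s + 1)) (consT V v y) m =
      if m = 2 * p + 1 + s then v else y m := by
    intro m hm
    unfold permt consT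
    rw [dif_pos (by omega)]
    split_ifs with h1 h2 h2
    · rfl
    · exfalso
      by_cases h : m = 2 * p + 1 + s
      · exact h2 h
      · rw [coe_finRotate_of_ne_last (by intro e; exact h (congrArg Fin.val e))] at h1
        simp at h1
    · exfalso; apply h1
      have : (⟨m, by omega⟩ : Fin (2 * p + 1 + s + 1)) = Fin.last _ := Fin.ext h2
      rw [this, finRotate_last]; rfl
    · rw [coe_finRotate_of_ne_last (by intro e; exact h2 (congrArg Fin.val e))]; simp
  apply tpN_congr
  intro n hn
  unfold putAt blockEv gb
  by_cases h1 : n < 2 * a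
  · rw [if_neg (by omega), if_pos h1, if_pos h1, hrot n (by omega), if_neg (by omega)]
  · rw [if_neg h1, if_neg h1]
    by_cases h2 : n = 2 * a
    · rw [if_neg (by omega), if_pos h2, if_pos h2]
      congr 1; funext i
      rw [hrot _ (by omega), if_neg (by omega)]
    · rw [if_neg h2, if_neg h2, hrot _ (by omega)]
      by_cases h3 : n = 2 * p + 1
      · rw [if_pos h3, if_pos (by omega)]
      · rw [if_neg h3, if_neg (by omega)]

end PBW10

namespace PBW10
set_option linter.unusedSectionVars false
variable (k V : Type) [Field k] [CharZero k] [AddCommGroup V] [Module k V]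

lemma zs (n : ℕ) (z : ℤ) (t : ⨂[k]^n V) : z • t = (z : k) • t := by
  rw [← Int.cast_smul_eq_zsmul k z t]

/-- permuting tensor factors -/
noncomputable def Q {n : ℕ} (π : Equiv.Perm (Fin n)) : (⨂[k]^n V) →ₗ[k] (⨂[k]^n V) :=
  (PiTensorProduct.reindex k (fun _ : Fin n => V) π).toLinearMap

lemma Q_tprod {n : ℕ} (π : Equiv.Perm (Fin n)) (f : Fin n → V) :
    Q k V π (tprod k f) = tprod k (fun i => f (π.symm i)) := by
  unfold Q
  exact PiTensorProduct.reindex_tprod π f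

lemma Q_mul {n : ℕ} (π ρ : Equiv.Perm (Fin n)) (t : ⨂[k]^n V) :
    Q k V (π * ρ) t = Q k V π (Q k V ρ t) := by
  have : Q k V (π * ρ) = Q k V π ∘ₗ Q k V ρ := by
    apply PiTensorProduct.ext
    ext f
    simp only [LinearMap.compMultilinearMap_apply, LinearMap.comp_apply, Q_tprod]
    rfl
  rw [this]; rfl

lemma Q_one {n : ℕ} (t : ⨂[k]^n V) : Q k V (1 : Equiv.Perm (Fin n)) t = t := by
  have : Q k V (1 : Equiv.Perm (Fin n)) = LinearMap.id := by
    apply PiTensorProduct.ext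
    ext f
    simp only [LinearMap.compMultilinearMap_apply, Q_tprod]
    rfl
  rw [this]; rfl

lemma Q_asymN {n : ℕ} (π : Equiv.Perm (Fin n)) (x : ℕ → V) :
    Q k V π (asymN k V n x) = (Equiv.Perm.sign π : ℤ) • asymN k V n x := by
  unfold asymN
  simp only [zs]
  rw [map_sum, Finset.smul_sum]
  refine Fintype.sum_equiv (Equiv.mulRight π⁻¹) _ _ fun σ => ?_
  rw [map_smul, Q_tprod, smul_smul]
  congr 1
  simp only [Equiv.coe_mulRight, Equiv.Perm.sign_mul, Equiv.Perm.sign_inv]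
  push_cast
  rw [mul_comm, mul_assoc]
  norm_cast
  simp

lemma Q_wedge {n : ℕ} (π : Equiv.Perm (Fin n)) (t : ⨂[k]^n V) (ht : t ∈ wedgeIm k V n) :
    Q k V π t = (Equiv.Perm.sign π : ℤ) • t := by
  unfold wedgeIm at ht
  rw [zs]
  induction ht using Submodule.span_induction with
  | mem t ht => obtain ⟨x, rfl⟩ := ht; rw [Q_asymN, zs]
  | zero => simp
  | add a b _ _ ha hb => rw [map_add, ha, hb, smul_add]
  | smul c a _ ha => rw [map_smul, ha, smul_comm]

lemma sum_Q_mem {n : ℕ} (t : ⨂[k]^n V) :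
    ∑ π : Equiv.Perm (Fin n), (Equiv.Perm.sign π : ℤ) • Q k V π t ∈ wedgeIm k V n := by
  induction t using PiTensorProduct.induction_on with
  | smul_tprod r f =>
    have : ∑ π : Equiv.Perm (Fin n), (Equiv.Perm.sign π : ℤ) • Q k V π (r • tprod k f) =
        r • asymN k V n (fun i => if h : i < n then f ⟨i, h⟩ else 0) := by
      unfold asymN
      rw [Finset.smul_sum]
      refine Fintype.sum_equiv (Equiv.inv _) _ _ fun σ => ?_
      rw [map_smul, Q_tprod, smul_comm]
      simp
      rfl
    rw [this]
    exact Submodule.smul_mem _ _ (Submodule.subset_span ⟨_, rfl⟩)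
  | add a b ha hb =>
    have := Submodule.add_mem _ ha hb
    rw [← Finset.sum_add_distrib] at this
    simpa only [zs, map_add, smul_add] using this

lemma mem_wedge_of_anti {n : ℕ} (t : ⨂[k]^(n + 1) V)
    (h : ∀ i : Fin n, Q k V (Equiv.swap i.castSucc i.succ) t = -t) : t ∈ wedgeIm k V (n + 1) := by
  have hall : ∀ π : Equiv.Perm (Fin (n + 1)), Q k V π t = (Equiv.Perm.sign π : ℤ) • t := by
    intro π
    have hπ : π ∈ Submonoid.closure (Set.range fun i : Fin n => Equiv.swap i.castSucc i.succ) := by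
      rw [Equiv.Perm.mclosure_swap_castSucc_succ]; trivial
    induction hπ using Submonoid.closure_induction with
    | mem x hx =>
      obtain ⟨i, rfl⟩ := hx
      beta_reduce
      rw [h i, Equiv.Perm.sign_swap (by simp [Fin.ext_iff])]; simp
    | one => simp [Q_one]
    | mul a b _ _ ha hb =>
      rw [Q_mul, hb, map_zsmul, ha, smul_smul, Equiv.Perm.sign_mul]
      congr 1; push_cast; ring
  have hs := sum_Q_mem k V t
  have e : ∑ π : Equiv.Perm (Fin (n + 1)), (Equiv.Perm.sign π : ℤ) • Q k V π t =
      (((n + 1).factorial : ℕ) : k) • t := by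
    have : ∀ π : Equiv.Perm (Fin (n + 1)), (Equiv.Perm.sign π : ℤ) • Q k V π t = t := by
      intro π
      rw [hall, smul_smul]
      norm_cast
      simp
    simp only [this, Finset.sum_const, Finset.card_univ, Fintype.card_perm, Fintype.card_fin]
    rw [Nat.cast_smul_eq_nsmul]
  rw [e] at hs
  have hne : (((n + 1).factorial : ℕ) : k) ≠ 0 := by exact_mod_cast (Nat.factorial_pos _).ne'
  exact (Submodule.smul_mem_iff _ hne).mp hs

lemma permt_swap {n a b : ℕ} (ha : a < n) (hb : b < n) (y : ℕ → V) (m : ℕ) :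
    permt V (Equiv.swap (⟨a, ha⟩ : Fin n) ⟨b, hb⟩) y m = y (Equiv.swap a b m) := by
  unfold permt
  split_ifs with h
  · congr 1
    rw [Equiv.swap_apply_def, Equiv.swap_apply_def]
    simp only [Fin.ext_iff]
    split_ifs <;> rfl
  · rw [Equiv.swap_apply_of_ne_of_ne (by omega) (by omega)]

lemma permt_cycle {n a b : ℕ} (hab : a ≤ b) (hb : b < n) (y : ℕ → V) (m : ℕ) :
    permt V (Fin.cycleIcc (⟨a, by omega⟩ : Fin n) ⟨b, hb⟩).symm y m =
      y (if m = a then b else if a < m ∧ m ≤ b then m - 1 else m) := by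
  unfold permt
  by_cases h : m < n
  · rw [dif_pos h]
    congr 1
    have : NeZero n := ⟨by omega⟩
    have key : ∀ z : Fin n, Fin.cycleIcc (⟨a, by omega⟩ : Fin n) ⟨b, hb⟩ z = ⟨m, h⟩ →
        (((Fin.cycleIcc (⟨a, by omega⟩ : Fin n) ⟨b, hb⟩).symm ⟨m, h⟩ : Fin n) : ℕ) = z := by
      intro z hz; rw [← hz, Equiv.symm_apply_apply]
    split_ifs with h1 h2
    · refine key ⟨b, hb⟩ ?_
      rw [Fin.cycleIcc_of_last (by exact hab)]; exact Fin.ext h1.symm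
    · refine key ⟨m - 1, by omega⟩ ?_
      rw [Fin.cycleIcc_of_ge_of_lt (by simp [Fin.le_def]; omega) (by simp [Fin.lt_def]; omega)]
      ext
      rw [Fin.val_add_one_of_lt' (by simp; omega)]
      simp; omega
    · refine key ⟨m, h⟩ ?_
      rcases lt_or_ge m a with h3 | h3
      · rw [Fin.cycleIcc_of_lt (by simpa [Fin.lt_def] using h3)]
      · rw [Fin.cycleIcc_of_gt (by simp [Fin.lt_def]; omega)]
  · rw [dif_neg h, if_neg (by omega), if_neg (by omega)]

end PBW10

namespace PBW10
set_option linter.unusedSectionVars false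
variable (k V : Type) [Field k] [CharZero k] [AddCommGroup V] [Module k V]

/-- the element `{1, f}(x)` for a function `f` of sequences -/
noncomputable def Om (m s : ℕ) (f : (ℕ → V) → ⨂[k]^m V) (x : ℕ → V) : ⨂[k]^(m + 1) V :=
  (∑ j ∈ Finset.range (m + s + 1), ((-1 : k) ^ j) • prepend k V m (x j) (f (removeN V j x))) +
  ((-1 : k) ^ s) •
    ∑ j ∈ Finset.range (m + s + 1), ((-1 : k) ^ (m + s - j)) •
      append k V m (x j) (f (removeN V j x))

/-- the right-hand side -/
noncomputable def RL (p s : ℕ) (L : AlternatingMap k V V (Fin (s + 1))) (x : ℕ → V) :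
    ⨂[k]^(2 * p + 1) V :=
  Alt V (2 * p + 1 + s)
    (fun y => ∑ a ∈ Finset.range (p + 1), tpN k V (2 * p + 1) (blockEv k V s L a y)) x

lemma Alt_map {n m m' : ℕ} (g : (⨂[k]^m V) →ₗ[k] (⨂[k]^m' V)) (F : (ℕ → V) → ⨂[k]^m V)
    (x : ℕ → V) : g (Alt V n F x) = Alt V n (fun y => g (F y)) x := by
  unfold Alt
  simp only [zs]
  rw [map_sum]
  simp only [map_smul]

lemma Alt_sum {n m : ℕ} {τ : Type*} (S : Finset τ) (F : τ → (ℕ → V) → ⨂[k]^m V)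
    (x : ℕ → V) : Alt V n (fun y => ∑ a ∈ S, F a y) x = ∑ a ∈ S, Alt V n (F a) x := by
  unfold Alt
  simp only [zs]
  rw [Finset.sum_comm]
  simp only [Finset.smul_sum]

/-- `L` at position `l`, antisymmetrized -/
noncomputable def HH (p s : ℕ) (L : AlternatingMap k V V (Fin (s + 1))) (x : ℕ → V) (l : ℕ) :
    ⨂[k]^(2 * p + 1 + 1) V :=
  Alt V (2 * p + 1 + s + 1) (fun y => tpN k V (2 * p + 1 + 1) (gb k V s L l y)) x

lemma Om_RL (p s : ℕ) (L : AlternatingMap k V V (Fin (s + 1))) (x : ℕ → V) :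
    Om k V (2 * p + 1) s (RL k V p s L) x =
      (∑ a ∈ Finset.range (p + 1), HH k V p s L x (2 * a + 1)) +
      ((-1 : k) ^ s) • ∑ a ∈ Finset.range (p + 1), HH k V p s L x (2 * a) := by
  unfold Om
  congr 1
  · rw [show (∑ a ∈ Finset.range (p + 1), HH k V p s L x (2 * a + 1)) =
      Alt V (2 * p + 1 + s + 1) (fun y => ∑ a ∈ Finset.range (p + 1),
        tpN k V (2 * p + 1 + 1) (gb k V s L (2 * a + 1) y)) x from (Alt_sum k V _ _ x).symm,
      ← Alt_cons]
    refine Finset.sum_congr rfl fun j _ => ?_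
    rw [zs]
    push_cast
    congr 1
    unfold RL
    rw [Alt_map]
    refine Alt_congr V _ (fun y => ?_) _
    rw [map_sum]
    refine Finset.sum_congr rfl fun a _ => ?_
    rw [prepend_tpN, consT_blockEv]
  · congr 1
    have e := Alt_perm V (2 * p + 1 + s + 1) (fun y => ∑ a ∈ Finset.range (p + 1),
        tpN k V (2 * p + 1 + 1) (gb k V s L (2 * a) y)) x (finRotate (2 * p + 1 + s + 1))
    rw [← Alt_cons, Alt_sum, zs, sign_finRotate] at e
    have e2 : ∑ j ∈ Finset.range (2 * p + 1 + s + 1), ((-1 : k) ^ (2 * p + 1 + s - j)) •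
      append k V (2 * p + 1) (x j) (RL k V p s L (removeN V j x)) = ((-1 : k) ^ (2 * p + 1 + s)) •
      ∑ j ∈ Finset.range (2 * p + 1 + s + 1), ((-1 : ℤ) ^ j) •
        Alt V (2 * p + 1 + s) (fun y => ∑ a ∈ Finset.range (p + 1),
        tpN k V (2 * p + 1 + 1) (gb k V s L (2 * a)
          (permt V (finRotate (2 * p + 1 + s + 1)) (consT V (x j) y)))) (removeN V j x) := by
      rw [Finset.smul_sum]
      refine Finset.sum_congr rfl fun j hj => ?_
      rw [Finset.mem_range] at hj
      rw [zs, smul_smul]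
      push_cast
      congr 1
      · obtain ⟨i, hi⟩ : ∃ i, 2 * p + 1 + s = j + i := ⟨2 * p + 1 + s - j, by omega⟩
        rw [hi, Nat.add_sub_cancel_left, pow_add]
        have : (-1 : k) ^ j * (-1 : k) ^ j = 1 := by rw [← mul_pow]; simp
        linear_combination (-(-1 : k) ^ i) * this
      · unfold RL
        rw [Alt_map]
        refine Alt_congr V _ (fun y => ?_) _
        rw [map_sum]
        refine Finset.sum_congr rfl fun a ha => ?_
        rw [append_tpN]
        exact putAt_blockEv k V p s L a (Finset.mem_range.mp ha) _ _
    rw [e2, e, smul_smul]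
    push_cast
    rw [← mul_pow]
    simp
    rfl

lemma swap_HH_of_ne (p s : ℕ) (L : AlternatingMap k V V (Fin (s + 1))) (x : ℕ → V)
    (i : Fin (2 * p + 1)) (l : ℕ) (h1 : l ≠ i) (h2 : l ≠ i + 1) (hl : l < 2 * p + 2) :
    Q k V (Equiv.swap i.castSucc i.succ) (HH k V p s L x l) = - HH k V p s L x l := by
  have hi := i.2
  have val : ∀ j : Fin (2 * p + 1 + 1), ((Equiv.swap i.castSucc i.succ j : Fin (2 * p + 1 + 1)) : ℕ) =
      Equiv.swap (i : ℕ) (i + 1) j := by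
    intro j
    rw [Equiv.swap_apply_def, Equiv.swap_apply_def]
    simp only [Fin.ext_iff, Fin.val_castSucc, Fin.val_succ]
    split_ifs <;> rfl
  have main : ∃ (a b : Fin (2 * p + 1 + s + 1)), a ≠ b ∧ ∀ (y : ℕ → V) (j : ℕ), j < 2 * p + 2 →
      gb k V s L l y (Equiv.swap (i : ℕ) (i + 1) j) = gb k V s L l (permt V (Equiv.swap a b) y) j := by
    rcases lt_or_ge l i with h | h
    · refine ⟨⟨i + s, by omega⟩, ⟨i + s + 1, by omega⟩, by simp, fun y j hj => ?_⟩
      unfold gb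
      simp only [permt_swap]
      by_cases hj1 : j < l
      · rw [Equiv.swap_apply_of_ne_of_ne (by omega) (by omega), if_pos hj1, if_pos hj1,
          Equiv.swap_apply_of_ne_of_ne (by omega) (by omega)]
      rw [if_neg hj1]
      by_cases hj2 : j = l
      · rw [Equiv.swap_apply_of_ne_of_ne (by omega) (by omega), if_neg hj1, if_pos hj2, if_pos hj2]
        congr 1; funext t
        rw [Equiv.swap_apply_of_ne_of_ne (by omega) (by omega)]
      rw [if_neg hj2]
      have : ¬ (Equiv.swap (i : ℕ) (i + 1) j < l) ∧ Equiv.swap (i : ℕ) (i + 1) j ≠ l := by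
        rw [Equiv.swap_apply_def]; split_ifs <;> omega
      rw [if_neg this.1, if_neg this.2]
      congr 1
      rw [Equiv.swap_apply_def, Equiv.swap_apply_def]
      split_ifs <;> omega
    · refine ⟨⟨i, by omega⟩, ⟨i + 1, by omega⟩, by simp, fun y j hj => ?_⟩
      unfold gb
      simp only [permt_swap]
      by_cases hj1 : j < l
      · have : (Equiv.swap (i : ℕ) (i + 1) j < l) := by
          rw [Equiv.swap_apply_def]; split_ifs <;> omega
        rw [if_pos this, if_pos hj1]
      rw [if_neg hj1, Equiv.swap_apply_of_ne_of_ne (by omega) (by omega), if_neg hj1]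
      by_cases hj2 : j = l
      · rw [if_pos hj2, if_pos hj2]
        congr 1; funext t
        rw [Equiv.swap_apply_of_ne_of_ne (by omega) (by omega)]
      rw [if_neg hj2, if_neg hj2, Equiv.swap_apply_of_ne_of_ne (by omega) (by omega)]
  obtain ⟨a, b, hab, hm⟩ := main
  unfold HH
  rw [Alt_map]
  have e := Alt_perm V (2 * p + 1 + s + 1) (fun y => tpN k V (2 * p + 1 + 1) (gb k V s L l y)) x
    (Equiv.swap a b)
  rw [Equiv.Perm.sign_swap hab, zs] at e
  rw [show -(Alt V (2 * p + 1 + s + 1) (fun y => tpN k V (2 * p + 1 + 1) (gb k V s L l y)) x) =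
    (((-1 : ℤˣ) : ℤ) : k) • Alt V (2 * p + 1 + s + 1) (fun y => tpN k V (2 * p + 1 + 1) (gb k V s L l y)) x by simp, ← e]
  refine Alt_congr V _ (fun y => ?_) _
  unfold tpN
  rw [Q_tprod]
  congr 1
  funext j
  rw [Equiv.symm_swap, val, hm y j j.2]

lemma swap_HH_eq (p s : ℕ) (L : AlternatingMap k V V (Fin (s + 1))) (x : ℕ → V)
    (i : Fin (2 * p + 1)) :
    Q k V (Equiv.swap i.castSucc i.succ) (HH k V p s L x i) =
      ((-1 : k) ^ (s + 1)) • HH k V p s L x (i + 1) := by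
  have hi := i.2
  have val : ∀ j : Fin (2 * p + 1 + 1), ((Equiv.swap i.castSucc i.succ j : Fin (2 * p + 1 + 1)) : ℕ) =
      Equiv.swap (i : ℕ) (i + 1) j := by
    intro j
    rw [Equiv.swap_apply_def, Equiv.swap_apply_def]
    simp only [Fin.ext_iff, Fin.val_castSucc, Fin.val_succ]
    split_ifs <;> rfl
  unfold HH
  rw [Alt_map]
  have e := Alt_perm V (2 * p + 1 + s + 1) (fun y => tpN k V (2 * p + 1 + 1) (gb k V s L (i + 1) y)) x
    (Fin.cycleIcc (⟨i, by omega⟩ : Fin (2 * p + 1 + s + 1)) ⟨i + s + 1, by omega⟩).symm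
  rw [Equiv.Perm.sign_symm, Fin.sign_cycleIcc_of_le (by simp [Fin.le_def]; omega), zs] at e
  simp only [show (i : ℕ) + s + 1 - i = s + 1 by omega] at e
  push_cast at e
  rw [← e]
  refine Alt_congr V _ (fun y => ?_) _
  unfold tpN
  rw [Q_tprod]
  congr 1
  funext j
  rw [Equiv.symm_swap, val]
  have hj := j.2
  generalize (j : ℕ) = j at hj
  unfold gb
  simp only [permt_cycle V (show (i : ℕ) ≤ i + s + 1 by omega) (show (i : ℕ) + s + 1 < 2 * p + 1 + s + 1 by omega)]
  by_cases h1 : j < i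
  · rw [Equiv.swap_apply_of_ne_of_ne (by omega) (by omega), if_pos h1, if_pos (by omega),
      if_neg (by omega), if_neg (by omega)]
  by_cases h2 : j = i
  · subst h2
    rw [Equiv.swap_apply_left, if_neg (by omega), if_neg (by omega), if_pos (by omega), if_pos rfl]
    congr 1; omega
  by_cases h3 : j = i + 1
  · subst h3
    rw [Equiv.swap_apply_right, if_neg (by omega), if_pos rfl, if_neg (by omega), if_pos rfl]
    congr 1; funext t
    rw [if_neg (by omega), if_pos (by omega)]
    congr 1; omega
  · rw [Equiv.swap_apply_of_ne_of_ne (by omega) (by omega), if_neg h1, if_neg h2, if_neg (by omega),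
      if_neg (by omega), if_neg (by omega), if_neg (by omega)]

lemma sum_pair {M : Type*} [AddCommMonoid M] (f : ℕ → M) (n : ℕ) :
    ∑ l ∈ Finset.range (2 * n), f l =
      (∑ a ∈ Finset.range n, f (2 * a + 1)) + ∑ a ∈ Finset.range n, f (2 * a) := by
  induction n with
  | zero => simp
  | succ n ih =>
    rw [show 2 * (n + 1) = 2 * n + 1 + 1 by ring, Finset.sum_range_succ, Finset.sum_range_succ, ih,
      Finset.sum_range_succ, Finset.sum_range_succ]
    abel

theorem Om_RL_mem (p s : ℕ) (L : AlternatingMap k V V (Fin (s + 1))) (x : ℕ → V) :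
    Om k V (2 * p + 1) s (RL k V p s L) x ∈ wedgeIm k V (2 * p + 1 + 1) := by
  have e : Om k V (2 * p + 1) s (RL k V p s L) x =
      ∑ l ∈ Finset.range (2 * (p + 1)), (((-1 : k) ^ s) ^ (l + 1)) • HH k V p s L x l := by
    rw [Om_RL, sum_pair, Finset.smul_sum]
    congr 1
    · refine Finset.sum_congr rfl fun a _ => ?_
      rw [← pow_mul, show s * (2 * a + 1 + 1) = 2 * (s * (a + 1)) by ring, pow_mul]; simp
    · refine Finset.sum_congr rfl fun a _ => ?_
      rw [← pow_mul, show s * (2 * a + 1) = 2 * (s * a) + s by ring, pow_add, pow_mul]; simp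
  rw [e]
  apply mem_wedge_of_anti
  intro i
  have hi := i.2
  rw [eq_neg_iff_add_eq_zero, map_sum, ← Finset.sum_add_distrib]
  have ei := swap_HH_eq k V p s L x i
  have ei' : Q k V (Equiv.swap i.castSucc i.succ) (HH k V p s L x (i + 1)) =
      ((-1 : k) ^ (s + 1)) • HH k V p s L x i := by
    have := congrArg (Q k V (Equiv.swap i.castSucc i.succ)) ei
    rw [← Q_mul, Equiv.swap_mul_self, Q_one, map_smul] at this
    rw [this, smul_smul, ← mul_pow]; simp
  rw [Finset.sum_eq_add (i : ℕ) (i + 1) (by omega)]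
  · rw [map_smul, map_smul, ei, ei', pow_succ _ (i + 1 : ℕ)]
    have h2 : ((-1 : k) ^ s) * ((-1 : k) ^ s) = 1 := by rw [← mul_pow]; simp
    generalize HH k V p s L x i = A
    generalize HH k V p s L x (i + 1) = B
    rw [pow_succ (-1 : k) s]
    generalize (-1 : k) ^ s = c at *
    generalize c ^ (i + 1 : ℕ) = d
    have : d • (c * -1) • B + d • A + ((d * c) • (c * -1) • A + (d * c) • B) = 0 := by
      match_scalars
      · linear_combination 0 * h2
      · linear_combination (-d) * h2
    exact this
  · intro l hl h
    rw [map_smul, swap_HH_of_ne k V p s L x i l h.1 h.2 (by rw [Finset.mem_range] at hl; omega)]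
    simp
  · intro h; exact absurd (Finset.mem_range.mpr (by omega)) h
  · intro h; exact absurd (Finset.mem_range.mpr (by omega)) h

end PBW10

namespace PBW10
set_option linter.unusedSectionVars false
variable (k V : Type) [Field k] [CharZero k] [AddCommGroup V] [Module k V]

section coef
variable {k V} {ι : Type} [Fintype ι] [DecidableEq ι] (b : Module.Basis ι k V)

/-- coefficient at a word -/
noncomputable def cf {n : ℕ} (w : Fin n → ι) : (⨂[k]^n V) →ₗ[k] k :=
  PiTensorProduct.lift ((MultilinearMap.mkPiAlgebra k (Fin n) k).compLinearMap
    (fun i => b.coord (w i)))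

lemma cf_tprod {n : ℕ} (w : Fin n → ι) (f : Fin n → V) :
    cf b w (tprod k f) = ∏ i, b.repr (f i) (w i) := by
  unfold cf
  rw [PiTensorProduct.lift.tprod]
  simp

lemma cf_ext {n : ℕ} (t : ⨂[k]^n V) (h : ∀ w : Fin n → ι, cf b w t = 0) : t = 0 := by
  have e : ∀ w : Fin n → ι, cf b w =
      (Finsupp.lapply w) ∘ₗ (Basis.piTensorProduct (fun _ : Fin n => b)).repr.toLinearMap := by
    intro w
    apply PiTensorProduct.ext
    ext f
    simp only [LinearMap.compMultilinearMap_apply, cf_tprod, LinearMap.comp_apply,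
      LinearEquiv.coe_coe, Finsupp.lapply_apply]
    exact (Basis.piTensorProduct_repr_tprod_apply (fun _ : Fin n => b) f w).symm
  apply (Basis.piTensorProduct (fun _ : Fin n => b)).repr.injective
  rw [map_zero]
  ext w
  have := h w
  rw [e w] at this
  exact this

lemma tprod_tpN {n : ℕ} (f : Fin n → V) :
    tprod k f = tpN k V n (fun i => if h : i < n then f ⟨i, h⟩ else 0) := by
  unfold tpN; congr 1; funext i; simp

lemma cf_prepend {n : ℕ} (w : Fin (n + 1) → ι) (v : V) (t : ⨂[k]^n V) :
    cf b w (prepend k V n v t) = b.repr v (w 0) * cf b (fun i => w i.succ) t := by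
  have : cf b w ∘ₗ prepend k V n v = (b.repr v (w 0)) • cf b (fun i => w i.succ) := by
    apply PiTensorProduct.ext
    ext f
    simp only [LinearMap.compMultilinearMap_apply, LinearMap.comp_apply, LinearMap.smul_apply,
      smul_eq_mul]
    rw [cf_tprod, tprod_tpN, prepend_tpN, tpN, cf_tprod, Fin.prod_univ_succ]
    simp [consT]
  exact LinearMap.congr_fun this t

lemma cf_append {n : ℕ} (w : Fin (n + 1) → ι) (v : V) (t : ⨂[k]^n V) :
    cf b w (append k V n v t) = b.repr v (w (Fin.last n)) * cf b (fun i => w i.castSucc) t := by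
  have : cf b w ∘ₗ append k V n v = (b.repr v (w (Fin.last n))) • cf b (fun i => w i.castSucc) := by
    apply PiTensorProduct.ext
    ext f
    simp only [LinearMap.compMultilinearMap_apply, LinearMap.comp_apply, LinearMap.smul_apply,
      smul_eq_mul]
    rw [cf_tprod, tprod_tpN, append_tpN, tpN, cf_tprod, Fin.prod_univ_castSucc, mul_comm]
    simp only [putAt, Fin.val_last, if_true, Fin.val_castSucc]
    congr 1
    refine Finset.prod_congr rfl fun i _ => ?_
    rw [if_neg (by omega), dif_pos i.2]
  exact LinearMap.congr_fun this t

lemma cf_Q {n : ℕ} (w : Fin n → ι) (π : Equiv.Perm (Fin n)) (t : ⨂[k]^n V) :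
    cf b w (Q k V π t) = cf b (w ∘ π) t := by
  have : cf b w ∘ₗ Q k V π = cf b (w ∘ π) := by
    apply PiTensorProduct.ext
    ext f
    simp only [LinearMap.compMultilinearMap_apply, LinearMap.comp_apply]
    rw [cf_tprod, Q_tprod, cf_tprod]
    refine Fintype.prod_equiv π.symm _ _ fun i => ?_
    simp
  exact LinearMap.congr_fun this t

variable {p s : ℕ}

/-- hypothesis on an alternating map -/
def Hyp (A : AlternatingMap k V (⨂[k]^(2 * p + 1) V) (Fin (2 * p + 1 + s))) : Prop :=
  ∀ x : ℕ → V, Om k V (2 * p + 1) s (fun x => A (fun i => x i)) x ∈ wedgeIm k V (2 * p + 1 + 1)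

/-- the alternating map with the coefficients `T` -/
noncomputable def TT (A : AlternatingMap k V (⨂[k]^(2 * p + 1) V) (Fin (2 * p + 1 + s)))
    (w : Fin (2 * p + 2) → ι) : AlternatingMap k V k (Fin (2 * p + 1 + s + 1)) :=
  AlternatingMap.alternatizeUncurryFin
    (LinearMap.smulRight (b.coord (w 0)) ((cf b (fun i : Fin (2 * p + 1) => w i.succ)).compAlternatingMap A))

lemma TT_apply (A : AlternatingMap k V (⨂[k]^(2 * p + 1) V) (Fin (2 * p + 1 + s)))
    (w : Fin (2 * p + 2) → ι) (v : Fin (2 * p + 1 + s + 1) → V) :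
    TT b A w v = ∑ j : Fin (2 * p + 1 + s + 1), ((-1 : k) ^ (j : ℕ)) * (b.repr (v j) (w 0) *
      cf b (fun i : Fin (2 * p + 1) => w i.succ) (A (j.removeNth v))) := by
  unfold TT
  rw [AlternatingMap.alternatizeUncurryFin_apply]
  refine Finset.sum_congr rfl fun j _ => ?_
  rw [zsmul_eq_mul]
  push_cast
  simp

/-- index bijection -/
def ee (p s : ℕ) : Fin (2 * p + 1 + s + 1) ≃ Fin (2 * p + 2) ⊕ Fin s :=
  (finCongr (by omega)).trans finSumFinEquiv.symm

/-- the coefficients as in the combinatorial core -/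
noncomputable def Tc (A : AlternatingMap k V (⨂[k]^(2 * p + 1) V) (Fin (2 * p + 1 + s)))
    (x : Fin (2 * p + 2) ⊕ Fin s → ι) (w : Fin (2 * p + 2) → ι) : k :=
  TT b A w (fun i => b (x (ee p s i)))

lemma cf_Om (A : AlternatingMap k V (⨂[k]^(2 * p + 1) V) (Fin (2 * p + 1 + s)))
    (w : Fin (2 * p + 2) → ι) (x : ℕ → V) :
    cf b w (Om k V (2 * p + 1) s (fun x => A (fun i => x i)) x) =
      TT b A w (fun i => x i) - TT b A (w ∘ PBWCore.rr p) (fun i => x i) := by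
  have hrem : ∀ j : Fin (2 * p + 1 + s + 1),
      (fun i : Fin (2 * p + 1 + s) => removeN V j x i) =
        j.removeNth (fun i : Fin (2 * p + 1 + s + 1) => x i) := by
    intro j; funext i
    unfold removeN
    rw [Fin.removeNth_apply, Fin.succAbove]
    simp only [Fin.lt_def, Fin.val_castSucc]
    split_ifs <;> simp
  have h0 : (PBWCore.rr p) 0 = Fin.last (2 * p + 1) := by
    unfold PBWCore.rr
    rw [Equiv.symm_apply_eq, finRotate_last]
  have hs : ∀ i : Fin (2 * p + 1), (PBWCore.rr p) i.succ = i.castSucc := by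
    intro i
    unfold PBWCore.rr
    rw [Equiv.symm_apply_eq]
    ext
    rw [coe_finRotate_of_ne_last (Fin.castSucc_lt_last i).ne]
    simp
  rw [TT_apply, TT_apply]
  unfold Om
  rw [map_add, map_smul, map_sum, map_sum, Finset.sum_range, Finset.sum_range, sub_eq_add_neg,
    smul_eq_mul, Finset.mul_sum, ← Finset.sum_neg_distrib]
  congr 1
  · refine Finset.sum_congr rfl fun j _ => ?_
    rw [map_smul, cf_prepend]; beta_reduce; rw [hrem]; rfl
  · refine Finset.sum_congr rfl fun j _ => ?_
    rw [map_smul, cf_append]; beta_reduce; rw [hrem]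
    simp only [Function.comp_apply, h0, hs, smul_eq_mul]
    obtain ⟨i, hi⟩ : ∃ i, 2 * p + 1 + s = j + i := ⟨2 * p + 1 + s - j, by omega⟩
    have e : ((-1 : k) ^ s) * ((-1 : k) ^ (2 * p + 1 + s - j)) = - ((-1 : k) ^ (j : ℕ)) := by
      have : (-1 : k) ^ (j : ℕ) * (-1 : k) ^ (j : ℕ) = 1 := by rw [← mul_pow]; simp
      have h3 : (-1 : k) ^ s * (-1 : k) ^ (2 * p + 1 + s) = -1 := by
        rw [← pow_add, show s + (2 * p + 1 + s) = 2 * (s + p) + 1 by ring, pow_succ, pow_mul]; simp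
      rw [hi, pow_add] at h3
      rw [show 2 * p + 1 + s - (j : ℕ) = i by omega]
      linear_combination (-1 : k) ^ (j : ℕ) * h3 - (-1 : k) ^ s * (-1 : k) ^ i * this
    rw [← mul_assoc, e]
    ring

lemma TT_single (A : AlternatingMap k V (⨂[k]^(2 * p + 1) V) (Fin (2 * p + 1 + s)))
    (w : Fin (2 * p + 2) → ι) (x : Fin (2 * p + 1 + s + 1) → ι) (hx : Function.Injective x)
    (j : Fin (2 * p + 1 + s + 1)) (hj : x j = w 0) :
    TT b A w (fun i => b (x i)) = ((-1 : k) ^ (j : ℕ)) *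
      cf b (fun i : Fin (2 * p + 1) => w i.succ) (A (fun i => b (x (j.succAbove i)))) := by
  rw [TT_apply, Finset.sum_eq_single j]
  · rw [hj]; simp; rfl
  · intro i _ hi
    have : x i ≠ w 0 := fun e => hi (hx (e.trans hj.symm))
    simp [this]
  · simp

theorem isCore (A : AlternatingMap k V (⨂[k]^(2 * p + 1) V) (Fin (2 * p + 1 + s))) (hA : Hyp A) :
    PBWCore.IsCore p s (Tc b A) where
  alt σ x w := by
    unfold Tc
    have := (TT b A w).map_perm (fun i => b (x (ee p s i))) ((ee p s).symm.permCongr σ)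
    rw [Equiv.Perm.sign_permCongr] at this
    have e2 : (fun i => b (x (ee p s i))) ∘ ((ee p s).symm.permCongr σ) =
      fun i => b ((x ∘ σ) (ee p s i)) := by
      funext i; simp [Equiv.permCongr_apply]
    rw [e2] at this
    rw [this, Units.smul_def, zsmul_eq_mul]
  zero x w h := by
    unfold Tc
    rw [TT_apply]
    refine Finset.sum_eq_zero fun j _ => ?_
    simp [h]
  rep x w i c hx hi hc := by
    unfold Tc
    have e1 := TT_single b A w _ (hx.comp (ee p s).injective) ((ee p s).symm i) (by simpa using hi)
    have e2 := TT_single b A (Function.update w 0 c) _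
      ((PBWCore.inj_upd hx i c hc).comp (ee p s).injective) ((ee p s).symm i) (by simp)
    simp only [Function.comp_apply] at e1 e2
    rw [e1, e2]
    congr 1
    have : ∀ j, Function.update x i c (ee p s (((ee p s).symm i).succAbove j)) =
        x (ee p s (((ee p s).symm i).succAbove j)) := by
      intro j
      rw [Function.update_of_ne]
      intro e
      exact Fin.succAbove_ne _ _ ((Equiv.eq_symm_apply _).mpr e)
    simp only [Function.comp_apply, this]
    congr 2
  anti x w π := by
    unfold Tc
    let X : ℕ → V := fun n => if h : n < 2 * p + 1 + s + 1 then b (x (ee p s ⟨n, h⟩)) else 0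
    have hX : (fun i => b (x (ee p s i))) = fun i : Fin (2 * p + 1 + s + 1) => X i := by
      funext i; simp only [X]; rw [dif_pos i.2]
    have h := Q_wedge k V π _ (hA X)
    have e := congrArg (cf b w) h
    rw [cf_Q, cf_Om, zs, map_smul, cf_Om] at e
    rw [hX, ← Function.comp_assoc, e, smul_eq_mul]

theorem eq_zero_of_T (A : AlternatingMap k V (⨂[k]^(2 * p + 1) V) (Fin (2 * p + 1 + s)))
    (hd : 2 * p + s + 3 ≤ Fintype.card ι)
    (h : ∀ x w, Function.Injective x → Tc b A x w = 0) : A = 0 := by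
  refine Module.Basis.ext_alternating b fun y hy => ?_
  rw [AlternatingMap.zero_apply]
  refine cf_ext b _ fun w => ?_
  have : (Finset.univ.image y).card < (Finset.univ : Finset ι).card := by
    have h1 : (Finset.univ.image y).card ≤ _ := Finset.card_image_le
    rw [Finset.card_univ] at h1 ⊢
    simp only [Fintype.card_fin] at h1
    omega
  obtain ⟨c, -, hc⟩ := Finset.exists_mem_notMem_of_card_lt_card this
  have hx : Function.Injective (Fin.cons c y : Fin (2 * p + 1 + s + 1) → ι) := by
    rw [Fin.cons_injective_iff]
    exact ⟨by rintro ⟨i, e⟩; exact hc (by simp [← e]), hy⟩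
  have h1 := h ((Fin.cons c y : Fin (2 * p + 1 + s + 1) → ι) ∘ (ee p s).symm)
    (Fin.cons c w) (hx.comp (ee p s).symm.injective)
  unfold Tc at h1
  simp only [Function.comp_apply, Equiv.symm_apply_apply] at h1
  rw [TT_single b A _ _ hx 0 (by simp)] at h1
  simpa using h1

end coef
end PBW10

namespace PBW10
set_option linter.unusedSectionVars false
variable {k V : Type} [Field k] [CharZero k] [AddCommGroup V] [Module k V]

/-- extension of a finite sequence by zero -/
def exN {n : ℕ} (v : Fin n → V) : ℕ → V := fun i => if h : i < n then v ⟨i, h⟩ else 0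

lemma exN_val {n : ℕ} (v : Fin n → V) (i : ℕ) (h : i < n) : exN v i = v ⟨i, h⟩ := dif_pos h

/-- `α` as an alternating map -/
noncomputable def alphaAlt (n m : ℕ) (α : wedgeIm k V n →ₗ[k] ⨂[k]^m V) :
    AlternatingMap k V (⨂[k]^m V) (Fin n) :=
  α.compAlternatingMap ((MultilinearMap.alternatization (tprod k)).codRestrict (wedgeIm k V n)
    (fun v => by
      refine Submodule.subset_span ⟨exN v, ?_⟩
      rw [MultilinearMap.alternatization_apply]
      unfold asymN
      refine Finset.sum_congr rfl fun σ _ => ?_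
      rw [Units.smul_def, MultilinearMap.domDomCongr_apply]
      congr 2
      funext i
      rw [exN_val _ _ (Fin.is_lt _)]))

lemma alphaAlt_apply (n m : ℕ) (α : wedgeIm k V n →ₗ[k] ⨂[k]^m V) (x : ℕ → V) :
    alphaAlt n m α (fun i => x i) = α (wdgN k V n x) := by
  unfold alphaAlt
  rw [LinearMap.compAlternatingMap_apply]
  congr 1
  apply Subtype.ext
  change (MultilinearMap.alternatization (tprod k)) _ = asymN k V n x
  rw [MultilinearMap.alternatization_apply]
  unfold asymN
  refine Finset.sum_congr rfl fun σ _ => ?_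
  rw [Units.smul_def, MultilinearMap.domDomCongr_apply]

variable (p s : ℕ) (L : AlternatingMap k V V (Fin (s + 1)))

lemma blockEv_congr (a : ℕ) (ha : a < p + 1) (y z : ℕ → V) (h : ∀ i < 2 * p + 1 + s, y i = z i)
    (n : ℕ) (hn : n < 2 * p + 1) : blockEv k V s L a y n = blockEv k V s L a z n := by
  unfold blockEv
  split_ifs
  · exact h _ (by omega)
  · congr 1; funext i; exact h _ (by omega)
  · exact h _ (by omega)

lemma block_update (a : ℕ) (ha : a < p + 1) (v : Fin (2 * p + 1 + s) → V)
    (i : Fin (2 * p + 1 + s)) : ∃ (f : Fin (2 * p + 1) → V) (l : Fin (2 * p + 1)) (g : V →ₗ[k] V),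
      ∀ c, tpN k V (2 * p + 1) (blockEv k V s L a (exN (Function.update v i c))) =
        tprod k (Function.update f l (g c)) := by
  have hi := i.2
  have hex : ∀ c (n : ℕ), n < 2 * p + 1 + s → exN (Function.update v i c) n =
      if n = i then c else exN v n := by
    intro c n hn
    rw [exN_val _ _ hn]
    split_ifs with h
    · have : (⟨n, hn⟩ : Fin (2 * p + 1 + s)) = i := Fin.ext h
      rw [this, Function.update_self]
    · rw [Function.update_of_ne (fun e => h (congrArg Fin.val e)), exN_val]
  by_cases h1 : (i : ℕ) < 2 * a
  · refine ⟨fun n => blockEv k V s L a (exN v) n, ⟨i, by omega⟩, LinearMap.id, fun c => ?_⟩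
    unfold tpN; congr 1; funext n
    have hn := n.2
    by_cases h : n = ⟨i, by omega⟩
    · rw [h, Function.update_self]
      unfold blockEv
      simp only
      rw [if_pos h1, hex _ _ (by omega), if_pos rfl]; rfl
    · rw [Function.update_of_ne h]
      have h' : (n : ℕ) ≠ i := fun e => h (Fin.ext e)
      unfold blockEv
      split_ifs
      · rw [hex _ _ (by omega), if_neg h']
      · congr 1; funext t; rw [hex _ _ (by omega), if_neg (by omega)]
      · rw [hex _ _ (by omega), if_neg (by omega)]
  by_cases h2 : (i : ℕ) ≤ 2 * a + s
  · refine ⟨fun n => blockEv k V s L a (exN v) n, ⟨2 * a, by omega⟩,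
      L.toMultilinearMap.toLinearMap (fun t : Fin (s + 1) => exN v (2 * a + t)) ⟨i - 2 * a, by omega⟩,
      fun c => ?_⟩
    unfold tpN; congr 1; funext n
    have hn := n.2
    by_cases h : n = ⟨2 * a, by omega⟩
    · rw [h, Function.update_self]
      unfold blockEv
      simp only
      rw [if_neg (by omega), if_pos trivial, MultilinearMap.toLinearMap_apply]
      change L _ = L _
      congr 1
      funext t
      rw [hex _ _ (by omega)]
      by_cases ht : t = ⟨i - 2 * a, by omega⟩
      · rw [ht, Function.update_self]; simp only; rw [if_pos (by omega)]
      · have ht' : (t : ℕ) ≠ i - 2 * a := fun e => ht (Fin.ext e)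
        rw [Function.update_of_ne ht, if_neg (by omega)]
    · rw [Function.update_of_ne h]
      have h' : (n : ℕ) ≠ 2 * a := fun e => h (Fin.ext e)
      unfold blockEv
      split_ifs
      · rw [hex _ _ (by omega), if_neg (by omega)]
      · rw [hex _ _ (by omega), if_neg (by omega)]
  · refine ⟨fun n => blockEv k V s L a (exN v) n, ⟨i - s, by omega⟩, LinearMap.id, fun c => ?_⟩
    unfold tpN; congr 1; funext n
    have hn := n.2
    by_cases h : n = ⟨i - s, by omega⟩
    · rw [h, Function.update_self]
      unfold blockEv
      simp only
      rw [if_neg (by omega), if_neg (by omega), hex _ _ (by omega), if_pos (by omega)]; rfl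
    · rw [Function.update_of_ne h]
      have h' : (n : ℕ) ≠ i - s := fun e => h (Fin.ext e)
      unfold blockEv
      split_ifs
      · rw [hex _ _ (by omega), if_neg (by omega)]
      · congr 1; funext t; rw [hex _ _ (by omega), if_neg (by omega)]
      · rw [hex _ _ (by omega), if_neg (by omega)]

/-- the multilinear map of one block -/
noncomputable def MB (a : Fin (p + 1)) :
    MultilinearMap k (fun _ : Fin (2 * p + 1 + s) => V) (⨂[k]^(2 * p + 1) V) :=
  MultilinearMap.mk' (fun v => tpN k V (2 * p + 1) (blockEv k V s L a (exN v)))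
    (fun v i x y => by
      obtain ⟨f, l, g, h⟩ := block_update p s L a a.2 v i
      rw [h, h, h, map_add, MultilinearMap.map_update_add])
    (fun v i c x => by
      obtain ⟨f, l, g, h⟩ := block_update p s L a a.2 v i
      rw [h, h, map_smul, MultilinearMap.map_update_smul])

/-- one antisymmetrized block -/
noncomputable def RA (a : Fin (p + 1)) :
    AlternatingMap k V (⨂[k]^(2 * p + 1) V) (Fin (2 * p + 1 + s)) :=
  MultilinearMap.alternatization (MB p s L a)

lemma RA_apply (a : Fin (p + 1)) (v : Fin (2 * p + 1 + s) → V) :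
    RA p s L a v = ∑ σ : Equiv.Perm (Fin (2 * p + 1 + s)), (((Equiv.Perm.sign σ : ℤ)) : k) •
      tpN k V (2 * p + 1) (blockEv k V s L a (exN (fun i => v (σ i)))) := by
  unfold RA
  rw [MultilinearMap.alternatization_apply]
  refine Finset.sum_congr rfl fun σ _ => ?_
  rw [Units.smul_def, zs, MultilinearMap.domDomCongr_apply]
  rfl

/-- the right-hand side as an alternating map -/
noncomputable def RLalt : AlternatingMap k V (⨂[k]^(2 * p + 1) V) (Fin (2 * p + 1 + s)) :=
  ∑ a : Fin (p + 1), RA p s L a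

lemma RLalt_apply (v : Fin (2 * p + 1 + s) → V) :
    RLalt p s L v = ∑ a : Fin (p + 1), RA p s L a v := by
  unfold RLalt
  induction (Finset.univ : Finset (Fin (p + 1))) using Finset.induction_on with
  | empty => simp
  | insert a S ha ih => rw [Finset.sum_insert ha, Finset.sum_insert ha, AlternatingMap.add_apply, ih]

lemma RLalt_eq (x : ℕ → V) : RLalt p s L (fun i => x i) = RL k V p s L x := by
  rw [RLalt_apply]
  unfold RL
  rw [Alt_sum, Finset.sum_range]
  refine Finset.sum_congr rfl fun a _ => ?_
  rw [RA_apply]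
  unfold Alt
  refine Finset.sum_congr rfl fun σ _ => ?_
  rw [zs]
  congr 1
  apply tpN_congr
  intro n hn
  apply blockEv_congr p s L a a.2 _ _ _ n hn
  intro i hi
  rw [exN_val _ _ hi]
  unfold permt
  rw [dif_pos hi]

end PBW10

namespace PBW10
set_option linter.unusedSectionVars false
section coefR
variable {k V : Type} [Field k] [CharZero k] [AddCommGroup V] [Module k V]
variable {ι : Type} [Fintype ι] [DecidableEq ι] (b : Module.Basis ι k V)
variable (p s : ℕ) (L : AlternatingMap k V V (Fin (s + 1)))

lemma cf_RA (a : Fin (p + 1)) (w : Fin (2 * p + 1) → ι) (v : Fin (2 * p + 1 + s) → V) :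
    cf b w (RA p s L a v) = ∑ σ : Equiv.Perm (Fin (2 * p + 1 + s)), (((Equiv.Perm.sign σ : ℤ)) : k) *
      ∏ n : Fin (2 * p + 1), b.repr (blockEv k V s L a (exN (fun i => v (σ i))) n) (w n) := by
  rw [RA_apply, map_sum]
  refine Finset.sum_congr rfl fun σ _ => ?_
  rw [map_smul, tpN, cf_tprod, smul_eq_mul]

lemma blk_lt (a : Fin (p + 1)) (v : Fin (2 * p + 1 + s) → V) (n : ℕ) (h : n < 2 * a) :
    blockEv k V s L a (exN v) n = v ⟨n, by omega⟩ := by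
  unfold blockEv; rw [if_pos h, exN_val]

lemma blk_gt (a : Fin (p + 1)) (v : Fin (2 * p + 1 + s) → V) (n : ℕ) (h : 2 * a < n)
    (hn : n < 2 * p + 1) :
    blockEv k V s L a (exN v) n = v ⟨n + s, by omega⟩ := by
  unfold blockEv; rw [if_neg (by omega), if_neg (by omega), exN_val]

lemma blk_eq (a : Fin (p + 1)) (v : Fin (2 * p + 1 + s) → V) :
    blockEv k V s L a (exN v) (2 * a) = L (fun i => v ⟨2 * a + i, by omega⟩) := by
  unfold blockEv; rw [if_neg (by omega), if_pos rfl]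
  congr 1; funext i; rw [exN_val]

lemma RC0 (a : Fin (p + 1)) (w : Fin (2 * p + 1) → ι) (x : Fin (2 * p + 1 + s) → ι)
    (n : Fin (2 * p + 1)) (hn : (n : ℕ) ≠ 2 * a) (h : ∀ i, x i ≠ w n) :
    cf b w (RA p s L a (fun i => b (x i))) = 0 := by
  rw [cf_RA]
  refine Finset.sum_eq_zero fun σ _ => ?_
  rw [Finset.prod_eq_zero (Finset.mem_univ n), mul_zero]
  rcases lt_or_gt_of_ne hn with h1 | h1
  · rw [blk_lt p s L a _ _ h1]; simp [h]
  · rw [blk_gt p s L a _ _ h1 n.2]; simp [h]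

/-- the positions of the block -/
def blkE (a : Fin (p + 1)) :
    Fin (s + 1) ≃ {n : Fin (2 * p + 1 + s) // 2 * (a : ℕ) ≤ n ∧ (n : ℕ) ≤ 2 * a + s} where
  toFun i := ⟨⟨2 * a + i, by omega⟩, by simp, by simp; omega⟩
  invFun n := ⟨n.1.1 - 2 * a, by have := n.2; omega⟩
  left_inv i := by ext; simp
  right_inv n := by
    have := n.2
    apply Subtype.ext; apply Fin.ext; simp only; omega

lemma RC1 (a : Fin (p + 1)) (w : Fin (2 * p + 1) → ι) (x : Fin (2 * p + 1 + s) → ι)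
    (hx : Function.Injective x)
    (h1 : ∀ n : ℕ, ∀ h : n < 2 * a, w ⟨n, by omega⟩ = x ⟨n, by omega⟩)
    (h2 : ∀ n : ℕ, ∀ _ : 2 * a < n, ∀ h : n < 2 * p + 1, w ⟨n, h⟩ = x ⟨n + s, by omega⟩) :
    cf b w (RA p s L a (fun i => b (x i))) =
      ((s + 1).factorial : k) * b.repr (L (fun i => b (x ⟨2 * a + i, by omega⟩)))
        (w ⟨2 * a, by omega⟩) := by
  rw [cf_RA]
  set S := b.repr (L (fun i => b (x ⟨2 * a + i, by omega⟩))) (w ⟨2 * a, by omega⟩) with hS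
  have key : ∑ τ : Equiv.Perm (Fin (s + 1)), S = ((s + 1).factorial : k) * S := by
    rw [Finset.sum_const, Finset.card_univ, Fintype.card_perm, Fintype.card_fin, nsmul_eq_mul]
  rw [← key]
  symm
  refine Finset.sum_of_injOn (fun τ => τ.extendDomain (blkE p s a)) ?_ (by simp) ?_ ?_
  · intro τ _ τ' _ e
    exact Equiv.Perm.extendDomainHom_injective (blkE p s a) e
  · intro σ _ hσ
    by_contra hne
    apply hσ
    have hp := right_ne_zero_of_mul hne
    rw [Finset.prod_ne_zero_iff] at hp
    have hfix : ∀ n : Fin (2 * p + 1 + s), ¬ (2 * (a : ℕ) ≤ n ∧ (n : ℕ) ≤ 2 * a + s) → σ n = n := by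
      intro n hn
      by_cases hlt : (n : ℕ) < 2 * a
      · have := hp ⟨n, by omega⟩ (Finset.mem_univ _)
        simp only at this
        rw [blk_lt p s L a _ _ hlt, h1 _ hlt] at this
        by_contra hc
        apply this
        have : x (σ n) ≠ x n := fun e => hc (hx e)
        simp [this]
      · have := hp ⟨n - s, by omega⟩ (Finset.mem_univ _)
        simp only at this
        rw [blk_gt p s L a _ _ (by omega) (by omega), h2 _ (by omega) (by omega)] at this
        have en : (⟨n - s + s, by omega⟩ : Fin (2 * p + 1 + s)) = n := by ext; simp; omega
        rw [en] at this
        by_contra hc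
        apply this
        have : x (σ n) ≠ x n := fun e => hc (hx e)
        simp [this]
    have hmem : ∀ n : Fin (2 * p + 1 + s), (2 * (a : ℕ) ≤ n ∧ (n : ℕ) ≤ 2 * a + s) ↔
        (2 * (a : ℕ) ≤ σ n ∧ (σ n : ℕ) ≤ 2 * a + s) := by
      intro n
      constructor
      · intro h
        by_contra hc
        have := hfix _ hc
        rw [σ.injective this] at hc
        exact hc h
      · intro h
        by_contra hc
        rw [hfix _ hc] at h
        exact hc h
    refine ⟨(blkE p s a).symm.permCongr (σ.subtypePerm (fun n => (hmem n).symm)), by simp, ?_⟩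
    ext n
    by_cases hn : 2 * (a : ℕ) ≤ n ∧ (n : ℕ) ≤ 2 * a + s
    · simp only
      rw [Equiv.Perm.extendDomain_apply_subtype (p := fun n : Fin (2 * p + 1 + s) => 2 * (a : ℕ) ≤ n ∧ (n : ℕ) ≤ 2 * a + s) _ _ hn]
      simp [Equiv.permCongr_apply]
    · simp only
      rw [Equiv.Perm.extendDomain_apply_not_subtype (p := fun n : Fin (2 * p + 1 + s) => 2 * (a : ℕ) ≤ n ∧ (n : ℕ) ≤ 2 * a + s) _ _ hn, hfix n hn]
  · intro τ _
    rw [Equiv.Perm.sign_extendDomain, Finset.prod_eq_single (⟨2 * a, by omega⟩ : Fin (2 * p + 1))]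
    · simp only
      rw [blk_eq]
      have e : (fun i : Fin (s + 1) => b (x (τ.extendDomain (blkE p s a) ⟨2 * a + i, by omega⟩))) =
          (fun i : Fin (s + 1) => b (x ⟨2 * a + i, by omega⟩)) ∘ τ := by
        funext i
        have : (⟨2 * a + i, by omega⟩ : Fin (2 * p + 1 + s)) = (blkE p s a i : Fin _) := rfl
        rw [this, Equiv.Perm.extendDomain_apply_image]
        rfl
      rw [e, AlternatingMap.map_perm, hS]
      rcases Int.units_eq_one_or (Equiv.Perm.sign τ) with h | h <;> simp [h]
    · intro n _ hn
      have hn' : (n : ℕ) ≠ 2 * a := fun e => hn (Fin.ext e)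
      rcases lt_or_gt_of_ne hn' with h | h
      · rw [blk_lt p s L a _ _ h, Equiv.Perm.extendDomain_apply_not_subtype _ _ (by simp; omega),
          ← h1 _ h]
        simp
      · rw [blk_gt p s L a _ _ h n.2, Equiv.Perm.extendDomain_apply_not_subtype _ _ (by simp; omega),
          ← h2 _ h n.2]
        simp
    · simp

/-- a rotation of the positions after `2 a` -/
def rotF (a j : ℕ) : ℕ := if j ≤ 2 * a then j else
    if j + (p - a) < 2 * p + 1 + s then j + (p - a) else j + (p - a) - (2 * (p - a) + s)

/-- the inverse rotation of the positions after `2 a` -/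
def rotG (a j : ℕ) : ℕ := if j ≤ 2 * a then j else
    if 2 * a + (p - a) < j then j - (p - a) else j + (2 * (p - a) + s) - (p - a)

/-- a rotation of the positions after `2 a` -/
def rotA (a : Fin (p + 1)) : Equiv.Perm (Fin (2 * p + 1 + s)) where
  toFun j := ⟨rotF p s a j, by unfold rotF; split_ifs <;> omega⟩
  invFun j := ⟨rotG p s a j, by unfold rotG; split_ifs <;> omega⟩
  left_inv j := by
    have := a.2; have := j.2
    ext
    simp only
    unfold rotF rotG
    split_ifs <;> omega
  right_inv j := by
    have := a.2; have := j.2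
    ext
    simp only
    unfold rotF rotG
    split_ifs <;> omega

lemma rotA_val (a : Fin (p + 1)) (j : Fin (2 * p + 1 + s)) :
    (rotA p s a j : ℕ) = if (j : ℕ) ≤ 2 * a then (j : ℕ) else
    if (j : ℕ) + (p - a) < 2 * p + 1 + s then j + (p - a) else
      j + (p - a) - (2 * (p - a) + s) := rfl

lemma rotA2_val (a : Fin (p + 1)) (j : Fin (2 * p + 1 + s)) :
    ((rotA p s a * rotA p s a) j : ℕ) = if (j : ℕ) ≤ 2 * a then (j : ℕ) else
    if (j : ℕ) ≤ 2 * a + s then j + 2 * (p - a) else j - s := by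
  have := a.2; have := j.2
  rw [Equiv.Perm.mul_apply, rotA_val, rotA_val]
  split_ifs <;> omega

lemma RC2 (a : Fin (p + 1)) (w : Fin (2 * p + 1) → ι) (x : Fin (2 * p + 1 + s) → ι)
    (hx : Function.Injective x)
    (h1 : ∀ n : ℕ, n ≠ 2 * a → ∀ h : n < 2 * p + 1, w ⟨n, h⟩ = x ⟨n, by omega⟩) :
    cf b w (RA p s L a (fun i => b (x i))) =
      ((s + 1).factorial : k) * b.repr (L (fun i => b ((Fin.cons (x ⟨2 * a, by omega⟩)
        (fun i : Fin s => x ⟨2 * p + 1 + i, by omega⟩) : Fin (s + 1) → ι) i)))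
        (w ⟨2 * a, by omega⟩) := by
  have ha := a.2
  have hm := (RA p s L a).map_perm (fun i => b (x i)) (rotA p s a * rotA p s a)
  have hsg : Equiv.Perm.sign (rotA p s a * rotA p s a) = 1 := by
    rw [map_mul, Int.units_mul_self]
  rw [hsg, one_smul] at hm
  rw [← hm]
  have := RC1 b p s L a w (x ∘ ⇑(rotA p s a * rotA p s a : Equiv.Perm (Fin (2 * p + 1 + s))))
    (hx.comp (Equiv.injective _)) ?_ ?_
  · refine this.trans ?_
    congr 4
    funext i
    congr 1
    refine Fin.cases ?_ (fun i => ?_) i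
    · rw [Fin.cons_zero, Function.comp_apply]
      congr 1
      ext
      rw [rotA2_val]; simp
    · rw [Fin.cons_succ, Function.comp_apply]
      congr 1
      ext
      rw [rotA2_val]; simp only [Fin.val_succ]
      split_ifs <;> omega
  · intro n h
    rw [h1 _ (by omega), Function.comp_apply]
    congr 1
    ext
    rw [rotA2_val]; simp only
    split_ifs <;> omega
  · intro n h h'
    rw [h1 _ (by omega), Function.comp_apply]
    congr 1
    ext
    rw [rotA2_val]; simp only
    split_ifs <;> omega

end coefR
end PBW10

namespace PBW10
set_option linter.unusedSectionVars false
section defL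
variable {k V : Type} [Field k] [CharZero k] [AddCommGroup V] [Module k V]
variable {ι : Type} [Fintype ι] [LinearOrder ι] (b : Module.Basis ι k V)

lemma exists_alt (n : ℕ) (l : (Fin n → ι) → V) : ∃ L : AlternatingMap k V V (Fin n),
    ∀ y : Fin n → ι, StrictMono y → L (fun i => b (y i)) = l y := by
  classical
  let M : MultilinearMap k (fun _ : Fin n => V) V :=
    ∑ y : {y : Fin n → ι // StrictMono y},
      ((MultilinearMap.mkPiAlgebra k (Fin n) k).compLinearMap
        (fun i => b.coord (y.1 i))).smulRight (l y.1)
  have hM : ∀ z : Fin n → ι, M (fun i => b (z i)) =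
      ∑ y : {y : Fin n → ι // StrictMono y}, (∏ i, b.repr (b (z i)) (y.1 i)) • l y.1 := by
    intro z
    simp only [M, sum_apply]
    refine Finset.sum_congr rfl fun y _ => ?_
    simp
  have hM1 : ∀ z : Fin n → ι, ¬ StrictMono z → M (fun i => b (z i)) = 0 := by
    intro z hz
    rw [hM]
    refine Finset.sum_eq_zero fun y _ => ?_
    have : z ≠ y.1 := fun e => hz (e ▸ y.2)
    obtain ⟨i, hi⟩ := Function.ne_iff.mp this
    rw [Finset.prod_eq_zero (Finset.mem_univ i), zero_smul]
    simp [hi]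
  have hM2 : ∀ z : Fin n → ι, StrictMono z → M (fun i => b (z i)) = l z := by
    intro z hz
    rw [hM, Finset.sum_eq_single ⟨z, hz⟩]
    · simp
    · intro y _ hy
      have : z ≠ y.1 := fun e => hy (Subtype.ext e.symm)
      obtain ⟨i, hi⟩ := Function.ne_iff.mp this
      rw [Finset.prod_eq_zero (Finset.mem_univ i), zero_smul]
      simp [hi]
    · simp
  refine ⟨MultilinearMap.alternatization M, fun y hy => ?_⟩
  rw [MultilinearMap.alternatization_apply, Finset.sum_eq_single 1]
  · simp only [Equiv.Perm.sign_one, one_smul]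
    exact hM2 y hy
  · intro σ _ hσ
    rw [MultilinearMap.domDomCongr_apply]
    rw [hM1 (fun i => y (σ i)), smul_zero]
    intro hs
    apply hσ
    have h : StrictMono σ := fun i j hij => hy.lt_iff_lt.mp (hs hij)
    ext i
    have := (StrictMono.range_inj h strictMono_id).mp (by simp)
    rw [this]; rfl
  · simp

lemma exists_ins {s : ℕ} (j : ι) (q : Fin s → ι) (hq : StrictMono q) (hj : ∀ i, q i ≠ j) :
    ∃ i : Fin (s + 1), StrictMono (i.insertNth j q : Fin (s + 1) → ι) := by
  classical
  have hx : Function.Injective (Fin.cons j q : Fin (s + 1) → ι) := by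
    rw [Fin.cons_injective_iff]
    exact ⟨by rintro ⟨i, e⟩; exact hj i e, hq.injective⟩
  obtain ⟨y, hy, -, hyx⟩ := PBWCore.IsCore.exists_sorted (n := s + 1) (m := 0)
    (Fin.cons j q : Fin (s + 1) → ι) hx ∅ (by simp) (by simp) (by simp)
  have him : Finset.univ.image y = Finset.univ.image (Fin.cons j q : Fin (s + 1) → ι) := by
    apply Finset.eq_of_subset_of_card_le
    · intro c hc
      simp only [Finset.mem_image, Finset.mem_univ, true_and] at hc ⊢
      obtain ⟨a, rfl⟩ := hc
      exact hyx a
    · rw [Finset.card_image_of_injective _ hx, Finset.card_image_of_injective _ hy.injective]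
  have hjm : j ∈ Finset.univ.image y := by
    rw [him, Finset.mem_image]; exact ⟨0, by simp, by simp⟩
  obtain ⟨i, -, hi⟩ := Finset.mem_image.mp hjm
  have hr : StrictMono (i.removeNth y) := fun a c hac =>
    hy ((Fin.strictMono_succAbove i) hac)
  have hrq : i.removeNth y = q := by
    apply (StrictMono.range_inj hr hq).mp
    have : Finset.univ.image (i.removeNth y) = Finset.univ.image q := by
      apply Finset.eq_of_subset_of_card_le
      · intro c hc
        simp only [Finset.mem_image, Finset.mem_univ, true_and] at hc ⊢
        obtain ⟨a, rfl⟩ := hc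
        obtain ⟨t, ht⟩ := hyx (i.succAbove a)
        revert ht
        refine Fin.cases (fun ht => ?_) (fun t ht => ⟨t, by rw [Fin.cons_succ] at ht; exact ht⟩) t
        rw [Fin.cons_zero, ← hi] at ht
        exact absurd (hy.injective ht).symm (Fin.succAbove_ne _ _)
      · rw [Finset.card_image_of_injective _ hr.injective,
          Finset.card_image_of_injective _ hq.injective]
    have h2 := congrArg (fun S : Finset ι => (S : Set ι)) this
    simpa using h2
  refine ⟨i, ?_⟩
  rw [← hrq, ← hi, Fin.insertNth_self_removeNth]
  exact hy

lemma exists_L (s : ℕ) (g : (Fin s → ι) → ι → k) (l : (Fin (s + 1) → ι) → ι → k) :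
    ∃ L : AlternatingMap k V V (Fin (s + 1)),
      (∀ q, StrictMono q → ∀ j, (∀ i, q i ≠ j) →
        b.repr (L (fun i => b ((Fin.cons j q : Fin (s + 1) → ι) i))) j = g q j) ∧
      (∀ y, StrictMono y → ∀ j, (∀ a, y a ≠ j) → b.repr (L (fun i => b (y i))) j = l y j) := by
  classical
  obtain ⟨L, hL⟩ := exists_alt b (s + 1) (fun y =>
    (∑ j, (if ∃ a, y a = j then 0 else l y j) • b j) +
      ∑ i : Fin (s + 1), ((-1 : k) ^ (i : ℕ) * g (i.removeNth y) (y i)) • b (y i))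
  have hrep : ∀ y, StrictMono y → ∀ j, b.repr (L (fun i => b (y i))) j =
      (if ∃ a, y a = j then 0 else l y j) +
        ∑ i : Fin (s + 1), if y i = j then ((-1 : k) ^ (i : ℕ) * g (i.removeNth y) (y i)) else 0 := by
    intro y hy j
    rw [hL y hy]
    simp only [map_add, map_sum, map_smul, Finsupp.add_apply, Finsupp.finsetSum_apply,
      Finsupp.smul_apply, Module.Basis.repr_self, Finsupp.single_apply, smul_eq_mul, mul_ite,
      mul_one, mul_zero]
    simp
  refine ⟨L, fun q hq j hj => ?_, fun y hy j hj => ?_⟩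
  · obtain ⟨i, hi⟩ := exists_ins j q hq hj
    have h1 := hrep _ hi j
    rw [if_pos ⟨i, by simp⟩, zero_add, Finset.sum_eq_single i] at h1
    · have h2 : (fun t => b ((i.insertNth j q : Fin (s + 1) → ι) t)) =
          (i.insertNth (b j) (fun t => b (q t)) : Fin (s + 1) → V) := by
        funext t
        refine Fin.succAboveCases i ?_ (fun t => ?_) t <;> simp
      have h3 : (fun t => b ((Fin.cons j q : Fin (s + 1) → ι) t)) =
          Matrix.vecCons (b j) (fun t => b (q t)) := by
        funext t
        refine Fin.cases ?_ (fun t => ?_) t <;> simp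
      rw [h3, ← AlternatingMap.neg_one_pow_smul_map_insertNth L i, ← h2]
      have hz : ((-1 : ℤ) ^ (i : ℕ)) • L (fun t => b ((i.insertNth j q : Fin (s + 1) → ι) t)) =
          ((-1 : k) ^ (i : ℕ)) • L (fun t => b ((i.insertNth j q : Fin (s + 1) → ι) t)) := by
        rcases neg_one_pow_eq_or ℤ (i : ℕ) with h | h <;>
        rcases Nat.even_or_odd (i : ℕ) with h' | h' <;> simp [h'.neg_one_pow]
      rw [hz, map_smul, Finsupp.smul_apply, h1, smul_eq_mul]
      simp only [Fin.insertNth_apply_same, if_true, Fin.removeNth_insertNth]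
      rw [← mul_assoc, ← mul_pow]; simp
    · intro t _ ht
      rw [if_neg]
      intro e
      apply ht
      apply hi.injective
      rw [e]; simp
    · simp
  · rw [hrep y hy j, if_neg (by rintro ⟨a, e⟩; exact hj a e), Finset.sum_eq_zero, add_zero]
    intro i _
    rw [if_neg (hj i)]

end defL
end PBW10

namespace PBW10
set_option linter.unusedSectionVars false
section fin
variable {k V : Type} [Field k] [CharZero k] [AddCommGroup V] [Module k V]
variable {ι : Type} [Fintype ι] [LinearOrder ι] (b : Module.Basis ι k V)
variable {p s : ℕ}

lemma Hyp_sub (A B : AlternatingMap k V (⨂[k]^(2 * p + 1) V) (Fin (2 * p + 1 + s)))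
    (hA : Hyp A) (hB : Hyp B) : Hyp (A - B) := by
  intro x
  have := Submodule.sub_mem _ (hA x) (hB x)
  convert this using 1
  unfold Om
  simp only [AlternatingMap.sub_apply, map_sub, smul_sub, Finset.sum_sub_distrib]
  abel

lemma Hyp_RLalt (L : AlternatingMap k V V (Fin (s + 1))) : Hyp (RLalt p s L) := by
  intro x
  have := Om_RL_mem k V p s L x
  simp only [RLalt_eq]
  exact this

lemma Tc_sub (A B : AlternatingMap k V (⨂[k]^(2 * p + 1) V) (Fin (2 * p + 1 + s)))
    (x : Fin (2 * p + 2) ⊕ Fin s → ι) (w : Fin (2 * p + 2) → ι) :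
    Tc b (A - B) x w = Tc b A x w - Tc b B x w := by
  unfold Tc
  rw [TT_apply, TT_apply, TT_apply, ← Finset.sum_sub_distrib]
  refine Finset.sum_congr rfl fun j _ => ?_
  rw [AlternatingMap.sub_apply, map_sub]; ring

/-- the sequence read off after dropping the first letter -/
def xs (x : Fin (2 * p + 2) ⊕ Fin s → ι) : Fin (2 * p + 1 + s) → ι :=
  fun i => x (ee p s i.succ)

lemma xs_lt (x : Fin (2 * p + 2) ⊕ Fin s → ι) (n : ℕ) (h : n < 2 * p + 1) :
    xs x ⟨n, by omega⟩ = x (Sum.inl ⟨n + 1, by omega⟩) := by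
  unfold xs
  congr 1
  rw [← Equiv.eq_symm_apply]
  ext
  simp [ee]

lemma xs_ge (x : Fin (2 * p + 2) ⊕ Fin s → ι) (i : Fin s) :
    xs x ⟨2 * p + 1 + i, by omega⟩ = x (Sum.inr i) := by
  unfold xs
  congr 1
  rw [← Equiv.eq_symm_apply]
  ext
  simp [ee]
  omega

lemma xs_inj (x : Fin (2 * p + 2) ⊕ Fin s → ι) (hx : Function.Injective x) :
    Function.Injective (xs x) :=
  hx.comp ((ee p s).injective.comp (Fin.succ_injective _))

lemma ee_zero : ee p s 0 = Sum.inl 0 := by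
  rw [← Equiv.eq_symm_apply]
  ext
  simp [ee]

lemma Tc_first (A : AlternatingMap k V (⨂[k]^(2 * p + 1) V) (Fin (2 * p + 1 + s)))
    (x : Fin (2 * p + 2) ⊕ Fin s → ι) (hx : Function.Injective x) (w : Fin (2 * p + 2) → ι)
    (h : x (Sum.inl 0) = w 0) :
    Tc b A x w = cf b (fun i => w i.succ) (A (fun i => b (xs x i))) := by
  unfold Tc
  have := TT_single b A w (fun i => x (ee p s i)) (hx.comp (ee p s).injective) 0
    (by rw [ee_zero, h])
  simpa [xs] using this

lemma N1aux (L : AlternatingMap k V V (Fin (s + 1))) (w : Fin (2 * p + 2) → ι) (q : Fin s → ι)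
    (h : Function.Injective (Sum.elim w q)) :
    Tc b (RLalt p s L) (Sum.elim w q) w = ∑ a : Fin (p + 1), ((s + 1).factorial : k) *
      b.repr (L (fun i => b ((Fin.cons (w ⟨2 * a + 1, by omega⟩) q : Fin (s + 1) → ι) i)))
        (w ⟨2 * a + 1, by omega⟩) := by
  rw [Tc_first b _ _ h _ rfl, RLalt_apply, map_sum]
  refine Finset.sum_congr rfl fun a _ => ?_
  rw [RC2 b p s L a _ _ (xs_inj _ h)]
  · rw [xs_lt _ _ (by omega)]
    simp only [xs_ge, Sum.elim_inl, Sum.elim_inr]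
    rfl
  · intro n _ hn
    rw [xs_lt _ _ hn]
    rfl

lemma N2aux (L : AlternatingMap k V V (Fin (s + 1))) (y : Fin (s + 1) → ι) (j z : ι)
    (r : Fin (2 * p) → ι) (hj : ∀ a, y a ≠ j) (hr : ∀ l, r l ≠ j)
    (h : Function.Injective (Sum.elim (PBWCore.IsCore.wd z (y 0) r) (Fin.tail y))) :
    Tc b (RLalt p s L) (Sum.elim (PBWCore.IsCore.wd z (y 0) r) (Fin.tail y))
      (PBWCore.IsCore.wd z j r) = ((s + 1).factorial : k) * b.repr (L (fun i => b (y i))) j := by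
  rw [Tc_first b _ _ h _ rfl, RLalt_apply, map_sum, Finset.sum_eq_single 0]
  · rw [RC2 b p s L 0 _ _ (xs_inj _ h)]
    · rw [xs_lt _ _ (by simp)]
      simp only [xs_ge, Sum.elim_inl, Sum.elim_inr]
      congr 3
      congr 1
      funext i
      congr 1
      refine Fin.cases ?_ (fun i => ?_) i
      · rfl
      · rfl
    · intro n hn0 hn
      rw [xs_lt _ _ hn, Sum.elim_inl]
      obtain ⟨m, rfl⟩ : ∃ m, n = m + 1 := ⟨n - 1, by simp at hn0; omega⟩
      rfl
  · intro a _ ha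
    have ha' : (a : ℕ) ≠ 0 := fun e => ha (Fin.ext e)
    refine RC0 b p s L a _ _ 0 (by simp; omega) ?_
    intro i
    change _ ≠ j
    unfold xs
    rcases hh : ee p s i.succ with t | t
    · rw [Sum.elim_inl]
      revert hh
      refine Fin.cases (fun hh => ?_) (fun t => ?_) t
      · rw [← ee_zero, (ee p s).injective.eq_iff] at hh
        exact absurd hh (Fin.succ_ne_zero _)
      · refine Fin.cases (fun hh => ?_) (fun t hh => ?_) t
        · exact hj 0
        · exact hr t
    · exact hj _
  · simp

lemma exists_zr (hd : 2 * p + s + 3 ≤ Fintype.card ι) (y : Fin (s + 1) → ι)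
    (hy : Function.Injective y) (j : ι) : ∃ (z : ι) (r : Fin (2 * p) → ι),
      Function.Injective (Sum.elim (PBWCore.IsCore.wd z (y 0) r) (Fin.tail y)) ∧
        z ≠ j ∧ (∀ l, r l ≠ j) := by
  classical
  let S : Finset ι := insert j (Finset.univ.image y)
  have hS : S.card ≤ s + 2 := by
    refine (Finset.card_insert_le _ _).trans ?_
    have : (Finset.univ.image y).card ≤ _ := Finset.card_image_le
    simp at this
    omega
  have : Nonempty (Fin (2 * p + 1) ↪ {x // x ∉ S}) := by
    apply Function.Embedding.nonempty_of_card_le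
    rw [Fintype.card_fin, Fintype.card_subtype_compl, Fintype.card_coe]
    omega
  obtain ⟨f⟩ := this
  have hfj : ∀ i, (f i : ι) ≠ j := fun i e => (f i).2 (by simp [S, e])
  have hfy : ∀ i a, (f i : ι) ≠ y a := fun i a e => (f i).2 (by simp [S, e])
  have hfi : Function.Injective (fun i => (f i : ι)) := Subtype.val_injective.comp f.injective
  refine ⟨f 0, fun l => f l.succ, ?_, hfj _, fun l => hfj _⟩
  refine Function.Injective.sumElim ?_ (hy.comp (Fin.succ_injective _)) ?_
  · unfold PBWCore.IsCore.wd
    rw [Fin.cons_injective_iff, Fin.cons_injective_iff]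
    refine ⟨?_, ?_, hfi.comp (Fin.succ_injective _)⟩
    · rintro ⟨i, e⟩
      revert e
      refine Fin.cases (fun e => ?_) (fun i e => ?_) i
      · exact hfy 0 0 e.symm
      · exact Fin.succ_ne_zero _ (hfi e)
    · rintro ⟨i, e⟩
      exact hfy _ _ e
  · intro a c
    unfold PBWCore.IsCore.wd
    refine Fin.cases ?_ (fun a => ?_) a
    · exact hfy _ _
    · refine Fin.cases ?_ (fun a => ?_) a
      · intro e
        exact Fin.succ_ne_zero c (hy e).symm
      · exact hfy _ _

theorem main_fwd (b : Module.Basis ι k V) (hd : 2 * p + s + 3 ≤ Fintype.card ι)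
    (A : AlternatingMap k V (⨂[k]^(2 * p + 1) V) (Fin (2 * p + 1 + s))) (hA : Hyp A) :
    ∃ L : AlternatingMap k V V (Fin (s + 1)), A = RLalt p s L := by
  classical
  have hT := isCore b A hA
  choose g hg using fun q => hT.diag hd q
  choose! z r hinj hz hr using fun (y : Fin (s + 1) → ι) (hy : Function.Injective y) (j : ι) =>
    exists_zr (p := p) hd y hy j
  obtain ⟨L0, h1, h2⟩ := exists_L b s g (fun y j =>
    Tc b A (Sum.elim (PBWCore.IsCore.wd (z y j) (y 0) (r y j)) (Fin.tail y))
      (PBWCore.IsCore.wd (z y j) j (r y j)))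
  have hf : ((s + 1).factorial : k) ≠ 0 := Nat.cast_ne_zero.mpr (Nat.factorial_ne_zero _)
  let L := ((s + 1).factorial : k)⁻¹ • L0
  have hL : ∀ v j, ((s + 1).factorial : k) * b.repr (L v) j = b.repr (L0 v) j := by
    intro v j
    simp only [L, AlternatingMap.smul_apply, map_smul, Finsupp.smul_apply, smul_eq_mul]
    rw [mul_inv_cancel_left₀ hf]
  refine ⟨L, ?_⟩
  rw [← sub_eq_zero]
  apply eq_zero_of_T b _ hd
  refine (isCore b _ (Hyp_sub _ _ hA (Hyp_RLalt L))).vanish hd ?_ ?_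
  · intro w q hi hq
    rw [Tc_sub, hg q w hi, N1aux b L w q hi, sub_eq_zero]
    refine Finset.sum_congr rfl fun a _ => ?_
    rw [hL, h1 q hq]
    intro i e
    have : Sum.elim w q (Sum.inr i) = Sum.elim w q (Sum.inl ⟨2 * a + 1, by omega⟩) := e
    have := hi this
    simp at this
  · intro y hy j hj
    have hyi := hy.injective
    refine ⟨z y j, r y j, hinj y hyi j, hz y hyi j, hr y hyi j, ?_⟩
    rw [Tc_sub, N2aux b L y j _ _ hj (hr y hyi j) (hinj y hyi j), hL, h2 y hy j hj, sub_self]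

lemma Om_alpha (α : wedgeIm k V (2 * p + 1 + s) →ₗ[k] ⨂[k]^(2 * p + 1) V) (x : ℕ → V) :
    oneTA k V (2 * p + 1) s α x + ((-1 : ℤ) ^ s) • taOne k V (2 * p + 1) s α x =
      Om k V (2 * p + 1) s (fun x => α (wdgN k V (2 * p + 1 + s) x)) x := by
  unfold oneTA taOne Om
  simp only [zs]
  push_cast
  rfl

end fin
end PBW10

namespace PBW10

variable (k V : Type) [Field k] [CharZero k] [AddCommGroup V] [Module k V]

/-- Let `V` be a vector space over a field of characteristic zero with
`dim V ≥ N + 2`, where `N - s` is odd, say `N = 2p + s + 1` (below we write `N = 2p + 1 + s`).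
Embed exterior powers in tensor powers by antisymmetrization.  For a linear map
`α : ∧^N V → V^{⊗(N-s)}`, set `{𝟙, α} = 𝟙 ⊗ α + (-1)^s • α ⊗ 𝟙 : ∧^{N+1} V → V^{⊗(N+1-s)}`.
Then the image of `{𝟙, α}` is contained in `∧^{N+1-s} V` if and only if
`α = ∑_{a+b=p} 𝟙^{⊗2a} ⊗ L ⊗ 𝟙^{⊗2b}` for some linear map `L : ∧^{s+1} V → V`. -/
theorem stmt10 [FiniteDimensional k V] (p s : ℕ)
    (hdim : 2 * p + s + 3 ≤ Module.finrank k V)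
    (α : wedgeIm k V (2 * p + 1 + s) →ₗ[k] ⨂[k]^(2 * p + 1) V) :
    (∀ x : ℕ → V,
        oneTA k V (2 * p + 1) s α x + ((-1 : ℤ) ^ s) • taOne k V (2 * p + 1) s α x ∈
          wedgeIm k V (2 * p + 1 + 1)) ↔
      ∃ L : AlternatingMap k V V (Fin (s + 1)), ∀ x : ℕ → V,
        α (wdgN k V (2 * p + 1 + s) x) =
          ∑ σ : Equiv.Perm (Fin (2 * p + 1 + s)), (Equiv.Perm.sign σ : ℤ) •
            ∑ a ∈ Finset.range (p + 1),
              tpN k V (2 * p + 1) (blockEv k V s L a (permt V σ x)) := by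
  constructor
  · intro h
    obtain ⟨L, hL⟩ := main_fwd (p := p) (s := s) (Module.finBasis k V) (by simpa using hdim)
      (alphaAlt (2 * p + 1 + s) (2 * p + 1) α) (by
        intro x
        have h1 := h x
        rw [Om_alpha] at h1
        simp only [alphaAlt_apply]
        exact h1)
    refine ⟨L, fun x => ?_⟩
    rw [← alphaAlt_apply, hL, RLalt_eq]
    rfl
  · rintro ⟨L, hL⟩ x
    rw [Om_alpha]
    have e : (fun x => α (wdgN k V (2 * p + 1 + s) x)) = RL k V p s L := by
      funext x
      rw [hL x]
      rfl
    rw [e]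
    exact Om_RL_mem k V p s L x

end PBW10
end

section
/- Let $V$ be a vector space over a field of characteristic zero, $L : \wedge^2 V \to V$ a Lie bracket, and $\Phi_{2r} : \wedge^{2r} V \to k$ a linear form, all regarded as maps on tensor powers. Then the map $L \otimes \Phi_{2r} \circ (\underline{\pm \mathbf{1}^{2r-1} L}) : \wedge^{2r+3} V \to V$ and the composition $L \circ T_2(\Phi_{2r}) \circ T_{2r+1}(L) : \wedge^{2r+3} V \to \wedge^{2r+2} V \to \wedge^2 V \to V$ are equal up to multiplication by a nonzero scalar. -/
namespace PBW13

variable (k V : Type) [Field k] [CharZero k] [AddCommGroup V] [Module k V]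

/-- Permute the first `n` entries of the sequence `x` by `σ`. -/
def permt {n : ℕ} (σ : Equiv.Perm (Fin n)) (x : ℕ → V) : ℕ → V :=
  fun m => if h : m < n then x (σ ⟨m, h⟩) else x m

/-- The map `𝟙^{⊗p} ⊗ L ⊗ 𝟙^{⊗·}` applied to a sequence: `L` is applied to the entries in
positions `p, p+1` and the remaining entries are kept. -/
def insL (L : V →ₗ[k] V →ₗ[k] V) (p : ℕ) (x : ℕ → V) : ℕ → V :=
  fun n => if n < p then x n else if n = p then L (x p) (x (p + 1)) else x (n + 1)

/-- The length-`(2r+2)` sequence obtained from the first `2r+1` entries of `permt σ x`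
followed by `L` of the last two, i.e. the entries of the wedge
`x_{σ0} ∧ ⋯ ∧ x_{σ(2r)} ∧ L(x_{σ(2r+1)}, x_{σ(2r+2)})` produced by `T_{2r+1}(L)`. -/
def zT (r : ℕ) (L : V →ₗ[k] V →ₗ[k] V) (σ : Equiv.Perm (Fin (2 * r + 3))) (x : ℕ → V) :
    ℕ → V :=
  fun n =>
    if n < 2 * r + 1 then permt V σ x n
    else L (permt V σ x (2 * r + 1)) (permt V σ x (2 * r + 2))

section helpers
set_option linter.unusedSectionVars false
set_option linter.unusedSimpArgs false
variable {k V}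

lemma permt_mul {n : ℕ} (σ ρ : Equiv.Perm (Fin n)) (x : ℕ → V) :
    permt V (σ * ρ) x = permt V ρ (permt V σ x) := by
  funext m
  unfold permt
  by_cases h : m < n <;> simp [h]

lemma permt_swap {n : ℕ} (i j : Fin n) (x : ℕ → V) :
    permt V (Equiv.swap i j) x = fun m => x (Equiv.swap (i : ℕ) (j : ℕ) m) := by
  funext m
  unfold permt
  by_cases h : m < n
  · simp only [h, dite_true, Equiv.swap_apply_def, Fin.ext_iff]
    split_ifs <;> rfl
  · have h1 : m ≠ i := by have := i.2; omega
    have h2 : m ≠ j := by have := j.2; omega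
    simp [h, Equiv.swap_apply_of_ne_of_ne h1 h2]

/-- Antisymmetrization over permutations of the first `n` entries. -/
def Alt (n : ℕ) (f : (ℕ → V) → V) (x : ℕ → V) : V :=
  ∑ σ : Equiv.Perm (Fin n), (Equiv.Perm.sign σ : ℤ) • f (permt V σ x)

lemma Alt_perm {n : ℕ} (f : (ℕ → V) → V) (x : ℕ → V) (ρ : Equiv.Perm (Fin n)) :
    Alt n (fun y => f (permt V ρ y)) x = (Equiv.Perm.sign ρ : ℤ) • Alt n f x := by
  unfold Alt
  rw [Finset.smul_sum, ← Equiv.sum_comp (Equiv.mulRight ρ)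
    (fun σ => (Equiv.Perm.sign ρ : ℤ) • (Equiv.Perm.sign σ : ℤ) • f (permt V σ x))]
  refine Finset.sum_congr rfl fun σ _ => ?_
  simp only [Equiv.coe_mulRight, permt_mul, smul_smul]
  congr 1
  rcases Int.units_eq_one_or (Equiv.Perm.sign ρ) with h | h <;> simp [h]

lemma Alt_swap {n : ℕ} (f : (ℕ → V) → V) (x : ℕ → V) (a b : ℕ) (ha : a < n) (hb : b < n)
    (hab : a ≠ b) :
    Alt n (fun y => f (fun m => y (Equiv.swap a b m))) x = - Alt n f x := by
  have h := Alt_perm f x (Equiv.swap (⟨a, ha⟩ : Fin n) ⟨b, hb⟩)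
  simp only [permt_swap] at h
  rw [h, Equiv.Perm.sign_swap (by simpa [Fin.ext_iff] using hab)]
  simp

lemma Alt_add {n : ℕ} (f g : (ℕ → V) → V) (x : ℕ → V) :
    Alt n (fun y => f y + g y) x = Alt n f x + Alt n g x := by
  simp [Alt, smul_add, Finset.sum_add_distrib]

lemma Alt_neg {n : ℕ} (f : (ℕ → V) → V) (x : ℕ → V) :
    Alt n (fun y => - f y) x = - Alt n f x := by
  simp [Alt]

/-- The sequence with `L` of two entries at the end. -/
def zz (r : ℕ) (L : V →ₗ[k] V →ₗ[k] V) (y : ℕ → V) : ℕ → V :=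
  fun n => if n < 2 * r + 1 then y n else L (y (2 * r + 1)) (y (2 * r + 2))

/-- The map `L ⊗ Φ`. -/
def FF (r : ℕ) (L : V →ₗ[k] V →ₗ[k] V) (Φ : AlternatingMap k V k (Fin (2 * r))) (z : ℕ → V) : V :=
  Φ (fun i : Fin (2 * r) => z ((i : ℕ) + 2)) • L (z 0) (z 1)

variable (r : ℕ) (L : V →ₗ[k] V →ₗ[k] V) (Φ : AlternatingMap k V k (Fin (2 * r)))

lemma L_skew (hL : ∀ v : V, L v v = 0) (a b : V) : L a b = - L b a := by
  have h := hL (a + b)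
  simp only [map_add, LinearMap.add_apply, hL, zero_add, add_zero] at h
  exact eq_neg_of_add_eq_zero_right h

lemma jac (hL : ∀ v : V, L v v = 0)
    (hJac : ∀ x : Fin 3 → V,
      (∑ σ : Equiv.Perm (Fin 3), (Equiv.Perm.sign σ : ℤ) •
          (L (x (σ 0)) (L (x (σ 1)) (x (σ 2))) - L (L (x (σ 0)) (x (σ 1))) (x (σ 2)))) = 0)
    (a b c : V) : L a (L b c) + L b (L c a) + L c (L a b) = 0 := by
  have h := hJac ![a, b, c]
  have s01 : Equiv.Perm.sign (Equiv.swap (0 : Fin 3) 1) = -1 := by decide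
  rw [Finset.sum_equiv (t := Finset.univ) (Equiv.refl _) (g := fun σ : Equiv.Perm (Fin 3) =>
    (Equiv.Perm.sign σ : ℤ) • ((2 : ℤ) • L (![a,b,c] (σ 0)) (L (![a,b,c] (σ 1)) (![a,b,c] (σ 2)))
    - (L (![a,b,c] (σ 0)) (L (![a,b,c] (σ 1)) (![a,b,c] (σ 2))) +
       L (L (![a,b,c] (σ 0)) (![a,b,c] (σ 1))) (![a,b,c] (σ 2)))))
    (by simp) (by intro i _; simp only [Equiv.refl_apply]; congr 1; rw [two_smul]; abel)] at h
  have e : (Finset.univ : Finset (Equiv.Perm (Fin 3))) =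
    {1, Equiv.swap 0 1, Equiv.swap 0 2, Equiv.swap 1 2, Equiv.swap 0 1 * Equiv.swap 1 2,
      Equiv.swap 1 2 * Equiv.swap 0 1} := by decide
  rw [e] at h
  repeat rw [Finset.sum_insert (by decide)] at h
  rw [Finset.sum_singleton] at h
  have q1 : (Equiv.swap (0 : Fin 3) 1) 2 = 2 := by decide
  have q2 : (Equiv.swap (0 : Fin 3) 2) 1 = 1 := by decide
  have q3 : (Equiv.swap (1 : Fin 3) 2) 0 = 0 := by decide
  simp [Equiv.Perm.sign_swap, Equiv.Perm.sign_mul, q1, q2, q3] at h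
  rw [L_skew L hL (L a b) c, L_skew L hL (L b a) c, L_skew L hL (L c b) a, L_skew L hL (L a c) b,
    L_skew L hL (L b c) a, L_skew L hL (L c a) b, L_skew L hL b a, L_skew L hL c b,
    L_skew L hL a c] at h
  simp only [map_neg] at h
  have h4 : (4 : k) • (L a (L b c) + L b (L c a) + L c (L a b)) = 0 := by
    rw [← h]; module
  exact (smul_eq_zero.mp h4).resolve_left (by norm_num)

lemma FF_swap_high (z : ℕ → V) (a b : ℕ) (ha : a < 2 * r + 2) (hb : b < 2 * r + 2)
    (ha2 : 2 ≤ a) (hb2 : 2 ≤ b) (hab : a ≠ b) :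
    FF r L Φ (fun m => z (Equiv.swap a b m)) = - FF r L Φ z := by
  unfold FF
  have h := Φ.map_swap (fun i : Fin (2 * r) => z ((i : ℕ) + 2))
    (i := ⟨a - 2, by omega⟩) (j := ⟨b - 2, by omega⟩) (by simp [Fin.ext_iff]; omega)
  have e : (fun i : Fin (2 * r) => z (Equiv.swap a b ((i : ℕ) + 2))) =
    (fun i : Fin (2 * r) => z ((i : ℕ) + 2)) ∘
      (Equiv.swap (⟨a - 2, by omega⟩ : Fin (2 * r)) ⟨b - 2, by omega⟩) := by
    funext i
    simp only [Function.comp, Equiv.swap_apply_def, Fin.ext_iff]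
    congr 1
    split_ifs <;> (try simp only) <;> omega
  beta_reduce
  rw [e, h, Equiv.swap_apply_of_ne_of_ne (by omega) (by omega),
    Equiv.swap_apply_of_ne_of_ne (by omega) (by omega), neg_smul]

lemma FF_swap_low (hL : ∀ v : V, L v v = 0) (z : ℕ → V) :
    FF r L Φ (fun m => z (Equiv.swap 0 1 m)) = - FF r L Φ z := by
  unfold FF
  have e : (fun i : Fin (2 * r) => z (Equiv.swap 0 1 ((i : ℕ) + 2))) =
    (fun i : Fin (2 * r) => z ((i : ℕ) + 2)) := by
    funext i
    rw [Equiv.swap_apply_of_ne_of_ne (by omega) (by omega)]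
  simp only [e, Equiv.swap_apply_left, Equiv.swap_apply_right]
  rw [L_skew L hL, smul_neg]

/-- The contribution of a single `τ` to the right-hand side. -/
def GG (x : ℕ → V) (τ : Equiv.Perm (Fin (2 * r + 2))) : V :=
  (Equiv.Perm.sign τ : ℤ) • Alt (2 * r + 3) (fun y => FF r L Φ (permt V τ (zz r L y))) x

lemma GG_high (x : ℕ → V) (τ : Equiv.Perm (Fin (2 * r + 2))) (i j : Fin (2 * r + 2))
    (hi : 2 ≤ (i : ℕ)) (hj : 2 ≤ (j : ℕ)) (hij : i ≠ j) :
    GG r L Φ x (τ * Equiv.swap i j) = GG r L Φ x τ := by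
  unfold GG
  simp only [permt_mul, permt_swap]
  simp only [FF_swap_high r L Φ _ i j i.2 j.2 hi hj (by simpa [Fin.ext_iff] using hij), Alt_neg,
    Equiv.Perm.sign_mul, Equiv.Perm.sign_swap hij]
  simp

lemma GG_low (hL : ∀ v : V, L v v = 0) (x : ℕ → V) (τ : Equiv.Perm (Fin (2 * r + 2))) :
    GG r L Φ x (τ * Equiv.swap 0 1) = GG r L Φ x τ := by
  unfold GG
  have h := FF_swap_low r L Φ hL
  simp only [permt_mul, permt_swap, Fin.val_zero, Fin.val_one, h, Alt_neg,
    Equiv.Perm.sign_mul, Equiv.Perm.sign_swap (zero_ne_one (α := Fin (2 * r + 2)))]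
  simp

lemma zz_lift (ρ : Equiv.Perm (Fin (2 * r + 2))) (hρ : ρ (Fin.last _) = Fin.last _) (y : ℕ → V) :
    zz r L (permt V (ρ.viaFintypeEmbedding Fin.castSuccEmb) y) =
      permt V ρ (zz r L y) := by
  have hc : ∀ i : Fin (2 * r + 2),
      ρ.viaFintypeEmbedding Fin.castSuccEmb i.castSucc = (ρ i).castSucc := by
    intro i
    exact ρ.viaFintypeEmbedding_apply_image Fin.castSuccEmb i
  have hl : ρ.viaFintypeEmbedding Fin.castSuccEmb (Fin.last (2 * r + 2)) =
      Fin.last (2 * r + 2) := by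
    apply Equiv.Perm.viaFintypeEmbedding_apply_notMem_range
    rintro ⟨i, hi⟩
    exact (Fin.castSucc_lt_last i).ne hi
  have v1 : permt V (ρ.viaFintypeEmbedding Fin.castSuccEmb) y (2 * r + 1)
      = y (2 * r + 1) := by
    have := hc (Fin.last _)
    rw [hρ] at this
    have h' : (ρ.viaFintypeEmbedding Fin.castSuccEmb)
      (⟨2 * r + 1, by omega⟩ : Fin (2 * r + 2 + 1)) = (Fin.last (2 * r + 1)).castSucc := this
    unfold permt
    rw [dif_pos (by omega), h']; rfl
  have v2 : permt V (ρ.viaFintypeEmbedding Fin.castSuccEmb) y (2 * r + 2)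
      = y (2 * r + 2) := by
    have h' : (ρ.viaFintypeEmbedding Fin.castSuccEmb)
      (⟨2 * r + 2, by omega⟩ : Fin (2 * r + 2 + 1)) = Fin.last (2 * r + 2) := hl
    unfold permt
    rw [dif_pos (by omega), h']; rfl
  funext m
  unfold zz
  rw [v1, v2]
  by_cases hm : m < 2 * r + 1
  · rw [if_pos hm]
    have h' : (ρ.viaFintypeEmbedding Fin.castSuccEmb)
      (⟨m, by omega⟩ : Fin (2 * r + 2 + 1)) = (ρ ⟨m, by omega⟩).castSucc := hc ⟨m, by omega⟩
    have hne : (ρ ⟨m, by omega⟩ : Fin (2 * r + 2)) ≠ Fin.last _ := by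
      rw [← hρ]
      intro h
      have := congrArg Fin.val (ρ.injective h)
      simp at this
      omega
    have hlt : ((ρ ⟨m, by omega⟩ : Fin (2 * r + 2)) : ℕ) < 2 * r + 1 := Fin.val_lt_last hne
    unfold permt
    rw [dif_pos (by omega), dif_pos (by omega), h']
    beta_reduce
    rw [if_pos hlt]; rfl
  · rw [if_neg hm]
    unfold permt
    by_cases hm2 : m < 2 * r + 2
    · have : (⟨m, hm2⟩ : Fin (2 * r + 2)) = Fin.last _ := by
        apply Fin.ext; simp; omega
      rw [dif_pos hm2, this, hρ]
      beta_reduce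
      rw [if_neg (by simp)]
    · rw [dif_neg hm2]
      beta_reduce
      rw [if_neg hm]

lemma GG_left (x : ℕ → V) (ρ τ : Equiv.Perm (Fin (2 * r + 2)))
    (hρ : ρ (Fin.last _) = Fin.last _) : GG r L Φ x (ρ * τ) = GG r L Φ x τ := by
  unfold GG
  simp only [permt_mul, ← zz_lift r L ρ hρ]
  rw [Alt_perm (fun y => FF r L Φ (permt V τ (zz r L y))) x
    (ρ.viaFintypeEmbedding Fin.castSuccEmb),
    Equiv.Perm.viaFintypeEmbedding_sign, smul_smul]
  congr 1
  rcases Int.units_eq_one_or (Equiv.Perm.sign ρ) with h | h <;> simp [h]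

lemma GG_one_last (hr : 1 ≤ r)
    (hJ : ∀ a b c : V, L a (L b c) + L b (L c a) + L c (L a b) = 0) (x : ℕ → V) :
    GG r L Φ x (Equiv.swap 1 (Fin.last _)) = 0 := by
  unfold GG
  have key : Alt (2 * r + 3)
      (fun y => FF r L Φ (permt V (Equiv.swap 1 (Fin.last (2 * r + 1))) (zz r L y))) x = 0 := by
    set f : (ℕ → V) → V :=
      fun y => FF r L Φ (permt V (Equiv.swap 1 (Fin.last (2 * r + 1))) (zz r L y)) with hf
    have hfy : ∀ y, f y = Φ (fun i : Fin (2 * r) =>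
        if (i : ℕ) + 2 = 2 * r + 1 then y 1 else y ((i : ℕ) + 2)) •
        L (y 0) (L (y (2 * r + 1)) (y (2 * r + 2))) := by
      intro y
      simp only [hf, FF, permt_swap]
      have e0 : Equiv.swap (1 : ℕ) (2 * r + 1) 0 = 0 :=
        Equiv.swap_apply_of_ne_of_ne (by omega) (by omega)
      simp only [Fin.val_one, Fin.val_last, Equiv.swap_apply_left, e0]
      congr 2
      · funext i
        rw [Equiv.swap_apply_def]
        have := i.2
        split_ifs <;> simp [zz] <;> omega
      · simp [zz]
    have h1 : Alt (2 * r + 3) (fun y => f (fun m => y (Equiv.swap 0 (2 * r + 1)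
        (Equiv.swap (2 * r + 1) (2 * r + 2) m)))) x = Alt (2 * r + 3) f x := by
      rw [Alt_swap (fun y => f (fun m => y (Equiv.swap (2 * r + 1) (2 * r + 2) m))) x
        0 (2 * r + 1) (by omega) (by omega) (by omega),
        Alt_swap f x (2 * r + 1) (2 * r + 2) (by omega) (by omega) (by omega), neg_neg]
    have h2 : Alt (2 * r + 3) (fun y => f (fun m => y (Equiv.swap (2 * r + 1) (2 * r + 2)
        (Equiv.swap 0 (2 * r + 1) m)))) x = Alt (2 * r + 3) f x := by
      rw [Alt_swap (fun y => f (fun m => y (Equiv.swap 0 (2 * r + 1) m))) x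
        (2 * r + 1) (2 * r + 2) (by omega) (by omega) (by omega),
        Alt_swap f x 0 (2 * r + 1) (by omega) (by omega) (by omega), neg_neg]
    have h3 : Alt (2 * r + 3) (fun y => f y + f (fun m => y (Equiv.swap 0 (2 * r + 1)
        (Equiv.swap (2 * r + 1) (2 * r + 2) m))) + f (fun m => y (Equiv.swap (2 * r + 1) (2 * r + 2)
        (Equiv.swap 0 (2 * r + 1) m)))) x = 0 := by
      have : ∀ y : ℕ → V, f y + f (fun m => y (Equiv.swap 0 (2 * r + 1)
        (Equiv.swap (2 * r + 1) (2 * r + 2) m))) + f (fun m => y (Equiv.swap (2 * r + 1) (2 * r + 2)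
        (Equiv.swap 0 (2 * r + 1) m))) = 0 := by
        intro y
        simp only [hfy]
        have a1 : ∀ m, m ≠ 0 → m < 2 * r + 1 → Equiv.swap 0 (2 * r + 1)
          (Equiv.swap (2 * r + 1) (2 * r + 2) m) = m := by
          intro m _ _
          rw [Equiv.swap_apply_of_ne_of_ne (a := 2 * r + 1) (by omega) (by omega),
            Equiv.swap_apply_of_ne_of_ne (by omega) (by omega)]
        have a2 : ∀ m, m ≠ 0 → m < 2 * r + 1 → Equiv.swap (2 * r + 1) (2 * r + 2)
          (Equiv.swap 0 (2 * r + 1) m) = m := by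
          intro m _ _
          rw [Equiv.swap_apply_of_ne_of_ne (a := 0) (by omega) (by omega),
            Equiv.swap_apply_of_ne_of_ne (by omega) (by omega)]
        have b1 : (fun i : Fin (2 * r) => if (i : ℕ) + 2 = 2 * r + 1 then
            y (Equiv.swap 0 (2 * r + 1) (Equiv.swap (2 * r + 1) (2 * r + 2) 1)) else
            y (Equiv.swap 0 (2 * r + 1) (Equiv.swap (2 * r + 1) (2 * r + 2) ((i : ℕ) + 2)))) =
            fun i : Fin (2 * r) => if (i : ℕ) + 2 = 2 * r + 1 then y 1 else y ((i : ℕ) + 2) := by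
          funext i
          have := i.2
          split_ifs
          · rw [a1 _ (by omega) (by omega)]
          · rw [a1 _ (by omega) (by omega)]
        have b2 : (fun i : Fin (2 * r) => if (i : ℕ) + 2 = 2 * r + 1 then
            y (Equiv.swap (2 * r + 1) (2 * r + 2) (Equiv.swap 0 (2 * r + 1) 1)) else
            y (Equiv.swap (2 * r + 1) (2 * r + 2) (Equiv.swap 0 (2 * r + 1) ((i : ℕ) + 2)))) =
            fun i : Fin (2 * r) => if (i : ℕ) + 2 = 2 * r + 1 then y 1 else y ((i : ℕ) + 2) := by
          funext i
          have := i.2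
          split_ifs
          · rw [a2 _ (by omega) (by omega)]
          · rw [a2 _ (by omega) (by omega)]
        rw [b1, b2, ← smul_add, ← smul_add]
        have c1 : Equiv.swap (2 * r + 1) (2 * r + 2) 0 = 0 :=
          Equiv.swap_apply_of_ne_of_ne (by omega) (by omega)
        have c2 : Equiv.swap 0 (2 * r + 1) (2 * r + 2) = 2 * r + 2 :=
          Equiv.swap_apply_of_ne_of_ne (by omega) (by omega)
        simp only [c1, c2, Equiv.swap_apply_left, Equiv.swap_apply_right]
        have := hJ (y 0) (y (2 * r + 1)) (y (2 * r + 2))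
        rw [this, smul_zero]
      simp [this, Alt]
    rw [Alt_add, Alt_add, h1, h2] at h3
    have h4 : (3 : k) • Alt (2 * r + 3) f x = 0 := by rw [← h3]; module
    exact (smul_eq_zero.mp h4).resolve_left (by norm_num)
  rw [key, smul_zero]

lemma GG_value (hr : 1 ≤ r) (hL : ∀ v : V, L v v = 0)
    (hJ : ∀ a b c : V, L a (L b c) + L b (L c a) + L c (L a b) = 0) (x : ℕ → V)
    (τ : Equiv.Perm (Fin (2 * r + 2))) :
    GG r L Φ x τ = if 2 ≤ ((τ⁻¹ (Fin.last _) : Fin (2 * r + 2)) : ℕ) then GG r L Φ x 1 else 0 := by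
  set p := τ⁻¹ (Fin.last _) with hp
  have hτp : τ p = Fin.last _ := by simp [hp]
  have hfac : GG r L Φ x τ = GG r L Φ x (Equiv.swap p (Fin.last _)) := by
    have := GG_left r L Φ x (τ * Equiv.swap p (Fin.last _)) (Equiv.swap p (Fin.last _))
      (by simp [hτp])
    rwa [mul_assoc, Equiv.swap_mul_self, mul_one] at this
  have hl1 : (Fin.last (2 * r + 1)) ≠ 1 := by
    intro h; have := congrArg Fin.val h; simp at this; omega
  have hl0 : (Fin.last (2 * r + 1)) ≠ 0 := by
    intro h; have := congrArg Fin.val h; simp at this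
  rw [hfac]
  split_ifs with h
  · by_cases hpl : p = Fin.last _
    · rw [hpl, Equiv.swap_self]; rfl
    · have := GG_high r L Φ x 1 p (Fin.last _) h (by simp; omega) hpl
      rwa [one_mul] at this
  · have hcase : p = 0 ∨ p = 1 := by
      simp only [Fin.ext_iff, Fin.val_zero, Fin.val_one]; omega
    have h1 := GG_one_last r L Φ hr hJ x
    rcases hcase with h0 | h0
    · rw [h0, ← GG_low r L Φ hL]
      have h2 := GG_left r L Φ x (Equiv.swap 0 (Fin.last _) * Equiv.swap 0 1 *
        Equiv.swap 1 (Fin.last _)) (Equiv.swap 1 (Fin.last _)) (by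
          simp)
      rw [mul_assoc, Equiv.swap_mul_self, mul_one] at h2
      rw [h2, h1]
    · rw [h0, h1]

/-- The contribution of a single position to the left-hand side. -/
def HH (x : ℕ → V) (p : ℕ) : V :=
  Alt (2 * r + 3) (fun y => ((-1 : k) ^ (2 * r - 1 - p) *
    Φ (fun i : Fin (2 * r) => insL k V L p (fun n => y (n + 2)) i)) • L (y 0) (y 1)) x

lemma HH_step (x : ℕ → V) (p : ℕ) (hp : p + 1 < 2 * r) : HH r L Φ x p = HH r L Φ x (p + 1) := by
  set g : (ℕ → V) → V := fun y => ((-1 : k) ^ (2 * r - 1 - (p + 1)) *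
    Φ (fun i : Fin (2 * r) => insL k V L (p + 1) (fun n => y (n + 2)) i)) • L (y 0) (y 1) with hg
  have h1 : Alt (2 * r + 3) (fun y => g (fun m => y (Equiv.swap (p + 3) (p + 4)
        (Equiv.swap (p + 2) (p + 3) m)))) x = Alt (2 * r + 3) g x := by
    rw [Alt_swap (fun y => g (fun m => y (Equiv.swap (p + 2) (p + 3) m))) x
        (p + 3) (p + 4) (by omega) (by omega) (by omega),
        Alt_swap g x (p + 2) (p + 3) (by omega) (by omega) (by omega), neg_neg]
  unfold HH
  rw [← hg, ← h1]
  congr 1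
  funext y
  simp only [hg]
  have e0 : Equiv.swap (p + 3) (p + 4) (Equiv.swap (p + 2) (p + 3) 0) = 0 := by
    rw [Equiv.swap_apply_of_ne_of_ne (a := p + 2) (by omega) (by omega),
      Equiv.swap_apply_of_ne_of_ne (by omega) (by omega)]
  have e1 : Equiv.swap (p + 3) (p + 4) (Equiv.swap (p + 2) (p + 3) 1) = 1 := by
    rw [Equiv.swap_apply_of_ne_of_ne (a := p + 2) (by omega) (by omega),
      Equiv.swap_apply_of_ne_of_ne (by omega) (by omega)]
  rw [e0, e1]
  congr 1
  have hs := Φ.map_swap (fun i : Fin (2 * r) => insL k V L p (fun n => y (n + 2)) i)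
    (i := ⟨p, by omega⟩) (j := ⟨p + 1, by omega⟩) (by simp [Fin.ext_iff])
  have e : (fun i : Fin (2 * r) => insL k V L (p + 1) (fun n => y (Equiv.swap (p + 3) (p + 4)
        (Equiv.swap (p + 2) (p + 3) (n + 2)))) i) =
      (fun i : Fin (2 * r) => insL k V L p (fun n => y (n + 2)) i) ∘
      (Equiv.swap (⟨p, by omega⟩ : Fin (2 * r)) ⟨p + 1, by omega⟩) := by
    funext i
    have s2 : Equiv.swap (p + 3) (p + 4) (Equiv.swap (p + 2) (p + 3) (p + 2)) = p + 4 := by simp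
    have s3 : Equiv.swap (p + 3) (p + 4) (Equiv.swap (p + 2) (p + 3) (p + 1 + 2)) = p + 2 := by
      rw [show p + 1 + 2 = p + 3 by omega, Equiv.swap_apply_right,
        Equiv.swap_apply_of_ne_of_ne (by omega) (by omega)]
    have s4 : Equiv.swap (p + 3) (p + 4) (Equiv.swap (p + 2) (p + 3) (p + 1 + 1 + 2)) = p + 3 := by
      rw [show p + 1 + 1 + 2 = p + 4 by omega, Equiv.swap_apply_of_ne_of_ne (a := p + 2)
        (by omega) (by omega), Equiv.swap_apply_right]
    have s : ∀ m, m < p + 2 ∨ p + 4 < m →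
        Equiv.swap (p + 3) (p + 4) (Equiv.swap (p + 2) (p + 3) m) = m := by
      intro m hm
      rw [Equiv.swap_apply_of_ne_of_ne (a := p + 2) (by omega) (by omega),
        Equiv.swap_apply_of_ne_of_ne (by omega) (by omega)]
    obtain ⟨i, hi⟩ := i
    simp only [Function.comp, Equiv.swap_apply_def (⟨p, _⟩ : Fin (2 * r)), Fin.mk.injEq]
    rcases lt_trichotomy i p with h | h | h
    · rw [if_neg (by omega), if_neg (by omega)]
      simp only [insL]
      rw [if_pos (by omega), if_pos h, s _ (by omega)]
    · subst h
      simp only [insL, if_true]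
      rw [if_pos (by omega), if_neg (by omega), if_neg (by omega), s2]
    · by_cases h' : i = p + 1
      · subst h'
        simp only [insL, if_true]
        rw [s3, s4, if_neg (show ¬ (p + 1 = p) by omega)]
        simp [show p + 1 + 2 = p + 3 by omega]
      · rw [if_neg (by omega), if_neg (by omega)]
        simp only [insL]
        rw [if_neg (by omega), if_neg (by omega), if_neg (by omega), if_neg (by omega),
          s _ (by omega)]
  rw [e, hs, show 2 * r - 1 - p = (2 * r - 1 - (p + 1)) + 1 by omega, pow_succ]
  ring

lemma HH_last (hr : 1 ≤ r) (x : ℕ → V) : HH r L Φ x (2 * r - 1) = GG r L Φ x 1 := by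
  unfold HH GG
  simp only [Equiv.Perm.sign_one, Units.val_one, one_smul]
  congr 1
  funext y
  simp only [FF]
  have e : ∀ z : ℕ → V, permt V (1 : Equiv.Perm (Fin (2 * r + 2))) z = z := by
    intro z; funext m; simp [permt]
  rw [e, Nat.sub_self, pow_zero, one_mul]
  congr 2
  funext i
  have := i.2
  simp only [insL, zz]
  rw [show 2 * r - 1 + 2 = 2 * r + 1 by omega, show 2 * r - 1 + 1 + 2 = 2 * r + 2 by omega]
  split_ifs <;> first | rfl | omega
  · simp [zz, show 1 < 2 * r + 1 by omega]

lemma HH_value (hr : 1 ≤ r) (x : ℕ → V) (p : ℕ) (hp : p < 2 * r) :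
    HH r L Φ x p = GG r L Φ x 1 := by
  rw [← HH_last r L Φ hr x]
  obtain ⟨d, hd⟩ : ∃ d, 2 * r - 1 = p + d := ⟨2 * r - 1 - p, by omega⟩
  rw [hd]
  have : ∀ d, p + d < 2 * r → HH r L Φ x p = HH r L Φ x (p + d) := by
    intro d
    induction d with
    | zero => intro _; rfl
    | succ d ih =>
      intro h
      rw [ih (by omega), HH_step r L Φ x (p + d) (by omega)]; rfl
  exact this d (by omega)

end helpers

/-- Let `V` be a vector space over a field of characteristic zero,
`L : ∧² V → V` a Lie bracket and `Φ : ∧^{2r} V → k` an alternating form, all regarded as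
maps on tensor powers.  Then the map
`L ⊗ (Φ ∘ (± 𝟙^{2r-1} L)) : ∧^{2r+3} V → V` and the composition
`L ∘ T₂(Φ) ∘ T_{2r+1}(L) : ∧^{2r+3} V → ∧^{2r+2} V → ∧² V → V`
are equal up to multiplication by a nonzero scalar. -/
theorem stmt13 (r : ℕ) (hr : 1 ≤ r)
    (L : V →ₗ[k] V →ₗ[k] V) (hL : ∀ v : V, L v v = 0)
    (hJac : ∀ x : Fin 3 → V,
      (∑ σ : Equiv.Perm (Fin 3), (Equiv.Perm.sign σ : ℤ) •
          (L (x (σ 0)) (L (x (σ 1)) (x (σ 2))) - L (L (x (σ 0)) (x (σ 1))) (x (σ 2)))) = 0)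
    (Φ : AlternatingMap k V k (Fin (2 * r))) :
    ∃ c : k, c ≠ 0 ∧ ∀ x : ℕ → V,
      (∑ σ : Equiv.Perm (Fin (2 * r + 3)), (Equiv.Perm.sign σ : ℤ) •
          ∑ pos ∈ Finset.range (2 * r),
            ((-1 : k) ^ (2 * r - 1 - pos) *
                Φ (fun i : Fin (2 * r) =>
                  insL k V L pos (fun n => permt V σ x (n + 2)) i)) •
              L (permt V σ x 0) (permt V σ x 1)) =
        c • ∑ σ : Equiv.Perm (Fin (2 * r + 3)), (Equiv.Perm.sign σ : ℤ) •
          ∑ τ : Equiv.Perm (Fin (2 * r + 2)), (Equiv.Perm.sign τ : ℤ) •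
            Φ (fun i : Fin (2 * r) => permt V τ (zT k V r L σ x) ((i : ℕ) + 2)) •
              L (permt V τ (zT k V r L σ x) 0) (permt V τ (zT k V r L σ x) 1) := by
  have hJ := jac L hL hJac
  set N := (Finset.univ.filter (fun τ : Equiv.Perm (Fin (2 * r + 2)) =>
    2 ≤ ((τ⁻¹ (Fin.last _) : Fin (2 * r + 2)) : ℕ))).card with hN
  have hN0 : (N : k) ≠ 0 := by
    rw [Nat.cast_ne_zero, hN]
    apply Finset.card_ne_zero_of_mem (a := 1)
    simp only [Finset.mem_filter, Finset.mem_univ, true_and, inv_one, Equiv.Perm.one_apply,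
      Fin.val_last]
    omega
  have hr0 : ((2 * r : ℕ) : k) ≠ 0 := by
    rw [Nat.cast_ne_zero]; omega
  refine ⟨((2 * r : ℕ) : k) / N, div_ne_zero hr0 hN0, fun x => ?_⟩
  have hlhs : (∑ σ : Equiv.Perm (Fin (2 * r + 3)), (Equiv.Perm.sign σ : ℤ) •
          ∑ pos ∈ Finset.range (2 * r),
            ((-1 : k) ^ (2 * r - 1 - pos) *
                Φ (fun i : Fin (2 * r) =>
                  insL k V L pos (fun n => permt V σ x (n + 2)) i)) •
              L (permt V σ x 0) (permt V σ x 1)) = ((2 * r : ℕ) : k) • GG r L Φ x 1 := by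
    simp only [Finset.smul_sum]
    rw [Finset.sum_comm]
    have h1 := Finset.sum_congr (s₁ := Finset.range (2 * r)) rfl
      (fun p hp => HH_value r L Φ hr x p (Finset.mem_range.mp hp))
    refine Eq.trans h1 ?_
    rw [Finset.sum_const, Finset.card_range, Nat.cast_smul_eq_nsmul]
  have hrhs : (∑ σ : Equiv.Perm (Fin (2 * r + 3)), (Equiv.Perm.sign σ : ℤ) •
          ∑ τ : Equiv.Perm (Fin (2 * r + 2)), (Equiv.Perm.sign τ : ℤ) •
            Φ (fun i : Fin (2 * r) => permt V τ (zT k V r L σ x) ((i : ℕ) + 2)) •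
              L (permt V τ (zT k V r L σ x) 0) (permt V τ (zT k V r L σ x) 1)) =
        (N : k) • GG r L Φ x 1 := by
    have h1 : ∀ τ : Equiv.Perm (Fin (2 * r + 2)),
        (∑ σ : Equiv.Perm (Fin (2 * r + 3)), (Equiv.Perm.sign σ : ℤ) • (Equiv.Perm.sign τ : ℤ) •
            Φ (fun i : Fin (2 * r) => permt V τ (zT k V r L σ x) ((i : ℕ) + 2)) •
              L (permt V τ (zT k V r L σ x) 0) (permt V τ (zT k V r L σ x) 1)) =
        GG r L Φ x τ := by
      intro τ
      unfold GG Alt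
      rw [Finset.smul_sum]
      refine Finset.sum_congr rfl fun σ _ => ?_
      rw [smul_comm]
      rfl
    simp only [Finset.smul_sum]
    rw [Finset.sum_comm, Finset.sum_congr rfl (fun τ _ => h1 τ),
      Finset.sum_congr rfl (fun τ _ => GG_value r L Φ hr hL hJ x τ), ← Finset.sum_filter,
      Finset.sum_const, Nat.cast_smul_eq_nsmul]
  rw [hlhs, hrhs, smul_smul, div_mul_cancel₀ _ hN0]

end PBW13
end

section
/- Let $V$ be a vector space of dimension $\geq N+2$ over a field of characteristic zero, with $N$ odd. Let $l : V \to k$ be a linear form and $\Phi_{2r} : \wedge^{2r} V \to k$ alternating forms for $2 \leq 2r < N$. Setting $\alpha_{2r} = \mathbf{1}^{\otimes N-2r} \otimes \Phi_{2r}$ and $\alpha_{2r+1} = \mathbf{1}^{\otimes N-2r-1} \otimes l \otimes \Phi_{2r}$ (restricted to $\wedge^N V \subseteq V^{\otimes N}$), the maps satisfy: the image of $[\mathbf{1}, \alpha_1] = \mathbf{1} \otimes \alpha_1 - \alpha_1 \otimes \mathbf{1}$ on $\wedge^{N+1} V$ is contained in $\wedge^N V$, and $\alpha_i \circ [\mathbf{1},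 \alpha_1] = [\mathbf{1}, \alpha_{i+1}]$ for $i = 1, \ldots, N$ (with $\alpha_{N+1} = 0$). -/
open scoped TensorProduct
open PiTensorProduct

namespace PBW14


variable (k V : Type) [Field k] [CharZero k] [AddCommGroup V] [Module k V]

/-- The pure tensor `x 0 ⊗ ⋯ ⊗ x (n-1)` in `V^{⊗n}`. -/
noncomputable def tpN (n : ℕ) (x : ℕ → V) : ⨂[k]^n V := tprod k fun i : Fin n => x i

/-- The total antisymmetrization `∑_{σ ∈ S_n} sgn σ • x_{σ(0)} ⊗ ⋯ ⊗ x_{σ(n-1)}`,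
the image of `x 0 ∧ ⋯ ∧ x (n-1)` under the embedding `∧ⁿ V ⊆ V^{⊗n}`. -/
noncomputable def asymN (n : ℕ) (x : ℕ → V) : ⨂[k]^n V :=
  ∑ σ : Equiv.Perm (Fin n), (Equiv.Perm.sign σ : ℤ) • tprod k (fun i : Fin n => x (σ i))

/-- The image of `∧ⁿ V` in `V^{⊗n}` under total antisymmetrization. -/
noncomputable def wedgeIm (n : ℕ) : Submodule k (⨂[k]^n V) :=
  Submodule.span k (Set.range (asymN k V n))

/-- `x 0 ∧ ⋯ ∧ x (n-1)` as an element of the subspace `∧ⁿ V ⊆ V^{⊗n}`. -/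
noncomputable def wdgN (n : ℕ) (x : ℕ → V) : wedgeIm k V n :=
  ⟨asymN k V n x, Submodule.subset_span ⟨x, rfl⟩⟩

/-- Permute the first `n` entries of the sequence `x` by `σ`. -/
def permt {n : ℕ} (σ : Equiv.Perm (Fin n)) (x : ℕ → V) : ℕ → V :=
  fun m => if h : m < n then x (σ ⟨m, h⟩) else x m

/-- Remove the `j`-th entry of the sequence `x`. -/
def removeN (j : ℕ) (x : ℕ → V) : ℕ → V := fun m => if m < j then x m else x (m + 1)

/-- Prepend the entry `v` at the front of the sequence `x`. -/
def consT (v : V) (x : ℕ → V) : ℕ → V := fun m => if m = 0 then v else x (m - 1)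

/-- Replace the `p`-th entry of the sequence `x` by `v`. -/
def putAt (p : ℕ) (x : ℕ → V) (v : V) : ℕ → V := fun m => if m = p then v else x m


/-- The map `V^{⊗m} → V^{⊗(m+1)}`, `t ↦ v ⊗ t`. -/
noncomputable def prepend (m : ℕ) (v : V) : ⨂[k]^m V →ₗ[k] ⨂[k]^(m+1) V :=
  (TensorPower.cast k V (Nat.add_comm 1 m)).toLinearMap ∘ₗ
    (TensorPower.mulEquiv (R := k) (M := V) (n := 1) (m := m)).toLinearMap ∘ₗ
      TensorProduct.mk k (⨂[k]^1 V) (⨂[k]^m V) (tprod k fun _ : Fin 1 => v)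

/-- The map `V^{⊗m} → V^{⊗(m+1)}`, `t ↦ t ⊗ v`. -/
noncomputable def append (m : ℕ) (v : V) : ⨂[k]^m V →ₗ[k] ⨂[k]^(m+1) V :=
  (TensorPower.mulEquiv (R := k) (M := V) (n := m) (m := 1)).toLinearMap ∘ₗ
    (TensorProduct.mk k (⨂[k]^m V) (⨂[k]^1 V)).flip (tprod k fun _ : Fin 1 => v)


/-- The scalar part of the deformation map `α_i` of Theorem 4.1 (for `N` odd), evaluated on
the sequence `y` (of length `N`, with `n = N - i`):
for `i = 2r` it is `Φ_{2r}(y_n, …, y_{N-1})` (the map `α_{2r} = 𝟙^{⊗(N-2r)} ⊗ Φ_{2r}`),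
and for `i = 2r+1` it is `l(y_n) · Φ_{2r}(y_{n+1}, …, y_{N-1})` (the map
`α_{2r+1} = 𝟙^{⊗(N-2r-1)} ⊗ l ⊗ Φ_{2r}`); for `i > N` (i.e. `α_{N+1}`) it is `0`. -/
noncomputable def AvS (N : ℕ) (l : V →ₗ[k] k)
    (Φ : (r : ℕ) → AlternatingMap k V k (Fin (2 * r))) (i n : ℕ) (y : ℕ → V) : k :=
  if i ≤ N then
    if i % 2 = 0 then Φ (i / 2) (fun t : Fin (2 * (i / 2)) => y (n + t))
    else l (y n) * Φ (i / 2) (fun t : Fin (2 * (i / 2)) => y (n + 1 + t))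
  else 0

/-- `[𝟙, α₁] = 𝟙 ⊗ α₁ - α₁ ⊗ 𝟙` applied to the antisymmetrization of `x_0, …, x_N`,
where `α₁ = 𝟙^{⊗(N-1)} ⊗ l`, written out explicitly on pure tensors. -/
noncomputable def bracket1 (N : ℕ) (l : V →ₗ[k] k)
    (Φ : (r : ℕ) → AlternatingMap k V k (Fin (2 * r))) (x : ℕ → V) : ⨂[k]^N V :=
  (∑ j ∈ Finset.range (N + 1), ∑ σ : Equiv.Perm (Fin N),
      ((-1 : ℤ) ^ j * (Equiv.Perm.sign σ : ℤ)) •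
        AvS k V N l Φ 1 (N - 1) (permt V σ (removeN V j x)) •
          tpN k V N (consT V (x j) (permt V σ (removeN V j x)))) -
    ∑ j ∈ Finset.range (N + 1), ∑ σ : Equiv.Perm (Fin N),
      ((-1 : ℤ) ^ (N - j) * (Equiv.Perm.sign σ : ℤ)) •
        AvS k V N l Φ 1 (N - 1) (permt V σ (removeN V j x)) •
          tpN k V N (putAt V (N - 1) (permt V σ (removeN V j x)) (x j))

/-- `α_i ∘ [𝟙, α₁]` applied to the antisymmetrization of `x_0, …, x_N`. -/
noncomputable def lhsB (N : ℕ) (l : V →ₗ[k] k)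
    (Φ : (r : ℕ) → AlternatingMap k V k (Fin (2 * r))) (i : ℕ) (x : ℕ → V) :
    ⨂[k]^(N - i) V :=
  (∑ j ∈ Finset.range (N + 1), ∑ σ : Equiv.Perm (Fin N),
      ((-1 : ℤ) ^ j * (Equiv.Perm.sign σ : ℤ)) •
        AvS k V N l Φ 1 (N - 1) (permt V σ (removeN V j x)) •
          AvS k V N l Φ i (N - i) (consT V (x j) (permt V σ (removeN V j x))) •
            tpN k V (N - i) (consT V (x j) (permt V σ (removeN V j x)))) -
    ∑ j ∈ Finset.range (N + 1), ∑ σ : Equiv.Perm (Fin N),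
      ((-1 : ℤ) ^ (N - j) * (Equiv.Perm.sign σ : ℤ)) •
        AvS k V N l Φ 1 (N - 1) (permt V σ (removeN V j x)) •
          AvS k V N l Φ i (N - i) (putAt V (N - 1) (permt V σ (removeN V j x)) (x j)) •
            tpN k V (N - i) (putAt V (N - 1) (permt V σ (removeN V j x)) (x j))

/-- `[𝟙, α_{i+1}]` applied to the antisymmetrization of `x_0, …, x_N`. -/
noncomputable def rhsB (N : ℕ) (l : V →ₗ[k] k)
    (Φ : (r : ℕ) → AlternatingMap k V k (Fin (2 * r))) (i : ℕ) (x : ℕ → V) :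
    ⨂[k]^(N - i) V :=
  (∑ j ∈ Finset.range (N + 1), ∑ σ : Equiv.Perm (Fin N),
      ((-1 : ℤ) ^ j * (Equiv.Perm.sign σ : ℤ)) •
        AvS k V N l Φ (i + 1) (N - (i + 1)) (permt V σ (removeN V j x)) •
          tpN k V (N - i) (consT V (x j) (permt V σ (removeN V j x)))) -
    ∑ j ∈ Finset.range (N + 1), ∑ σ : Equiv.Perm (Fin N),
      ((-1 : ℤ) ^ (N - j) * (Equiv.Perm.sign σ : ℤ)) •
        AvS k V N l Φ (i + 1) (N - (i + 1)) (permt V σ (removeN V j x)) •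
          tpN k V (N - i) (putAt V (N - (i + 1)) (permt V σ (removeN V j x)) (x j))


variable {V}

/-- Alternating sum over all permutations of the first `N + 1` entries. -/
noncomputable def altS {M : Type*} [AddCommGroup M] (N : ℕ) (x : ℕ → V) (G : (ℕ → V) → M) : M :=
  ∑ τ : Equiv.Perm (Fin (N + 1)), (Equiv.Perm.sign τ : ℤ) • G (permt V τ x)

/-- The sequence `y` with the entry at `N` set to `v` and the later ones taken from `x`. -/
def snocT (N : ℕ) (v : V) (y x : ℕ → V) : ℕ → V :=
  fun m => if m < N then y m else if m = N then v else x m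

/-- Glue a position and a permutation of the remaining entries. -/
def glue {N : ℕ} (j : Fin (N + 1)) (σ : Equiv.Perm (Fin N)) : Equiv.Perm (Fin (N + 1)) :=
  j.cycleRange.symm * Equiv.Perm.decomposeFin.symm (0, σ)

lemma glue_zero {N : ℕ} (j : Fin (N + 1)) (σ : Equiv.Perm (Fin N)) : glue j σ 0 = j := by
  simp [glue]

lemma glue_succ {N : ℕ} (j : Fin (N + 1)) (σ : Equiv.Perm (Fin N)) (i : Fin N) :
    glue j σ i.succ = j.succAbove (σ i) := by
  simp [glue]

lemma sign_glue {N : ℕ} (j : Fin (N + 1)) (σ : Equiv.Perm (Fin N)) :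
    ((Equiv.Perm.sign (glue j σ) : ℤˣ) : ℤ) = (-1) ^ (j : ℕ) * (Equiv.Perm.sign σ : ℤ) := by
  simp [glue, Equiv.Perm.sign_mul, Equiv.Perm.sign_symm, Fin.sign_cycleRange]

lemma glue_bij (N : ℕ) : Function.Bijective
    (fun p : Fin (N + 1) × Equiv.Perm (Fin N) => glue p.1 p.2) := by
  rw [Fintype.bijective_iff_injective_and_card]
  constructor
  · rintro ⟨j, σ⟩ ⟨j', σ'⟩ h
    simp only at h
    have h0 : j = j' := by rw [← glue_zero j σ, h, glue_zero]
    subst h0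
    have : σ = σ' := by
      ext i
      have := glue_succ j σ i
      rw [h, glue_succ] at this
      rw [Fin.succAbove_right_injective this]
    rw [this]
  · exact (Fintype.card_congr Equiv.Perm.decomposeFin).symm

lemma permt_glue {N : ℕ} (j : Fin (N + 1)) (σ : Equiv.Perm (Fin N)) (x : ℕ → V) :
    permt V (glue j σ) x = consT V (x j) (permt V σ (removeN V j x)) := by
  funext m
  rcases m with _ | m
  · have : (⟨0, by omega⟩ : Fin (N+1)) = 0 := rfl
    simp [permt, consT, this, glue_zero]
  · by_cases h : m < N
    · have : (⟨m + 1, by omega⟩ : Fin (N+1)) = Fin.succ ⟨m, h⟩ := rfl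
      simp only [permt, consT, removeN, this, glue_succ, Fin.succAbove]
      simp only [h, dif_pos, Nat.add_lt_add_iff_right, Nat.add_sub_cancel, Fin.lt_def]
      simp only [Nat.add_eq_zero_iff, one_ne_zero, and_false, if_false]
      split_ifs <;> simp_all
    · have := j.2
      have h2 : ¬ m < (j : ℕ) := by omega
      simp [permt, consT, removeN, h, h2]

lemma permt_mul {n : ℕ} (τ ρ : Equiv.Perm (Fin n)) (x : ℕ → V) :
    permt V (τ * ρ) x = permt V ρ (permt V τ x) := by
  funext m
  by_cases h : m < n <;> simp [permt, h]

section
variable {M : Type*} [AddCommGroup M]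

lemma altS_cons (N : ℕ) (x : ℕ → V) (G : (ℕ → V) → M) :
    ∑ j ∈ Finset.range (N + 1), ∑ σ : Equiv.Perm (Fin N),
      ((-1 : ℤ) ^ j * (Equiv.Perm.sign σ : ℤ)) • G (consT V (x j) (permt V σ (removeN V j x)))
      = altS N x G := by
  rw [Finset.sum_range (fun j => ∑ σ : Equiv.Perm (Fin N),
      ((-1 : ℤ) ^ j * (Equiv.Perm.sign σ : ℤ)) • G (consT V (x j) (permt V σ (removeN V j x)))),
    ← Finset.sum_product', altS]
  refine Fintype.sum_bijective _ (glue_bij N) _ _ ?_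
  rintro ⟨j, σ⟩
  simp only [sign_glue, permt_glue]

lemma altS_perm (N : ℕ) (x : ℕ → V) (G : (ℕ → V) → M) (ρ : Equiv.Perm (Fin (N + 1))) :
    altS N x G = (Equiv.Perm.sign ρ : ℤ) • altS N x (fun z => G (permt V ρ z)) := by
  unfold altS
  rw [Finset.smul_sum, ← Equiv.sum_comp (Equiv.mulRight ρ)]
  refine Finset.sum_congr rfl fun τ _ => ?_
  simp only [Equiv.coe_mulRight, permt_mul, Equiv.Perm.sign_mul, Units.val_mul, smul_smul]
  rw [mul_comm]

lemma permt_rot {N : ℕ} {j : ℕ} (hj : j ≤ N) (σ : Equiv.Perm (Fin N)) (x : ℕ → V) :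
    permt V (finRotate (N + 1)) (consT V (x j) (permt V σ (removeN V j x))) =
      snocT N (x j) (permt V σ (removeN V j x)) x := by
  funext m
  by_cases h : m < N
  · have h' : m < N + 1 := by omega
    have := finRotate_of_lt h
    simp [permt, snocT, h, h', this, consT]
  · by_cases h2 : m = N
    · subst h2
      have := finRotate_last' (n := m)
      simp [permt, snocT, this, consT]
    · have h' : ¬ m < N + 1 := by omega
      have h3 : ¬ m - 1 < N := by omega
      have h4 : ¬ m - 1 < j := by omega
      have h5 : m ≠ 0 := by omega
      have h6 : m - 1 + 1 = m := by omega
      simp [permt, snocT, h, h', h2, consT, h3, h4, h5, removeN, h6]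

lemma altS_snoc (N : ℕ) (x : ℕ → V) (G : (ℕ → V) → M) :
    ∑ j ∈ Finset.range (N + 1), ∑ σ : Equiv.Perm (Fin N),
      ((-1 : ℤ) ^ (N - j) * (Equiv.Perm.sign σ : ℤ)) •
        G (snocT N (x j) (permt V σ (removeN V j x)) x)
      = altS N x G := by
  rw [altS_perm N x G (finRotate (N + 1)), ← altS_cons, Finset.smul_sum]
  refine Finset.sum_congr rfl fun j hj => ?_
  have hj : j ≤ N := by simpa [Nat.lt_succ_iff] using hj
  rw [Finset.smul_sum]
  refine Finset.sum_congr rfl fun σ _ => ?_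
  rw [permt_rot hj, smul_smul, sign_finRotate, ← mul_assoc]
  congr 2
  obtain ⟨d, rfl⟩ := Nat.exists_eq_add_of_le hj
  have : (-1 : ℤ) ^ j * (-1) ^ j = 1 := by rw [← mul_pow]; simp
  simp only [Nat.add_sub_cancel_left, Units.val_pow_eq_pow_val, Units.val_neg, Units.val_one, Nat.add_sub_cancel]
  rw [pow_add]
  linear_combination -(-1 : ℤ) ^ d * this

/-- Swap the entries at `a` and `b`. -/
def swapT (a b : ℕ) (z : ℕ → V) : ℕ → V :=
  fun m => if m = a then z b else if m = b then z a else z m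

lemma altS_swap (N : ℕ) (x : ℕ → V) (G : (ℕ → V) → M) (a b : ℕ) (hab : a < b) (hb : b ≤ N) :
    altS N x G = - altS N x (fun z => G (swapT a b z)) := by
  have ha' : a < N + 1 := by omega
  have hb' : b < N + 1 := by omega
  rw [altS_perm N x G (Equiv.swap ⟨a, ha'⟩ ⟨b, hb'⟩), Equiv.Perm.sign_swap (by simp; omega)]
  have : ∀ z : ℕ → V, permt V (Equiv.swap (⟨a, ha'⟩ : Fin (N+1)) ⟨b, hb'⟩) z = swapT a b z := by
    intro z
    funext m
    by_cases h : m < N + 1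
    · simp only [permt, h, dif_pos, swapT, Equiv.swap_apply_def, Fin.mk.injEq]
      split_ifs <;> rfl
    · have h1 : m ≠ a := by omega
      have h2 : m ≠ b := by omega
      simp [permt, h, swapT, h1, h2]
  simp [this]

lemma altS_congr (N : ℕ) (x : ℕ → V) (G G' : (ℕ → V) → M) (h : ∀ z, G z = G' z) :
    altS N x G = altS N x G' := by
  rw [funext h]

lemma altS_neg (N : ℕ) (x : ℕ → V) (G : (ℕ → V) → M) :
    altS N x (fun z => - G z) = - altS N x G := by
  simp [altS]

end

lemma zero_of_eq_neg {M : Type*} [AddCommGroup M] [Module k M] {a : M} (h : a = -a) : a = 0 := by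
  have h2 : (2 : k) • a = 0 := by
    rw [two_smul]
    nth_rewrite 1 [h]
    simp
  exact (smul_eq_zero.1 h2).resolve_left two_ne_zero

lemma sum_gen {ι M : Type*} [Fintype ι] [AddCommGroup M] [Module k M] (c : ℤ) (a : k)
    (s : ι → ℤ) (T : ι → M) :
    ∑ i, (c * s i) • a • T i = c • a • ∑ i, s i • T i := by
  rw [Finset.smul_sum, Finset.smul_sum]
  refine Finset.sum_congr rfl fun i _ => ?_
  rw [mul_smul, smul_comm a]

lemma tpN_congr {n : ℕ} {y y' : ℕ → V} (h : ∀ m < n, y m = y' m) :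
    tpN k V n y = tpN k V n y' := by
  unfold tpN
  congr 1
  funext i
  exact h i i.2

lemma AvS_congr {N : ℕ} {l : V →ₗ[k] k}
    {Φ : (r : ℕ) → AlternatingMap k V k (Fin (2 * r))} {i n n' : ℕ} {y y' : ℕ → V}
    (h : ∀ t < i, y (n + t) = y' (n' + t)) :
    AvS k V N l Φ i n y = AvS k V N l Φ i n' y' := by
  unfold AvS
  have e1 : i % 2 = 0 → (fun t : Fin (2 * (i / 2)) => y (n + t)) =
      fun t : Fin (2 * (i / 2)) => y' (n' + t) := by
    intro _; funext t; exact h t (by omega)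
  have e2 : ¬ i % 2 = 0 → (fun t : Fin (2 * (i / 2)) => y (n + 1 + t)) =
      fun t : Fin (2 * (i / 2)) => y' (n' + 1 + t) := by
    intro _; funext t; rw [add_assoc, add_assoc]; exact h _ (by omega)
  have e3 : ¬ i % 2 = 0 → y n = y' n' := by intro _; exact h 0 (by omega)
  split_ifs with a b
  · rw [e1 b]
  · rw [e2 b, e3 b]
  · rfl

lemma AvS_one {N : ℕ} (hN : 2 ≤ N) {l : V →ₗ[k] k}
    {Φ : (r : ℕ) → AlternatingMap k V k (Fin (2 * r))}
    (hΦ0 : ∀ z : Fin (2 * 0) → V, Φ 0 z = 1) (n : ℕ) (y : ℕ → V) :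
    AvS k V N l Φ 1 n y = l (y n) := by
  have h : 1 ≤ N := by omega
  have := hΦ0 (fun t => y (n + 1 + t))
  simp only [AvS, h, if_true]
  rw [if_neg (by norm_num)]
  exact (congrArg _ this).trans (mul_one _)

lemma AvS_even {N r n : ℕ} (h : 2 * r ≤ N) {l : V →ₗ[k] k}
    {Φ : (r : ℕ) → AlternatingMap k V k (Fin (2 * r))} (y : ℕ → V) :
    AvS k V N l Φ (2 * r) n y = Φ r (fun t => y (n + t)) := by
  have e : 2 * r / 2 = r := by omega
  simp only [AvS, h, if_true, Nat.mul_mod_right]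
  rw [e]

lemma AvS_odd {N r n : ℕ} (h : 2 * r + 1 ≤ N) {l : V →ₗ[k] k}
    {Φ : (r : ℕ) → AlternatingMap k V k (Fin (2 * r))} (y : ℕ → V) :
    AvS k V N l Φ (2 * r + 1) n y = l (y n) * Φ r (fun t => y (n + 1 + t)) := by
  have e : (2 * r + 1) / 2 = r := by omega
  have e' : ¬ (2 * r + 1) % 2 = 0 := by omega
  simp only [AvS, h, if_true, e', if_false]
  rw [e]

lemma phi_rot {r : ℕ} (hr : 1 ≤ r) (f : AlternatingMap k V k (Fin (2 * r))) (w w' : ℕ → V)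
    (h : ∀ t, t + 1 < 2 * r → w t = w' (t + 1)) (h0 : w (2 * r - 1) = w' 0) :
    f (fun t => w t) = - f (fun t => w' t) := by
  obtain ⟨r, rfl⟩ := Nat.exists_eq_add_of_le' hr
  have := f.map_perm (fun t => w' t) (finRotate (2 * r + 1 + 1))
  have hs : Equiv.Perm.sign (finRotate (2 * r + 1 + 1)) = (-1) ^ (2 * r + 1) := by
    rw [sign_finRotate]; rfl
  have e : (fun t : Fin (2 * (r + 1)) => w t) =
      (fun t : Fin (2 * (r + 1)) => w' t) ∘ (finRotate (2 * r + 1 + 1)) := by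
    funext t
    by_cases ht : (t : ℕ) < 2 * r + 1
    · have := finRotate_of_lt (k := (t : ℕ)) ht
      have e2 : ((finRotate (2 * r + 1 + 1)) t : ℕ) = t + 1 := by
        rw [show t = ⟨t, by omega⟩ from rfl, this]
      simp only [Function.comp]
      rw [e2]
      exact h _ (by omega)
    · have ht' : t = Fin.last (2 * r + 1) := by
        apply Fin.ext
        have := t.2
        simp only [Fin.val_last]
        omega
      have e2 : ((finRotate (2 * r + 1 + 1)) t : ℕ) = 0 := by
        rw [ht', finRotate_last]; rfl
      simp only [Function.comp]
      rw [e2, ← h0]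
      congr 1
      have := t.2
      omega
  rw [e]
  refine this.trans ?_
  have hs' : ∀ inst, @Equiv.Perm.sign (Fin (2 * (r + 1))) inst _ (finRotate (2 * r + 1 + 1)) = -1 := by
    intro inst
    rw [Subsingleton.elim inst (instDecidableEqFin _)]
    refine hs.trans ?_
    rw [pow_succ, pow_mul]
    simp
  rw [hs']
  simp

/-- The common shape of `H ∘ [𝟙, α₁]`. -/
lemma bracket_gen {M : Type*} [AddCommGroup M] [Module k M] {N : ℕ} (hN : 2 ≤ N) {l : V →ₗ[k] k}
    {Φ : (r : ℕ) → AlternatingMap k V k (Fin (2 * r))}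
    (hΦ0 : ∀ z : Fin (2 * 0) → V, Φ 0 z = 1) (x : ℕ → V) (H : (ℕ → V) → M)
    (hH : ∀ w w' : ℕ → V, (∀ m < N, w m = w' m) → H w = H w') :
    (∑ j ∈ Finset.range (N + 1), ∑ σ : Equiv.Perm (Fin N),
      ((-1 : ℤ) ^ j * (Equiv.Perm.sign σ : ℤ)) •
        AvS k V N l Φ 1 (N - 1) (permt V σ (removeN V j x)) •
          H (consT V (x j) (permt V σ (removeN V j x)))) -
    (∑ j ∈ Finset.range (N + 1), ∑ σ : Equiv.Perm (Fin N),
      ((-1 : ℤ) ^ (N - j) * (Equiv.Perm.sign σ : ℤ)) •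
        AvS k V N l Φ 1 (N - 1) (permt V σ (removeN V j x)) •
          H (putAt V (N - 1) (permt V σ (removeN V j x)) (x j))) =
    altS N x (fun z => l (z N) • H z) + altS N x (fun z => l (z N) • H z) := by
  rw [sub_eq_add_neg]
  congr 1
  · rw [← altS_cons]
    refine Finset.sum_congr rfl fun j hj => Finset.sum_congr rfl fun σ _ => ?_
    rw [AvS_one k hN hΦ0]
    have : N ≠ 0 := by omega
    simp [consT, this]
  · rw [altS_swap N x _ (N - 1) N (by omega) le_rfl, ← altS_snoc]
    congr 1
    refine Finset.sum_congr rfl fun j hj => Finset.sum_congr rfl fun σ _ => ?_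
    rw [AvS_one k hN hΦ0]
    have h1 : N - 1 < N := by omega
    have h2 : N ≠ N - 1 := by omega
    congr 2
    · simp [swapT, snocT, h1, h2]
    · apply hH
      intro m hm
      have h3 : m ≠ N := by omega
      simp only [putAt, swapT, snocT, hm, h3]
      simp

lemma bracket_mem {N : ℕ} (hN : 2 ≤ N) {l : V →ₗ[k] k}
    {Φ : (r : ℕ) → AlternatingMap k V k (Fin (2 * r))}
    (hΦ0 : ∀ z : Fin (2 * 0) → V, Φ 0 z = 1) (x : ℕ → V) :
    bracket1 k V N l Φ x ∈ wedgeIm k V N := by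
  have key : altS N x (fun z => l (z N) • tpN k V N z) ∈ wedgeIm k V N := by
    rw [← altS_snoc]
    refine Submodule.sum_mem _ fun j hj => ?_
    have : ∑ σ : Equiv.Perm (Fin N), ((-1 : ℤ) ^ (N - j) * (Equiv.Perm.sign σ : ℤ)) •
        (l (snocT N (x j) (permt V σ (removeN V j x)) x N) •
          tpN k V N (snocT N (x j) (permt V σ (removeN V j x)) x)) =
        ((-1 : ℤ) ^ (N - j)) • l (x j) • asymN k V N (removeN V j x) := by
      rw [asymN]
      refine Eq.trans ?_ (sum_gen k _ _ _ _)
      refine Finset.sum_congr rfl fun σ _ => ?_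
      have e : tpN k V N (snocT N (x j) (permt V σ (removeN V j x)) x) =
          tprod k (fun i : Fin N => removeN V j x (σ i)) := by
        unfold tpN
        congr 1
        funext i
        simp [snocT, permt]
      rw [e]
      simp only [snocT, lt_irrefl, if_false, if_true]
    rw [this]
    exact zsmul_mem (Submodule.smul_mem _ _ (wdgN k V N (removeN V j x)).2) _
  unfold bracket1
  rw [bracket_gen k hN hΦ0 x (fun z => tpN k V N z) (fun w w' h => tpN_congr k h)]
  exact add_mem key key

lemma lhs_eq {N : ℕ} (hN : 2 ≤ N) {l : V →ₗ[k] k}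
    {Φ : (r : ℕ) → AlternatingMap k V k (Fin (2 * r))}
    (hΦ0 : ∀ z : Fin (2 * 0) → V, Φ 0 z = 1) (x : ℕ → V) {i : ℕ} (hi : i ≤ N) :
    lhsB k V N l Φ i x =
      altS N x (fun z => l (z N) • AvS k V N l Φ i (N - i) z • tpN k V (N - i) z) +
      altS N x (fun z => l (z N) • AvS k V N l Φ i (N - i) z • tpN k V (N - i) z) := by
  unfold lhsB
  refine bracket_gen k hN hΦ0 x (fun z => AvS k V N l Φ i (N - i) z • tpN k V (N - i) z) ?_
  intro w w' h
  beta_reduce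
  rw [AvS_congr k (y' := w') (n' := N - i) (fun t ht => h _ (by omega)),
    tpN_congr k (fun m hm => h m (by omega))]

/-- Rewriting of `[𝟙, α_{i+1}]`. -/
lemma rhs_eq {N : ℕ} {l : V →ₗ[k] k}
    {Φ : (r : ℕ) → AlternatingMap k V k (Fin (2 * r))} (x : ℕ → V) {i : ℕ} (hi : i + 1 ≤ N) :
    rhsB k V N l Φ i x =
      altS N x (fun z => AvS k V N l Φ (i + 1) (N - i) z • tpN k V (N - i) z) +
      altS N x (fun z => AvS k V N l Φ (i + 1) (N - i - 1) (swapT (N - i - 1) N z) •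
        tpN k V (N - i) z) := by
  unfold rhsB
  rw [sub_eq_add_neg]
  congr 1
  · rw [← altS_cons]
    refine Finset.sum_congr rfl fun j hj => Finset.sum_congr rfl fun σ _ => ?_
    congr 2
    apply AvS_congr
    intro t ht
    have h1 : N - i + t ≠ 0 := by omega
    simp only [consT, h1, if_false]
    congr 1
    omega
  · rw [altS_swap N x _ (N - i - 1) N (by omega) le_rfl, ← altS_snoc]
    congr 1
    refine Finset.sum_congr rfl fun j hj => Finset.sum_congr rfl fun σ _ => ?_
    congr 2
    · apply AvS_congr
      intro t ht
      have h1 : N - i - 1 + t < N := by omega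
      have h2 : N - i - 1 + t ≠ N := by omega
      have h3 : N ≠ N - i - 1 := by omega
      have h4 : N - (i + 1) = N - i - 1 := by omega
      have h5 : N - i - 1 < N := by omega
      rw [h4]
      by_cases ht0 : t = 0
      · subst ht0
        simp [swapT, snocT, h3, h5]
      · simp [swapT, snocT, h1, h2, ht0]
    · apply tpN_congr
      intro m hm
      have h3 : m ≠ N := by omega
      have h1 : m < N := by omega
      have h4 : N - (i + 1) = N - i - 1 := by omega
      simp only [putAt, swapT, snocT, h1, h3, h4]
      simp

lemma main_eq {N : ℕ} (hN : 2 ≤ N) (hNodd : Odd N) {l : V →ₗ[k] k}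
    {Φ : (r : ℕ) → AlternatingMap k V k (Fin (2 * r))}
    (hΦ0 : ∀ z : Fin (2 * 0) → V, Φ 0 z = 1) {i : ℕ} (h1 : 1 ≤ i) (hi : i ≤ N) (x : ℕ → V) :
    lhsB k V N l Φ i x = rhsB k V N l Φ i x := by
  rw [lhs_eq k hN hΦ0 x hi]
  rcases Nat.even_or_odd' i with ⟨r, rfl | rfl⟩
  · have hlt : 2 * r + 1 ≤ N := by
      obtain ⟨s, rfl⟩ := hNodd
      omega
    rw [rhs_eq k x hlt]
    congr 1
    · symm
      rw [altS_swap N x _ (N - 2 * r) N (by omega) le_rfl, ← altS_neg]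
      apply altS_congr
      intro z
      rw [AvS_odd k hlt, AvS_even k hi, smul_smul, ← neg_smul]
      have e := phi_rot k (by omega) (Φ r) (fun t => swapT (N - 2 * r) N z (N - 2 * r + 1 + t))
        (fun t => z (N - 2 * r + t)) (by
          intro t ht
          have a1 : N - 2 * r + 1 + t ≠ N - 2 * r := by omega
          have a2 : N - 2 * r + 1 + t ≠ N := by omega
          simp only [swapT, a1, a2, if_false]
          congr 1
          omega) (by
          have a1 : N - 2 * r + 1 + (2 * r - 1) = N := by omega
          have a2 : N ≠ N - 2 * r := by omega
          simp only [a1]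
          simp [swapT, a2])
      rw [e]
      congr 1
      · simp [swapT]
      · apply tpN_congr
        intro m hm
        have a1 : m ≠ N - 2 * r := by omega
        have a2 : m ≠ N := by omega
        simp [swapT, a1, a2]
    · apply altS_congr
      intro z
      rw [AvS_odd k hlt, AvS_even k hi, smul_smul]
      congr 2
      · simp [swapT]
      · congr 1
        funext t
        have := t.2
        have a1 : N - 2 * r - 1 + 1 + (t : ℕ) ≠ N - 2 * r - 1 := by omega
        have a2 : N - 2 * r - 1 + 1 + (t : ℕ) ≠ N := by omega
        simp only [swapT, a1, a2, if_false]
        congr 1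
        omega
  · have hz : altS N x (fun z => l (z N) • AvS k V N l Φ (2 * r + 1) (N - (2 * r + 1)) z •
        tpN k V (N - (2 * r + 1)) z) = 0 := by
      have hs := altS_swap N x (fun z => l (z N) • AvS k V N l Φ (2 * r + 1) (N - (2 * r + 1)) z •
        tpN k V (N - (2 * r + 1)) z) (N - (2 * r + 1)) N (by omega) le_rfl
      refine zero_of_eq_neg k ?_
      refine hs.trans ?_
      congr 1
      apply altS_congr
      intro z
      rw [AvS_odd k hi, AvS_odd k hi, smul_smul, smul_smul]
      have a0 : N ≠ N - (2 * r + 1) := by omega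
      have b1 : swapT (N - (2 * r + 1)) N z N = z (N - (2 * r + 1)) := by simp [swapT, a0]
      have b2 : swapT (N - (2 * r + 1)) N z (N - (2 * r + 1)) = z N := by simp [swapT]
      have b3 : (fun t : Fin (2 * r) => swapT (N - (2 * r + 1)) N z (N - (2 * r + 1) + 1 + t)) =
          fun t : Fin (2 * r) => z (N - (2 * r + 1) + 1 + t) := by
        funext t
        have := t.2
        have a1 : N - (2 * r + 1) + 1 + (t : ℕ) ≠ N - (2 * r + 1) := by omega
        have a2 : N - (2 * r + 1) + 1 + (t : ℕ) ≠ N := by omega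
        simp only [swapT, a1, a2, if_false]
      rw [b1, b2, b3, mul_left_comm]
      congr 1
      apply tpN_congr
      intro m hm
      have a1 : m ≠ N - (2 * r + 1) := by omega
      have a2 : m ≠ N := by omega
      simp [swapT, a1, a2]
    rw [hz, add_zero]
    symm
    by_cases hlt : 2 * r + 1 + 1 ≤ N
    · rw [rhs_eq k x hlt, add_eq_zero_iff_eq_neg, ← altS_neg]
      apply altS_congr
      intro z
      rw [← neg_smul]
      congr 1
      have hlt' : 2 * (r + 1) ≤ N := by omega
      rw [show 2 * r + 1 + 1 = 2 * (r + 1) by ring, AvS_even k hlt', AvS_even k hlt']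
      refine phi_rot k (by omega) (Φ (r + 1)) (fun t => z (N - (2 * r + 1) + t))
        (fun t => swapT (N - (2 * r + 1) - 1) N z (N - (2 * r + 1) - 1 + t)) ?_ ?_
      · intro t ht
        have a1 : N - (2 * r + 1) - 1 + (t + 1) ≠ N - (2 * r + 1) - 1 := by omega
        have a2 : N - (2 * r + 1) - 1 + (t + 1) ≠ N := by omega
        simp only [swapT, a1, a2, if_false]
        congr 1
        omega
      · have a1 : N - (2 * r + 1) + (2 * (r + 1) - 1) = N := by omega
        simp [swapT, a1]
    · simp only [rhsB, AvS, hlt, if_false, zero_smul, zsmul_zero, Finset.sum_const_zero, sub_zero]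

variable (V)

/-- Let `V` have dimension `≥ N + 2` over a field of characteristic
zero, with `N` odd.  Let `l : V → k` be a linear form and `Φ_{2r} : ∧^{2r} V → k`
alternating forms for `2 ≤ 2r < N` (encoded as a family `Φ` with `Φ 0 = 1`).  Setting
`α_{2r} = 𝟙^{⊗(N-2r)} ⊗ Φ_{2r}` and `α_{2r+1} = 𝟙^{⊗(N-2r-1)} ⊗ l ⊗ Φ_{2r}` (restricted to
`∧^N V ⊆ V^{⊗N}`), these maps satisfy the PBW conditions: the image of
`[𝟙, α₁] = 𝟙 ⊗ α₁ - α₁ ⊗ 𝟙` on `∧^{N+1} V` is contained in `∧^N V`, and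
`α_i ∘ [𝟙, α₁] = [𝟙, α_{i+1}]` for `i = 1, …, N` (with `α_{N+1} = 0`). -/
theorem stmt14 [FiniteDimensional k V] (N : ℕ) (hN : 2 ≤ N) (hNodd : Odd N)
    (hdim : N + 2 ≤ Module.finrank k V)
    (l : V →ₗ[k] k) (Φ : (r : ℕ) → AlternatingMap k V k (Fin (2 * r)))
    (hΦ0 : ∀ z : Fin (2 * 0) → V, Φ 0 z = 1) :
    (∀ x : ℕ → V, bracket1 k V N l Φ x ∈ wedgeIm k V N) ∧
      ∀ (i : ℕ) (h1 : 1 ≤ i) (hi : i ≤ N) (x : ℕ → V),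
        lhsB k V N l Φ i x = rhsB k V N l Φ i x := by
  exact ⟨fun x => bracket_mem k hN hΦ0 x, fun i h1 hi x => main_eq k hN hNodd hΦ0 h1 hi x⟩

end PBW14
end
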